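/- Let (p,u,U) be a smooth solution of the incompressible Navier-Stokes equations on [0,T_0]×T^2 with T_0 < ∞, and let (p^{ε,δ},u^{ε,δ},U^{ε,δ}) solve the two-parameter relaxation system with smooth initial data. Assume there exists C_0 ≥ 1 independent of ε and δ such that: ‖u_0^{ε,δ} − u_0‖²_{L²(T²)} ≤ C_0 δ; ‖curl u_0^{ε,δ}‖²_{L²(T²)} + δ‖curl u_0^{ε,δ}‖²_{H¹(T²)} ≤ C_0; ‖div u_0^{ε,δ}‖²_{L²(T²)} + δ‖div u_0^{ε,δ}‖²_{H¹(T²)} ≤ C_0 δ^{−1} ε; ε‖p_0^{ε,δ}‖²_{L²(T²)} + δ²‖p_0^{ε,δ}‖²_{H¹(T²)} + δ³‖p_0^{ε,δ}‖²_{H²(T²)} ≤ C_0 δ; and ‖U_0^{ε,δ}‖²_{L²(T²)} + δ‖U_0^{ε,δ}‖²_{H¹(T²)} + δ²‖div U_0^{ε,δ}‖²_{H¹(T²)} ≤ C_0. Then there exists a positive constant μ_* ≪ 1, depending only on C_0, T_0 and u, such that for all sufficiently small ε and δ satisfying ε ≤ μ_* δ, the solution (u^{ε,δ},p^{ε,δ},U^{ε,δ})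 exists on [0,T_0], and for all t ∈ [0,T_0]: ‖u^{ε,δ}(t,·) − u(t,·)‖²_{L²(T²)} ≤ C δ; ‖curl u^{ε,δ}(t,·)‖²_{L²(T²)} + δ‖curl u^{ε,δ}(t,·)‖²_{H¹(T²)} ≤ C; and ‖div u^{ε,δ}(t,·)‖²_{L²(T²)} + δ‖div u^{ε,δ}(t,·)‖²_{H¹(T²)} ≤ C δ^{−1} ε, where C depends only on C_0, T_0 and u. -/

import Mathlib

/-!
Common setup: fields on the torus `𝕋^d = ℝ^d/ℤ^d` are modelled as `ℤ^d`-periodic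
functions on `ℝ^d`; all integrals are taken over the fundamental cell `[0,1]^d`.
-/

noncomputable section
open MeasureTheory Real
open scoped ENNReal

namespace NSRelax

/-- Spatial variable; fields on the torus are `ℤ^d`-periodic functions on `ℝ^d`. -/
abbrev Spc (d : ℕ) := Fin d → ℝ

/-- Vectors in `ℝ^m`. -/
abbrev Vec (m : ℕ) := Fin m → ℝ

/-- Fundamental cell `[0,1]^d` of the torus. -/
def cube (d : ℕ) : Set (Spc d) := Set.pi Set.univ fun _ => Set.Icc (0 : ℝ) 1

/-- `ℤ^d`-periodicity. -/
def Per {d : ℕ} {E : Type*} (f : Spc d → E) : Prop :=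
  ∀ (x : Spc d) (k : Fin d → ℤ), f (fun i => x i + (k i : ℝ)) = f x

/-- `i`-th spatial partial derivative of a scalar field. -/
def pd {d : ℕ} (i : Fin d) (f : Spc d → ℝ) (x : Spc d) : ℝ :=
  fderiv ℝ f x (Pi.single i 1)

/-- Time derivative of a time-dependent scalar field. -/
def dtS {d : ℕ} (p : ℝ → Spc d → ℝ) (t : ℝ) (x : Spc d) : ℝ :=
  deriv (fun s => p s x) t

/-- Time derivative of a time-dependent vector field. -/
def dtV {d m : ℕ} (u : ℝ → Spc d → Vec m) (t : ℝ) (x : Spc d) : Vec m :=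
  fun a => deriv (fun s => u s x a) t

/-- Time derivative of a time-dependent matrix field. -/
def dtM {d m : ℕ} (U : ℝ → Spc d → Fin m → Fin m → ℝ) (t : ℝ) (x : Spc d) :
    Fin m → Fin m → ℝ :=
  fun i j => deriv (fun s => U s x i j) t

section Norms

variable {d : ℕ} {ι : Type*} [Fintype ι]

/-- Pointwise squared Euclidean magnitude of an `ι`-indexed field. -/
def ptsq (v : Spc d → ι → ℝ) (x : Spc d) : ℝ := ∑ a, v x a ^ 2

/-- Pointwise squared magnitude of the first derivatives. -/
def ptsqD1 (v : Spc d → ι → ℝ) (x : Spc d) : ℝ :=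
  ∑ a, ∑ i, pd i (fun y => v y a) x ^ 2

/-- Pointwise squared magnitude of the second derivatives. -/
def ptsqD2 (v : Spc d → ι → ℝ) (x : Spc d) : ℝ :=
  ∑ a, ∑ i, ∑ j, pd i (pd j (fun y => v y a)) x ^ 2

/-- Pointwise squared magnitude of the third derivatives. -/
def ptsqD3 (v : Spc d → ι → ℝ) (x : Spc d) : ℝ :=
  ∑ a, ∑ i, ∑ j, ∑ k, pd i (pd j (pd k (fun y => v y a))) x ^ 2

/-- Squared `L²(𝕋^d)` norm. -/
def L2sq (v : Spc d → ι → ℝ) : ℝ := ∫ x in cube d, ptsq v x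

/-- Squared `L²(𝕋^d)` norm of the gradient. -/
def D1L2sq (v : Spc d → ι → ℝ) : ℝ := ∫ x in cube d, ptsqD1 v x

/-- Squared `L²(𝕋^d)` norm of the second derivatives. -/
def D2L2sq (v : Spc d → ι → ℝ) : ℝ := ∫ x in cube d, ptsqD2 v x

/-- Squared `L²(𝕋^d)` norm of the third derivatives. -/
def D3L2sq (v : Spc d → ι → ℝ) : ℝ := ∫ x in cube d, ptsqD3 v x

/-- Squared `H¹(𝕋^d)` norm. -/
def H1sq (v : Spc d → ι → ℝ) : ℝ := L2sq v + D1L2sq v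

/-- Squared `H²(𝕋^d)` norm. -/
def H2sq (v : Spc d → ι → ℝ) : ℝ := L2sq v + D1L2sq v + D2L2sq v

/-- Squared `H³(𝕋^d)` norm. -/
def H3sq (v : Spc d → ι → ℝ) : ℝ := L2sq v + D1L2sq v + D2L2sq v + D3L2sq v

/-- `L^p(𝕋^d)` norm. -/
def LpN (p : ℝ) (v : Spc d → ι → ℝ) : ℝ :=
  (∫ x in cube d, Real.sqrt (ptsq v x) ^ p) ^ (1 / p)

/-- `L^∞(𝕋^d)` norm (for continuous periodic fields). -/
def LinfN (v : Spc d → ι → ℝ) : ℝ := ⨆ x : Spc d, Real.sqrt (ptsq v x)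

end Norms

/-- View a scalar field as a one-component indexed field. -/
def sc {d : ℕ} (f : Spc d → ℝ) : Spc d → Vec 1 := fun x _ => f x

/-- View a matrix field as an indexed field. -/
def mtx {d m : ℕ} (U : Spc d → Fin m → Fin m → ℝ) : Spc d → Fin m × Fin m → ℝ :=
  fun x ij => U x ij.1 ij.2

/-- Divergence of a vector field. -/
def divv {d : ℕ} (v : Spc d → Vec d) (x : Spc d) : ℝ := ∑ i, pd i (fun y => v y i) x

/-- Row-wise divergence of a matrix field. -/
def divM {d : ℕ} (U : Spc d → Fin d → Fin d → ℝ) (x : Spc d) : Vec d :=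
  fun i => ∑ j, pd j (fun y => U y i j) x

/-- Laplacian of a scalar field. -/
def lapS {d : ℕ} (f : Spc d → ℝ) (x : Spc d) : ℝ := ∑ i, pd i (pd i f) x

/-- Componentwise Laplacian of a vector field. -/
def lapV {d m : ℕ} (v : Spc d → Vec m) (x : Spc d) : Vec m :=
  fun a => lapS (fun y => v y a) x

/-- Tensor product `u ⊗ v` of vector fields. -/
def tens {d : ℕ} (u v : Spc d → Vec d) (x : Spc d) : Fin d → Fin d → ℝ :=
  fun i j => u x i * v x j

/-- Curl of a three-dimensional vector field. -/
def curl3 (v : Spc 3 → Vec 3) (x : Spc 3) : Vec 3 :=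
  ![pd 1 (fun y => v y 2) x - pd 2 (fun y => v y 1) x,
    pd 2 (fun y => v y 0) x - pd 0 (fun y => v y 2) x,
    pd 0 (fun y => v y 1) x - pd 1 (fun y => v y 0) x]

/-- Scalar curl of a planar vector field. -/
def curl2 (v : Spc 2 → Vec 2) (x : Spc 2) : ℝ :=
  pd 0 (fun y => v y 1) x - pd 1 (fun y => v y 0) x

/-- Smoothness (jointly in time and space) of a scalar field. -/
def SmoothS {d : ℕ} (p : ℝ → Spc d → ℝ) : Prop :=
  ContDiff ℝ (⊤ : ℕ∞) fun q : ℝ × Spc d => p q.1 q.2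

/-- Smoothness (jointly in time and space) of a vector field. -/
def SmoothV {d m : ℕ} (u : ℝ → Spc d → Vec m) : Prop :=
  ContDiff ℝ (⊤ : ℕ∞) fun q : ℝ × Spc d => u q.1 q.2

/-- Smoothness (jointly in time and space) of a matrix field. -/
def SmoothM {d m : ℕ} (U : ℝ → Spc d → Fin m → Fin m → ℝ) : Prop :=
  ContDiff ℝ (⊤ : ℕ∞) fun q : ℝ × Spc d => U q.1 q.2

/-- Stress tensor `U = u ⊗ u − ∇u` of a Navier–Stokes solution. -/
def stress {d : ℕ} (u : ℝ → Spc d → Vec d) (t : ℝ) (x : Spc d) : Fin d → Fin d → ℝ :=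
  fun i j => u t x i * u t x j - pd j (fun y => u t y i) x

/-- Smooth solution of the incompressible Navier–Stokes equations on the time set `I`. -/
structure IsNS (d : ℕ) (I : Set ℝ) (p : ℝ → Spc d → ℝ) (u : ℝ → Spc d → Vec d) :
    Prop where
  smooth_p : SmoothS p
  smooth_u : SmoothV u
  per_p : ∀ t, Per (p t)
  per_u : ∀ t, Per (u t)
  div_free : ∀ t ∈ I, ∀ x, divv (u t) x = 0
  momentum : ∀ t ∈ I, ∀ x a,
    dtV u t x a + divM (tens (u t) (u t)) x a = -pd a (p t) x + lapV (u t) x a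
  mean_zero : ∀ t ∈ I, ∫ x in cube d, p t x = 0

/-- The time interval `[0, Tl)`. -/
def Itv (Tl : ℝ≥0∞) : Set ℝ := {t : ℝ | 0 ≤ t ∧ ENNReal.ofReal t < Tl}

/-- Solution of the two-parameter relaxation system on the time interval `[0, Tl)`,
with smooth initial data. -/
structure IsRelax (d : ℕ) (ε δ : ℝ) (Tl : ℝ≥0∞) (p : ℝ → Spc d → ℝ)
    (u : ℝ → Spc d → Vec d) (U : ℝ → Spc d → Fin d → Fin d → ℝ) : Prop where
  pos : 0 < Tl
  init_smooth : ContDiff ℝ (⊤ : ℕ∞) fun x : Spc d => (p 0 x, u 0 x, U 0 x)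
  per_p : ∀ t ∈ Itv Tl, Per (p t)
  per_u : ∀ t ∈ Itv Tl, Per (u t)
  per_U : ∀ t ∈ Itv Tl, Per (U t)
  cont : ContinuousOn (fun q : ℝ × Spc d => (p q.1 q.2, u q.1 q.2, U q.1 q.2))
    (Itv Tl ×ˢ (Set.univ : Set (Spc d)))
  smooth : ∀ t ∈ Itv Tl, 0 < t → ∀ x : Spc d,
    ContDiffAt ℝ (⊤ : ℕ∞) (fun q : ℝ × Spc d => (p q.1 q.2, u q.1 q.2, U q.1 q.2)) (t, x)
  mass : ∀ t ∈ Itv Tl, 0 < t → ∀ x, ε * dtS p t x + divv (u t) x = 0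
  momentum : ∀ t ∈ Itv Tl, 0 < t → ∀ x a,
    dtV u t x a + divM (U t) x a + pd a (p t) x = 0
  stress_eq : ∀ t ∈ Itv Tl, 0 < t → ∀ x i j,
    δ * dtM U t x i j + pd j (fun y => u t y i) x = u t x i * u t x j - U t x i j

/-- Relaxation solution whose lifespan `Tl` is maximal (among solutions with the
same initial data). -/
def IsMaxRelax (d : ℕ) (ε δ : ℝ) (Tl : ℝ≥0∞) (p : ℝ → Spc d → ℝ)
    (u : ℝ → Spc d → Vec d) (U : ℝ → Spc d → Fin d → Fin d → ℝ) : Prop :=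
  IsRelax d ε δ Tl p u U ∧
    ∀ (Tl' : ℝ≥0∞) (p' : ℝ → Spc d → ℝ) (u' : ℝ → Spc d → Vec d)
      (U' : ℝ → Spc d → Fin d → Fin d → ℝ),
      IsRelax d ε δ Tl' p' u' U' → p' 0 = p 0 → u' 0 = u 0 → U' 0 = U 0 → Tl' ≤ Tl

/-- Smooth solution of the intermediate affine system on `[0,T]`. -/
structure IsAffine (ε δ T : ℝ) (u : ℝ → Spc 3 → Vec 3) (p' : ℝ → Spc 3 → ℝ)
    (u' : ℝ → Spc 3 → Vec 3) (U' : ℝ → Spc 3 → Fin 3 → Fin 3 → ℝ) : Prop where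
  smooth_p : SmoothS p'
  smooth_u : SmoothV u'
  smooth_U : SmoothM U'
  per_p : ∀ t, Per (p' t)
  per_u : ∀ t, Per (u' t)
  per_U : ∀ t, Per (U' t)
  mass : ∀ t ∈ Set.Icc (0 : ℝ) T, ∀ x, ε * dtS p' t x + divv (u' t) x = 0
  momentum : ∀ t ∈ Set.Icc (0 : ℝ) T, ∀ x a,
    dtV u' t x a + divM (U' t) x a + pd a (p' t) x = 0
  stress_eq : ∀ t ∈ Set.Icc (0 : ℝ) T, ∀ x i j,
    δ * dtM U' t x i j + pd j (fun y => u' t y i) x = u t x i * u t x j - U' t x i j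

/-- `A = curl ∇·(v ⊗ v)`. -/
def Af (v : Spc 3 → Vec 3) (x : Spc 3) : Vec 3 :=
  curl3 (fun y => divM (tens v v) y) x

/-- `K = 1 + ‖(p,u,U)‖²_{C⁰H³}`. -/
def Kc (T0 : ℝ) (p : ℝ → Spc 3 → ℝ) (u : ℝ → Spc 3 → Vec 3) : ℝ :=
  1 + ⨆ t ∈ Set.Icc (0 : ℝ) T0, (H3sq (sc (p t)) + H3sq (u t) + H3sq (mtx (stress u t)))

/-- `K = 1 + ‖u‖²_{C⁰H³}`. -/
def Ku (T0 : ℝ) (u : ℝ → Spc 3 → Vec 3) : ℝ :=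
  1 + ⨆ t ∈ Set.Icc (0 : ℝ) T0, H3sq (u t)


/-- The space-time slab `(a, b) × ℝ²`. -/
def slab (a b : ℝ) : Set (ℝ × Spc 2) := Set.Ioo a b ×ˢ Set.univ

theorem isOpen_slab (a b : ℝ) : IsOpen (slab a b) := isOpen_Ioo.prod isOpen_univ

theorem mem_slab {a b : ℝ} {q : ℝ × Spc 2} : q ∈ slab a b ↔ q.1 ∈ Set.Ioo a b := by
  simp [slab]

/-- The algebra of functions that are smooth and spatially periodic on the slab. -/
def fieldAlg (a b : ℝ) : Subalgebra ℝ (ℝ × Spc 2 → ℝ) where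
  carrier := {f | ContDiffOn ℝ (⊤ : ℕ∞) f (slab a b) ∧
    ∀ t ∈ Set.Ioo a b, Per fun x : Spc 2 => f (t, x)}
  mul_mem' := fun hf hg =>
    ⟨hf.1.mul hg.1, fun t ht x k => congrArg₂ (· * ·) (hf.2 t ht x k) (hg.2 t ht x k)⟩
  add_mem' := fun hf hg =>
    ⟨hf.1.add hg.1, fun t ht x k => congrArg₂ (· + ·) (hf.2 t ht x k) (hg.2 t ht x k)⟩
  algebraMap_mem' := fun _ => ⟨contDiffOn_const, fun _ _ _ _ => rfl⟩

/-- Smooth periodic fields on the slab. -/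
abbrev Fd (a b : ℝ) : Type := fieldAlg a b

section Fields

variable {a b : ℝ}

theorem Fd.contDiffOn (f : Fd a b) : ContDiffOn ℝ (⊤ : ℕ∞) f.1 (slab a b) := f.2.1

theorem Fd.contDiffAt (f : Fd a b) {q : ℝ × Spc 2} (hq : q ∈ slab a b) :
    ContDiffAt ℝ (⊤ : ℕ∞) f.1 q := f.2.1.contDiffAt ((isOpen_slab a b).mem_nhds hq)

theorem Fd.differentiableAt (f : Fd a b) {q : ℝ × Spc 2} (hq : q ∈ slab a b) :
    DifferentiableAt ℝ f.1 q := (f.contDiffAt hq).differentiableAt (by simp)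

theorem Fd.per (f : Fd a b) {t : ℝ} (ht : t ∈ Set.Ioo a b) :
    Per fun x : Spc 2 => f.1 (t, x) := f.2.2 t ht

open Classical in
/-- Directional derivative on the slab, extended by zero. -/
def dirFun (a b : ℝ) (e : ℝ × Spc 2) (f : ℝ × Spc 2 → ℝ) (q : ℝ × Spc 2) : ℝ :=
  if q ∈ slab a b then fderiv ℝ f q e else 0

theorem dirFun_mem (e : ℝ × Spc 2) (f : Fd a b) : dirFun a b e f.1 ∈ fieldAlg a b := by
  constructor
  · have h : ContDiffOn ℝ (⊤ : ℕ∞) (fun q => fderiv ℝ f.1 q e) (slab a b) :=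
      (f.contDiffOn.fderiv_of_isOpen (isOpen_slab a b) (m := (⊤ : ℕ∞)) (by simp)).clm_apply
        contDiffOn_const
    exact h.congr fun q hq => by simp [dirFun, hq]
  · intro t ht x k
    have h1 : ((t, x) : ℝ × Spc 2) ∈ slab a b := mem_slab.2 ht
    have h2 : ((t, fun i => x i + (k i : ℝ)) : ℝ × Spc 2) ∈ slab a b := mem_slab.2 ht
    simp only [dirFun, h1, h2, if_true]
    set c : ℝ × Spc 2 := (0, fun i => (k i : ℝ))
    have hc : ((t, fun i => x i + (k i : ℝ)) : ℝ × Spc 2) = (t, x) + c := by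
      ext <;> simp [c]
    rw [hc, ← fderiv_comp_add_right (f := f.1)]
    congr 1
    apply Filter.EventuallyEq.fderiv_eq
    filter_upwards [(isOpen_slab a b).mem_nhds h1] with q hq
    have := f.per (mem_slab.1 hq) q.2 k
    have e2 : q + c = (q.1, fun i => q.2 i + (k i : ℝ)) := by ext <;> simp [c]
    rw [e2]
    exact this

/-- Directional derivative as a derivation of the algebra of fields. -/
def Dd (e : ℝ × Spc 2) : Derivation ℝ (Fd a b) (Fd a b) :=
  Derivation.mk'
    { toFun := fun f => ⟨dirFun a b e f.1, dirFun_mem e f⟩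
      map_add' := fun f g => by
        ext q
        by_cases hq : q ∈ slab a b
        · simp [dirFun, hq, fderiv_add (f.differentiableAt hq) (g.differentiableAt hq)]
        · simp [dirFun, hq]
      map_smul' := fun c f => by
        ext q
        by_cases hq : q ∈ slab a b
        · simp [dirFun, hq, fderiv_const_smul (f.differentiableAt hq)]
        · simp [dirFun, hq] }
    fun f g => by
      ext q
      by_cases hq : q ∈ slab a b
      · simp [dirFun, hq, fderiv_mul (f.differentiableAt hq) (g.differentiableAt hq)]
      · simp [dirFun, hq]

/-- Time derivative of fields. -/
abbrev Dt : Derivation ℝ (Fd a b) (Fd a b) := Dd (1, 0)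

/-- Spatial derivative of fields. -/
abbrev Dx (i : Fin 2) : Derivation ℝ (Fd a b) (Fd a b) := Dd (0, Pi.single i 1)

theorem Dd_apply (e : ℝ × Spc 2) (f : Fd a b) {q : ℝ × Spc 2} (hq : q ∈ slab a b) :
    (Dd e f).1 q = fderiv ℝ f.1 q e := by
  simp [Dd, dirFun, hq]

theorem Dd_comm (e e' : ℝ × Spc 2) (f : Fd a b) : Dd e (Dd e' f) = Dd e' (Dd e f) := by
  ext q
  by_cases hq : q ∈ slab a b
  · have key : ∀ e e' : ℝ × Spc 2, (Dd e (Dd e' f)).1 q = fderiv ℝ (fderiv ℝ f.1) q e e' := by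
      intro e e'
      rw [Dd_apply _ _ hq]
      have : (Dd e' f).1 =ᶠ[nhds q] fun r => fderiv ℝ f.1 r e' := by
        filter_upwards [(isOpen_slab a b).mem_nhds hq] with r hr using Dd_apply _ _ hr
      rw [this.fderiv_eq]
      have hd : DifferentiableAt ℝ (fderiv ℝ f.1) q :=
        ((f.contDiffAt hq).fderiv_right (m := 1) (WithTop.coe_le_coe.2 le_top)).differentiableAt
          (by simp)
      rw [fderiv_clm_apply hd (differentiableAt_const _)]
      simp
    rw [key, key]
    exact ((f.contDiffAt hq).isSymmSndFDerivAt (by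
      rw [minSmoothness_of_isRCLikeNormedField]
      exact WithTop.coe_le_coe.2 (le_top : (2 : ℕ∞) ≤ ⊤))).eq _ _
  · simp [Dd, dirFun, hq]

theorem Dx_apply (i : Fin 2) (f : Fd a b) {t : ℝ} (ht : t ∈ Set.Ioo a b) (x : Spc 2) :
    (Dx i f).1 (t, x) = pd i (fun y => f.1 (t, y)) x := by
  have hq : ((t, x) : ℝ × Spc 2) ∈ slab a b := mem_slab.2 ht
  rw [Dd_apply _ _ hq, pd]
  have h1 : HasFDerivAt (fun y : Spc 2 => ((t, y) : ℝ × Spc 2))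
      (ContinuousLinearMap.inr ℝ ℝ (Spc 2)) x := hasFDerivAt_prodMk_right t x
  have := (f.differentiableAt hq).hasFDerivAt.comp x h1
  rw [show (fun y => f.1 (t, y)) = f.1 ∘ fun y => (t, y) from rfl, this.fderiv]
  simp

theorem hasDerivAt_time (f : Fd a b) {t : ℝ} (ht : t ∈ Set.Ioo a b) (x : Spc 2) :
    HasDerivAt (fun s => f.1 (s, x)) ((Dt f).1 (t, x)) t := by
  have hq : ((t, x) : ℝ × Spc 2) ∈ slab a b := mem_slab.2 ht
  rw [Dd_apply _ _ hq]
  have h1 : HasDerivAt (fun s : ℝ => ((s, x) : ℝ × Spc 2)) (1, 0) t :=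
    (hasDerivAt_id t).prodMk (hasDerivAt_const t x)
  exact (f.differentiableAt hq).hasFDerivAt.comp_hasDerivAt t h1

theorem Dt_apply (f : Fd a b) {t : ℝ} (ht : t ∈ Set.Ioo a b) (x : Spc 2) :
    (Dt f).1 (t, x) = deriv (fun s => f.1 (s, x)) t := (hasDerivAt_time f ht x).deriv.symm

theorem Fd.slice_contDiff (f : Fd a b) {t : ℝ} (ht : t ∈ Set.Ioo a b) :
    ContDiff ℝ (⊤ : ℕ∞) fun x : Spc 2 => f.1 (t, x) :=
  contDiff_iff_contDiffAt.2 fun x =>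
    (f.contDiffAt (mem_slab.2 ht : ((t, x) : ℝ × Spc 2) ∈ slab a b)).comp x
      (contDiffAt_const.prodMk contDiffAt_id)

theorem Fd.slice_continuous (f : Fd a b) {t : ℝ} (ht : t ∈ Set.Ioo a b) :
    Continuous fun x : Spc 2 => f.1 (t, x) := (f.slice_contDiff ht).continuous

/-- If two fields agree at time `t`, so do their spatial derivatives. -/
theorem Dx_congr (i : Fin 2) {f g : Fd a b} {t : ℝ} (ht : t ∈ Set.Ioo a b)
    (h : ∀ x, f.1 (t, x) = g.1 (t, x)) (x : Spc 2) :
    (Dx i f).1 (t, x) = (Dx i g).1 (t, x) := by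
  rw [Dx_apply i f ht, Dx_apply i g ht, funext h]

theorem cube_eq_Icc : cube 2 = Set.Icc (0 : Spc 2) 1 := by
  rw [cube, Set.pi_univ_Icc]; rfl

theorem isCompact_cube : IsCompact (cube 2) := by
  rw [cube_eq_Icc]; exact isCompact_Icc

theorem measurableSet_cube : MeasurableSet (cube 2) := isCompact_cube.measurableSet

theorem volume_cube : volume (cube 2) = 1 := by
  rw [cube_eq_Icc, Real.volume_Icc_pi]; simp

instance : IsProbabilityMeasure (volume.restrict (cube 2)) :=
  ⟨by rw [Measure.restrict_apply_univ, volume_cube]⟩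

theorem integrableOn_cube {f : Spc 2 → ℝ} (hf : Continuous f) : IntegrableOn f (cube 2) :=
  hf.continuousOn.integrableOn_compact isCompact_cube

theorem integral_pd_eq_zero (i : Fin 2) {f : Spc 2 → ℝ} (hf : ContDiff ℝ 1 f) (hp : Per f) :
    ∫ x in cube 2, pd i f x = 0 := by
  have hc : Continuous fun x => fderiv ℝ f x := hf.continuous_fderiv (by simp)
  have key := integral_divergence_of_hasFDerivAt_off_countable' (E := ℝ) (n := 1)
    (0 : Spc 2) 1 (fun i => zero_le_one) (fun j x => if j = i then f x else 0)
    (fun j x => if j = i then fderiv ℝ f x else 0) ∅ Set.countable_empty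
    (fun j => by
      by_cases h : j = i
      · simpa [h] using hf.continuous.continuousOn
      · simpa [h] using continuousOn_const)
    (fun x _ j => by
      by_cases h : j = i
      · simpa [h] using (hf.differentiable (by simp) x).hasFDerivAt
      · simpa [h] using hasFDerivAt_const (0 : ℝ) x)
    (by
      refine (Continuous.continuousOn ?_).integrableOn_compact isCompact_Icc
      refine continuous_finsetSum _ fun j _ => ?_
      by_cases h : j = i
      · simpa [h] using hc.clm_apply continuous_const
      · simpa [h] using continuous_const)
  rw [cube_eq_Icc]
  have e1 : ∀ x : Spc 2, pd i f x
      = ∑ j, (if j = i then fderiv ℝ f x else 0) (Pi.single j (1 : ℝ)) := by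
    intro x
    rw [Finset.sum_eq_single i]
    · simp [pd]
    · intro j _ h; simp [h]
    · simp
  simp_rw [e1]
  rw [key]
  apply Finset.sum_eq_zero
  intro j _
  rw [sub_eq_zero]
  refine setIntegral_congr_fun measurableSet_Icc fun y _ => ?_
  by_cases h : j = i
  · subst h
    have := hp (j.insertNth (0 : ℝ) y) (Pi.single j 1)
    simp only [if_true]
    rw [Pi.one_apply, Pi.zero_apply, ← this]
    congr 1
    funext l
    refine Fin.succAboveCases j ?_ (fun m => ?_) l
    · simp
    · simp
  · simp [h]

/-- Integral of a field over the cell at time `t`. -/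
def Int (t : ℝ) (f : Fd a b) : ℝ := ∫ x in cube 2, f.1 (t, x)

theorem Int_add {t : ℝ} (ht : t ∈ Set.Ioo a b) (f g : Fd a b) :
    Int t (f + g) = Int t f + Int t g :=
  integral_add (integrableOn_cube (f.slice_continuous ht)) (integrableOn_cube (g.slice_continuous ht))

theorem Int_sub {t : ℝ} (ht : t ∈ Set.Ioo a b) (f g : Fd a b) :
    Int t (f - g) = Int t f - Int t g :=
  integral_sub (integrableOn_cube (f.slice_continuous ht)) (integrableOn_cube (g.slice_continuous ht))

theorem Int_smul (t c : ℝ) (f : Fd a b) : Int t (c • f) = c * Int t f :=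
  integral_const_mul c _

theorem Int_mono {t : ℝ} (ht : t ∈ Set.Ioo a b) {f g : Fd a b}
    (h : ∀ x, f.1 (t, x) ≤ g.1 (t, x)) : Int t f ≤ Int t g :=
  setIntegral_mono (integrableOn_cube (f.slice_continuous ht))
    (integrableOn_cube (g.slice_continuous ht)) h

theorem Int_nonneg {t : ℝ} {f : Fd a b} (h : ∀ x, 0 ≤ f.1 (t, x)) : 0 ≤ Int t f :=
  integral_nonneg h

theorem Int_congr {t : ℝ} {f g : Fd a b} (h : ∀ x, f.1 (t, x) = g.1 (t, x)) :
    Int t f = Int t g := by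
  simp only [Int, h]

theorem Int_Dx (i : Fin 2) {t : ℝ} (ht : t ∈ Set.Ioo a b) (f : Fd a b) :
    Int t (Dx i f) = 0 := by
  simp only [Int, Dx_apply i f ht]
  exact integral_pd_eq_zero i ((f.slice_contDiff ht).of_le (by simp)) (f.per ht)

theorem hasDerivAt_Int {t : ℝ} (ht : t ∈ Set.Ioo a b) (f : Fd a b) :
    HasDerivAt (fun s => Int s f) (Int t (Dt f)) t := by
  obtain ⟨l, hl, r, hr, hlt, hrt⟩ : ∃ l, l ∈ Set.Ioo a b ∧ ∃ r, r ∈ Set.Ioo a b ∧ l < t ∧ t < r := by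
    obtain ⟨l, h1, h2⟩ := exists_between ht.1
    obtain ⟨r, h3, h4⟩ := exists_between ht.2
    exact ⟨l, ⟨h1, h2.trans ht.2⟩, r, ⟨ht.1.trans h3, h4⟩, h2, h3⟩
  have hsub : Set.Icc l r ×ˢ cube 2 ⊆ slab a b := fun q hq =>
    mem_slab.2 ⟨hl.1.trans_le hq.1.1, hq.1.2.trans_lt hr.2⟩
  obtain ⟨M, hM⟩ := (isCompact_Icc.prod isCompact_cube).exists_bound_of_continuousOn
    ((Dt f).contDiffOn.continuousOn.mono hsub)
  have hmem : ∀ s ∈ Set.Ioo l r, s ∈ Set.Ioo a b := fun s hs =>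
    ⟨hl.1.trans hs.1, hs.2.trans hr.2⟩
  refine (hasDerivAt_integral_of_dominated_loc_of_deriv_le (μ := volume.restrict (cube 2))
    (F := fun s x => f.1 (s, x)) (F' := fun s x => (Dt f).1 (s, x)) (bound := fun _ => M)
    (s := Set.Ioo l r) (x₀ := t) (Ioo_mem_nhds hlt hrt) ?_ ?_ ?_ ?_ ?_ ?_).2
  · filter_upwards [Ioo_mem_nhds hlt hrt] with s hs
    exact (f.slice_continuous (hmem s hs)).aestronglyMeasurable
  · exact integrableOn_cube (f.slice_continuous ht)
  · exact ((Dt f).slice_continuous ht).aestronglyMeasurable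
  · filter_upwards [ae_restrict_mem measurableSet_cube] with x hx s hs
    exact hM (s, x) ⟨⟨hs.1.le, hs.2.le⟩, hx⟩
  · exact integrable_const M
  · exact Filter.Eventually.of_forall fun x s hs => hasDerivAt_time f (hmem s hs) x

end Fields

section Sobolev

theorem integral_cube_eq {F : Spc 2 → ℝ} (hF : Continuous F) :
    ∫ z in cube 2, F z = ∫ x in (0:ℝ)..1, ∫ y in (0:ℝ)..1, F ![x, y] := by
  have hmp := (volume_preserving_finTwoArrow ℝ).symm
  have himg : (MeasurableEquiv.finTwoArrow (α := ℝ)).symm ⁻¹' (cube 2)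
      = Set.Icc (0:ℝ) 1 ×ˢ Set.Icc (0:ℝ) 1 := by
    ext q
    simp [cube, MeasurableEquiv.finTwoArrow, Fin.forall_fin_two, Pi.le_def, Prod.le_def]
  have h1 : ∫ z in cube 2, F z
      = ∫ q in Set.Icc (0:ℝ) 1 ×ˢ Set.Icc (0:ℝ) 1, F ![q.1, q.2] := by
    rw [← himg, ← hmp.setIntegral_preimage_emb (MeasurableEquiv.measurableEmbedding _)]
    rfl
  have hc : Continuous fun q : ℝ × ℝ => F ![q.1, q.2] := by
    refine hF.comp (continuous_pi fun i => ?_)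
    fin_cases i
    · exact continuous_fst
    · exact continuous_snd
  rw [h1, Measure.volume_eq_prod, setIntegral_prod]
  · rw [intervalIntegral.integral_of_le zero_le_one, integral_Icc_eq_integral_Ioc]
    refine setIntegral_congr_fun measurableSet_Ioc fun x _ => ?_
    rw [intervalIntegral.integral_of_le zero_le_one, integral_Icc_eq_integral_Ioc]
  · rw [← Measure.volume_eq_prod]
    exact hc.continuousOn.integrableOn_compact (isCompact_Icc.prod isCompact_Icc)

theorem abs_le_integral_add {h h' : ℝ → ℝ} (hd : ∀ x, HasDerivAt h (h' x) x)
    (hc : Continuous h') {x : ℝ} (hx : x ∈ Set.Icc (0:ℝ) 1) :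
    |h x| ≤ ∫ s in (0:ℝ)..1, (|h s| + |h' s|) := by
  have hh : Continuous h := continuous_iff_continuousAt.2 fun x => (hd x).continuousAt
  have hi : IntervalIntegrable (fun s => |h' s|) volume 0 1 := hc.abs.intervalIntegrable _ _
  have hbase : ∀ s ∈ Set.Icc (0:ℝ) 1, |h x| ≤ |h s| + ∫ r in (0:ℝ)..1, |h' r| := by
    intro s hs
    have h1 : h x - h s = ∫ r in s..x, h' r :=
      (intervalIntegral.integral_eq_sub_of_hasDerivAt (fun r _ => hd r)
        (hc.intervalIntegrable _ _)).symm
    have h2 : |∫ r in s..x, h' r| ≤ |(∫ r in s..x, |h' r|)| := by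
      simpa [Real.norm_eq_abs] using intervalIntegral.norm_integral_le_abs_integral_norm
        (f := h') (a := s) (b := x) (μ := volume)
    have h3 : |(∫ r in s..x, |h' r|)| ≤ ∫ r in (0:ℝ)..1, |h' r| := by
      rw [← abs_of_nonneg (intervalIntegral.integral_nonneg zero_le_one
        (fun r _ => abs_nonneg (h' r)))]
      refine intervalIntegral.abs_integral_mono_interval ?_
        (Filter.Eventually.of_forall fun r => abs_nonneg _) hi
      rw [Set.uIoc_of_le zero_le_one]
      intro r hr
      rw [Set.mem_uIoc] at hr
      rcases hr with hr | hr
      · exact ⟨hs.1.trans_lt hr.1, hr.2.trans hx.2⟩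
      · exact ⟨hx.1.trans_lt hr.1, hr.2.trans hs.2⟩
    have h4 : |h x| ≤ |h s| + |h x - h s| := by
      have := abs_add_le (h s) (h x - h s)
      simpa using this
    rw [h1] at h4
    linarith
  have := intervalIntegral.integral_mono_on (a := (0:ℝ)) (b := 1) (μ := volume) zero_le_one
    (intervalIntegrable_const (c := |h x|))
    ((hh.abs.intervalIntegrable _ _).add
      (intervalIntegrable_const (c := ∫ r in (0:ℝ)..1, |h' r|))) hbase
  rw [intervalIntegral.integral_add (hh.abs.intervalIntegrable _ _) intervalIntegrable_const] at this
  rw [intervalIntegral.integral_add (hh.abs.intervalIntegrable _ _) hi]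
  simpa using this

theorem continuous_pd {f : Spc 2 → ℝ} (hf : ContDiff ℝ (⊤ : ℕ∞) f) (i : Fin 2) :
    ContDiff ℝ (⊤ : ℕ∞) (pd i f) :=
  (hf.fderiv_right (m := (⊤ : ℕ∞)) (by simp)).clm_apply contDiff_const

theorem hasDerivAt_pd_zero {f : Spc 2 → ℝ} (hf : ContDiff ℝ (⊤ : ℕ∞) f) (x y : ℝ) :
    HasDerivAt (fun s => f ![s, y]) (pd 0 f ![x, y]) x := by
  have h1 : HasDerivAt (fun s : ℝ => (![s, y] : Spc 2)) (Pi.single 0 1) x := by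
    rw [hasDerivAt_pi]
    intro i
    fin_cases i
    · simpa using hasDerivAt_id' x
    · simpa using hasDerivAt_const x y
  exact (hf.differentiable (by simp) _).hasFDerivAt.comp_hasDerivAt x h1

theorem hasDerivAt_pd_one {f : Spc 2 → ℝ} (hf : ContDiff ℝ (⊤ : ℕ∞) f) (x y : ℝ) :
    HasDerivAt (fun s => f ![x, s]) (pd 1 f ![x, y]) y := by
  have h1 : HasDerivAt (fun s : ℝ => (![x, s] : Spc 2)) (Pi.single 1 1) y := by
    rw [hasDerivAt_pi]
    intro i
    fin_cases i
    · simpa using hasDerivAt_const y x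
    · simpa using hasDerivAt_id' y
  exact (hf.differentiable (by simp) _).hasFDerivAt.comp_hasDerivAt y h1

theorem continuous_vec2 : Continuous fun q : ℝ × ℝ => (![q.1, q.2] : Spc 2) := by
  refine continuous_pi fun i => ?_
  fin_cases i
  · exact continuous_fst
  · exact continuous_snd

theorem abs_le_integral_cube {f : Spc 2 → ℝ} (hf : ContDiff ℝ (⊤ : ℕ∞) f) (hp : Per f)
    (z : Spc 2) :
    |f z| ≤ ∫ x in cube 2, (|f x| + |pd 0 f x| + |pd 1 f x| + |pd 1 (pd 0 f) x|) := by
  have h0 := continuous_pd hf 0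
  have h1 := continuous_pd hf 1
  have h01 := continuous_pd h0 1
  have hcx : ∀ y : ℝ, Continuous fun s : ℝ => (![s, y] : Spc 2) := fun y =>
    continuous_vec2.comp (continuous_id.prodMk continuous_const)
  have hcy : ∀ x : ℝ, Continuous fun s : ℝ => (![x, s] : Spc 2) := fun y =>
    continuous_vec2.comp (continuous_const.prodMk continuous_id)
  have main : ∀ x ∈ Set.Icc (0:ℝ) 1, ∀ y ∈ Set.Icc (0:ℝ) 1, |f ![x, y]| ≤
      ∫ x in cube 2, (|f x| + |pd 0 f x| + |pd 1 f x| + |pd 1 (pd 0 f) x|) := by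
    intro x hx y hy
    have hF : Continuous fun x => |f x| + |pd 0 f x| + |pd 1 f x| + |pd 1 (pd 0 f) x| :=
      ((hf.continuous.abs.add h0.continuous.abs).add h1.continuous.abs).add h01.continuous.abs
    rw [integral_cube_eq hF]
    refine (abs_le_integral_add (fun s => hasDerivAt_pd_zero hf s y)
      (h0.continuous.comp (hcx y)) hx).trans ?_
    refine intervalIntegral.integral_mono_on zero_le_one ?_ ?_ ?_
    · exact (((hf.continuous.comp (hcx y)).abs.add
        (h0.continuous.comp (hcx y)).abs).intervalIntegrable _ _)
    · refine Continuous.intervalIntegrable ?_ _ _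
      exact intervalIntegral.continuous_parametric_intervalIntegral_of_continuous'
        (f := fun s r => |f ![s, r]| + |pd 0 f ![s, r]| + |pd 1 f ![s, r]|
          + |pd 1 (pd 0 f) ![s, r]|) (hF.comp continuous_vec2) 0 1
    · intro s _
      have e1 := abs_le_integral_add (fun r => hasDerivAt_pd_one hf s r)
        (h1.continuous.comp (hcy s)) hy
      have e2 := abs_le_integral_add (fun r => hasDerivAt_pd_one h0 s r)
        (h01.continuous.comp (hcy s)) hy
      refine (add_le_add e1 e2).trans (le_of_eq ?_)
      rw [← intervalIntegral.integral_add]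
      · refine intervalIntegral.integral_congr fun r _ => ?_
        ring
      · exact ((hf.continuous.comp (hcy s)).abs.add
          (h1.continuous.comp (hcy s)).abs).intervalIntegrable _ _
      · exact ((h0.continuous.comp (hcy s)).abs.add
          (h01.continuous.comp (hcy s)).abs).intervalIntegrable _ _
  have e : f z = f ![Int.fract (z 0), Int.fract (z 1)] := by
    have := hp ![Int.fract (z 0), Int.fract (z 1)] ![⌊z 0⌋, ⌊z 1⌋]
    rw [← this]
    congr 1
    funext i
    fin_cases i <;> simp
  rw [e]
  exact main _ ⟨Int.fract_nonneg _, (Int.fract_lt_one _).le⟩ _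
    ⟨Int.fract_nonneg _, (Int.fract_lt_one _).le⟩

variable {a b : ℝ}

theorem Fd.sq_le {t : ℝ} (ht : t ∈ Set.Ioo a b) (f : Fd a b) {l : ℝ} (hl : 0 < l) (x : Spc 2) :
    f.1 (t, x) ^ 2 ≤ (3 + l) * Int t (f ^ 2) + 2 * Int t (Dx 0 f ^ 2) + 2 * Int t (Dx 1 f ^ 2)
      + l⁻¹ * Int t (Dx 1 (Dx 0 f) ^ 2) := by
  have h := abs_le_integral_cube ((f ^ 2).slice_contDiff ht) ((f ^ 2).per ht) x
  have e0 : pd 0 (fun y => (f ^ 2).1 (t, y)) = fun y => (Dx 0 (f ^ 2)).1 (t, y) :=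
    funext fun y => (Dx_apply 0 _ ht y).symm
  have e1 : pd 1 (fun y => (f ^ 2).1 (t, y)) = fun y => (Dx 1 (f ^ 2)).1 (t, y) :=
    funext fun y => (Dx_apply 1 _ ht y).symm
  have e01 : pd 1 (fun y => (Dx 0 (f ^ 2)).1 (t, y)) = fun y => (Dx 1 (Dx 0 (f ^ 2))).1 (t, y) :=
    funext fun y => (Dx_apply 1 _ ht y).symm
  rw [e0, e01, e1] at h
  have hlhs : f.1 (t, x) ^ 2 ≤ |(f ^ 2).1 (t, x)| := le_abs_self _
  refine (hlhs.trans h).trans ?_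
  rw [← Int_smul, ← Int_smul, ← Int_smul, ← Int_smul, ← Int_add ht, ← Int_add ht, ← Int_add ht]
  refine setIntegral_mono ?_ (integrableOn_cube (Fd.slice_continuous _ ht)) fun y => ?_
  · exact integrableOn_cube ((((Fd.slice_continuous _ ht).abs.add
      (Fd.slice_continuous _ ht).abs).add (Fd.slice_continuous _ ht).abs).add
      (Fd.slice_continuous _ ht).abs)
  · simp only [pow_two, Derivation.leibniz, map_add, smul_eq_mul]
    simp only [Subalgebra.coe_add, Subalgebra.coe_mul, Subalgebra.coe_smul, Pi.add_apply,
      Pi.mul_apply, Pi.smul_apply, smul_eq_mul]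
    generalize f.1 (t, y) = v
    generalize (Dx 0 f).1 (t, y) = v0
    generalize (Dx 1 f).1 (t, y) = v1
    generalize (Dx 1 (Dx 0 f)).1 (t, y) = v01
    have a0 : |v * v0 + v * v0| ≤ v * v + v0 * v0 := by
      rw [abs_le]; constructor <;> nlinarith [sq_nonneg (v - v0), sq_nonneg (v + v0)]
    have a1 : |v * v1 + v * v1| ≤ v * v + v1 * v1 := by
      rw [abs_le]; constructor <;> nlinarith [sq_nonneg (v - v1), sq_nonneg (v + v1)]
    have a2 : |v0 * v1 + v0 * v1| ≤ v0 * v0 + v1 * v1 := by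
      rw [abs_le]; constructor <;> nlinarith [sq_nonneg (v0 - v1), sq_nonneg (v0 + v1)]
    have a3 : |v * v01 + v * v01| ≤ l * (v * v) + l⁻¹ * (v01 * v01) := by
      have i1 : 0 ≤ l⁻¹ * (l * v - v01) ^ 2 := by positivity
      have i2 : 0 ≤ l⁻¹ * (l * v + v01) ^ 2 := by positivity
      have c1 : l⁻¹ * (l * v - v01) ^ 2 = l * (v * v) + l⁻¹ * (v01 * v01) - 2 * (v * v01) := by
        field_simp; ring
      have c2 : l⁻¹ * (l * v + v01) ^ 2 = l * (v * v) + l⁻¹ * (v01 * v01) + 2 * (v * v01) := by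
        field_simp; ring
      rw [abs_le]; constructor <;> linarith
    have a4 : |v * v01 + v0 * v1 + (v * v01 + v0 * v1)| ≤
        |v * v01 + v * v01| + |v0 * v1 + v0 * v1| := by
      have := abs_add_le (v * v01 + v * v01) (v0 * v1 + v0 * v1)
      refine (le_of_eq ?_).trans this; congr 1; ring
    rw [abs_of_nonneg (mul_self_nonneg v)]
    linarith

/-- Gagliardo-Nirenberg: `‖(∂ᵢf)²‖² ≤ 9 K² ‖∂ᵢᵢf‖²` when `f² ≤ K²`. -/
theorem Int_Dx_pow_four {t : ℝ} (ht : t ∈ Set.Ioo a b) (f : Fd a b) (i : Fin 2) {B : ℝ}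
    (hB : ∀ x, f.1 (t, x) ^ 2 ≤ B) :
    Int t (Dx i f ^ 4) ≤ 9 * B * Int t (Dx i (Dx i f) ^ 2) := by
  have h0 : Int t (Dx i (f * Dx i f ^ 3)) = 0 := Int_Dx i ht _
  have e : Dx i (f * Dx i f ^ 3) = Dx i f ^ 4 + (3 : ℝ) • (f * Dx i f ^ 2 * Dx i (Dx i f)) := by
    simp only [Derivation.leibniz, Derivation.leibniz_pow, smul_eq_mul]
    simp only [Algebra.smul_def, map_ofNat]
    push_cast
    ring
  rw [e, Int_add ht, Int_smul] at h0
  have h1 : Int t ((-3 : ℝ) • (f * Dx i f ^ 2 * Dx i (Dx i f)))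
      ≤ Int t ((1 / 2 : ℝ) • Dx i f ^ 4 + (9 / 2 * B) • Dx i (Dx i f) ^ 2) := by
    refine Int_mono ht fun x => ?_
    simp only [Subalgebra.coe_add, Subalgebra.coe_mul, Subalgebra.coe_smul, Pi.add_apply,
      Pi.mul_apply, Pi.smul_apply, smul_eq_mul, Subalgebra.coe_pow, Pi.pow_apply]
    have := hB x
    generalize f.1 (t, x) = v at *
    generalize (Dx i f).1 (t, x) = v0
    generalize (Dx i (Dx i f)).1 (t, x) = v1
    nlinarith [sq_nonneg (v0 ^ 2 + 3 * v * v1), mul_nonneg (sub_nonneg.2 this) (sq_nonneg v1)]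
  rw [Int_smul, Int_add ht, Int_smul, Int_smul] at h1
  linarith

end Sobolev

section Energy

variable {a b : ℝ}

/-- The weighted quadratic form controlled by the energy. -/
def coreForm (ε δ : ℝ) (q : Fd a b) (v : Fin 2 → Fd a b) (V : Fin 2 → Fin 2 → Fd a b) : Fd a b :=
  ε • q ^ 2 + ∑ i, v i ^ 2 + δ • ∑ i, ∑ j, V i j ^ 2 + δ ^ 2 • ∑ i, Dt (v i) ^ 2
    + δ • ∑ i, ∑ j, Dx j (v i) ^ 2 + (δ ^ 2 / ε) • (∑ i, Dx i (v i)) ^ 2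

/-- The modified energy density of the linearised relaxation system. -/
def energyForm (ε δ : ℝ) (q : Fd a b) (v : Fin 2 → Fd a b) (V : Fin 2 → Fin 2 → Fd a b) :
    Fd a b :=
  ε • q ^ 2 + ∑ i, v i ^ 2 + (δ / 2) • ∑ i, ∑ j, V i j ^ 2 + δ • ∑ i, Dt (v i) * v i
    + ((δ + ε / 4) * δ / 2) • ∑ i, Dt (v i) ^ 2 + ((δ + ε / 4) / 2) • ∑ i, ∑ j, Dx j (v i) ^ 2
    + ((δ + ε / 4) * δ / (2 * ε)) • (∑ i, Dx i (v i)) ^ 2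
    - (δ + ε / 4) • (q * ∑ i, Dx i (v i))

/-- Evaluation of a field at a point is a ring homomorphism. -/
theorem Fd.ev_add (f g : Fd a b) (z : ℝ × Spc 2) : (f + g).1 z = f.1 z + g.1 z := rfl
theorem Fd.ev_sub (f g : Fd a b) (z : ℝ × Spc 2) : (f - g).1 z = f.1 z - g.1 z := rfl
theorem Fd.ev_neg (f : Fd a b) (z : ℝ × Spc 2) : (-f).1 z = -f.1 z := rfl
theorem Fd.ev_mul (f g : Fd a b) (z : ℝ × Spc 2) : (f * g).1 z = f.1 z * g.1 z := rfl
theorem Fd.ev_smul (c : ℝ) (f : Fd a b) (z : ℝ × Spc 2) : (c • f).1 z = c * f.1 z := rfl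
theorem Fd.ev_pow (f : Fd a b) (n : ℕ) (z : ℝ × Spc 2) : (f ^ n).1 z = f.1 z ^ n := rfl
theorem Fd.ev_sum {ι : Type*} (s : Finset ι) (f : ι → Fd a b) (z : ℝ × Spc 2) :
    (∑ i ∈ s, f i).1 z = ∑ i ∈ s, (f i).1 z := by
  simp

theorem coreForm_le_energyForm {ε δ : ℝ} (hε : 0 < ε) (hεδ : ε ≤ δ) (q : Fd a b)
    (v : Fin 2 → Fd a b) (V : Fin 2 → Fin 2 → Fd a b) (z : ℝ × Spc 2) :
    (coreForm ε δ q v V).1 z ≤ 12 * (energyForm ε δ q v V).1 z := by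
  have hδ : 0 < δ := hε.trans_le hεδ
  simp only [coreForm, energyForm, Fin.sum_univ_two, Fd.ev_add, Fd.ev_sub, Fd.ev_smul, Fd.ev_pow,
    Fd.ev_mul]
  generalize q.1 z = Q
  generalize (Dt (v 0)).1 z = W0
  generalize (Dt (v 1)).1 z = W1
  generalize hD : (Dx 0 (v 0)).1 z + (Dx 1 (v 1)).1 z = D
  have key : ∀ V W : ℝ, 0 ≤ V ^ 2 * (11 / 12) + δ * (W * V) + 5 / 12 * δ ^ 2 * W ^ 2 := by
    intro V W
    nlinarith [sq_nonneg (V * 6 / 7 + 7 / 12 * δ * W), sq_nonneg (δ * W), sq_nonneg V]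
  have k0 := key ((v 0).1 z) W0
  have k1 := key ((v 1).1 z) W1
  have kq : 0 ≤ 11 / 12 * ε * Q ^ 2 - (δ + ε / 4) * (Q * D)
      + ((δ + ε / 4) * δ / (2 * ε) - δ ^ 2 / ε / 12) * D ^ 2 := by
    have e : 11 / 12 * ε * Q ^ 2 - (δ + ε / 4) * (Q * D)
      + ((δ + ε / 4) * δ / (2 * ε) - δ ^ 2 / ε / 12) * D ^ 2
      = ε⁻¹ * (11 / 12 * (ε * Q) ^ 2 - (δ + ε / 4) * D * (ε * Q)
        + ((δ + ε / 4) * δ / 2 - δ ^ 2 / 12) * D ^ 2) := by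
      field_simp
    rw [e]
    refine mul_nonneg (inv_nonneg.2 hε.le) ?_
    nlinarith [sq_nonneg (11 / 12 * (ε * Q) - (δ + ε / 4) * D / 2), sq_nonneg D,
      mul_nonneg (sub_nonneg.2 hεδ) (mul_nonneg hδ.le (sq_nonneg D)),
      mul_nonneg (mul_nonneg (sub_nonneg.2 hεδ) hε.le) (sq_nonneg D),
      mul_nonneg (mul_nonneg hε.le hε.le) (sq_nonneg D),
      mul_nonneg (mul_nonneg hε.le hδ.le) (sq_nonneg D)]
  have r1 : 0 ≤ ε * δ * (W0 ^ 2 + W1 ^ 2) := by positivity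
  have r2 : 0 ≤ δ * ((V 0 0).1 z ^ 2 + (V 0 1).1 z ^ 2 + ((V 1 0).1 z ^ 2 + (V 1 1).1 z ^ 2)) := by
    positivity
  have r3 : 0 ≤ δ * ((Dx 0 (v 0)).1 z ^ 2 + (Dx 1 (v 0)).1 z ^ 2
    + ((Dx 0 (v 1)).1 z ^ 2 + (Dx 1 (v 1)).1 z ^ 2)) := by positivity
  have r4 : 0 ≤ ε * ((Dx 0 (v 0)).1 z ^ 2 + (Dx 1 (v 0)).1 z ^ 2
    + ((Dx 0 (v 1)).1 z ^ 2 + (Dx 1 (v 1)).1 z ^ 2)) := by positivity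
  linarith

theorem energyForm_le_coreForm {ε δ : ℝ} (hε : 0 < ε) (hεδ : ε ≤ δ) (q : Fd a b)
    (v : Fin 2 → Fd a b) (V : Fin 2 → Fin 2 → Fd a b) (z : ℝ × Spc 2) :
    (energyForm ε δ q v V).1 z ≤ 3 * (coreForm ε δ q v V).1 z := by
  have hδ : 0 < δ := hε.trans_le hεδ
  simp only [coreForm, energyForm, Fin.sum_univ_two, Fd.ev_add, Fd.ev_sub, Fd.ev_smul, Fd.ev_pow,
    Fd.ev_mul]
  generalize q.1 z = Q
  generalize (Dt (v 0)).1 z = W0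
  generalize (Dt (v 1)).1 z = W1
  generalize hD : (Dx 0 (v 0)).1 z + (Dx 1 (v 1)).1 z = D
  have key : ∀ V W : ℝ, δ * (W * V) ≤ V ^ 2 + δ ^ 2 * W ^ 2 := by
    intro V W
    nlinarith [sq_nonneg (V - δ * W), sq_nonneg (δ * W), sq_nonneg V]
  have k0 := key ((v 0).1 z) W0
  have k1 := key ((v 1).1 z) W1
  have kq : - (δ + ε / 4) * (Q * D) + ((δ + ε / 4) * δ / (2 * ε)) * D ^ 2 ≤ 2 * ε * Q ^ 2
      + 3 * (δ ^ 2 / ε) * D ^ 2 := by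
    have e : 2 * ε * Q ^ 2 + 3 * (δ ^ 2 / ε) * D ^ 2
      - (- (δ + ε / 4) * (Q * D) + ((δ + ε / 4) * δ / (2 * ε)) * D ^ 2)
      = ε⁻¹ * (2 * (ε * Q) ^ 2 + (δ + ε / 4) * D * (ε * Q)
        + (3 * δ ^ 2 - (δ + ε / 4) * δ / 2) * D ^ 2) := by
      field_simp
      ring
    have : 0 ≤ ε⁻¹ * (2 * (ε * Q) ^ 2 + (δ + ε / 4) * D * (ε * Q)
        + (3 * δ ^ 2 - (δ + ε / 4) * δ / 2) * D ^ 2) := by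
      refine mul_nonneg (inv_nonneg.2 hε.le) ?_
      nlinarith [sq_nonneg (ε * Q + (δ + ε / 4) * D / 2), sq_nonneg D,
        mul_nonneg (sub_nonneg.2 hεδ) (mul_nonneg hδ.le (sq_nonneg D)),
        mul_nonneg (mul_nonneg (sub_nonneg.2 hεδ) hε.le) (sq_nonneg D),
        mul_nonneg (mul_nonneg hε.le hε.le) (sq_nonneg D),
        mul_nonneg (mul_nonneg hε.le hδ.le) (sq_nonneg D), sq_nonneg (ε * Q)]
    linarith
  have r1 : ε * δ * (W0 ^ 2 + W1 ^ 2) ≤ δ * δ * (W0 ^ 2 + W1 ^ 2) := by gcongr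
  have r2 : 0 ≤ δ * ((V 0 0).1 z ^ 2 + (V 0 1).1 z ^ 2 + ((V 1 0).1 z ^ 2 + (V 1 1).1 z ^ 2)) := by
    positivity
  have r3 : 0 ≤ δ * ((Dx 0 (v 0)).1 z ^ 2 + (Dx 1 (v 0)).1 z ^ 2
    + ((Dx 0 (v 1)).1 z ^ 2 + (Dx 1 (v 1)).1 z ^ 2)) := by positivity
  have r4 : ε * ((Dx 0 (v 0)).1 z ^ 2 + (Dx 1 (v 0)).1 z ^ 2
    + ((Dx 0 (v 1)).1 z ^ 2 + (Dx 1 (v 1)).1 z ^ 2)) ≤ δ * ((Dx 0 (v 0)).1 z ^ 2 + (Dx 1 (v 0)).1 z ^ 2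
    + ((Dx 0 (v 1)).1 z ^ 2 + (Dx 1 (v 1)).1 z ^ 2)) := by gcongr
  have r5 : 0 ≤ ε * Q ^ 2 := by positivity
  have r6 : 0 ≤ δ ^ 2 * (W0 ^ 2 + W1 ^ 2) := by positivity
  linarith [sq_nonneg ((v 0).1 z), sq_nonneg ((v 1).1 z)]

end Energy

section LinearSystem

variable {a b : ℝ}

/-- The linearised relaxation system at time `t`, with the damped wave equation it implies. -/
structure LinSys (ε δ t : ℝ) (q : Fd a b) (v : Fin 2 → Fd a b) (V : Fin 2 → Fin 2 → Fd a b)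
    (g : Fd a b) (H : Fin 2 → Fin 2 → Fd a b) (h : Fin 2 → Fd a b) : Prop where
  mass : ∀ x, (ε • Dt q + ∑ i, Dx i (v i)).1 (t, x) = (ε • g).1 (t, x)
  momentum : ∀ i x, (Dt (v i) + ∑ j, Dx j (V i j) + Dx i q).1 (t, x) = 0
  stress : ∀ i j x, (δ • Dt (V i j) + Dx j (v i) + V i j).1 (t, x) = (H i j).1 (t, x)
  wave : ∀ i x, (δ • Dt (Dt (v i)) + Dt (v i) - ∑ j, Dx j (Dx j (v i))
    - (δ / ε) • Dx i (∑ j, Dx j (v j)) + Dx i q).1 (t, x) = (h i).1 (t, x)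

theorem Dt_Dx (i : Fin 2) (f : Fd a b) : Dt (Dx i f) = Dx i (Dt f) := Dd_comm _ _ f

theorem Dx_Dx (i j : Fin 2) (f : Fd a b) : Dx i (Dx j f) = Dx j (Dx i f) := Dd_comm _ _ f

theorem LinSys.dx {ε δ t : ℝ} (ht : t ∈ Set.Ioo a b) {q : Fd a b} {v : Fin 2 → Fd a b}
    {V : Fin 2 → Fin 2 → Fd a b} {g : Fd a b} {H : Fin 2 → Fin 2 → Fd a b} {h : Fin 2 → Fd a b}
    (hs : LinSys ε δ t q v V g H h) (k : Fin 2) :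
    LinSys ε δ t (Dx k q) (fun i => Dx k (v i)) (fun i j => Dx k (V i j)) (Dx k g)
      (fun i j => Dx k (H i j)) (fun i => Dx k (h i)) where
  mass := fun x => by
    have := Dx_congr k ht hs.mass x
    simpa only [map_add, map_sum, Derivation.map_smul, Dt_Dx, Dx_Dx k] using this
  momentum := fun i x => by
    have := Dx_congr k ht (g := 0) (hs.momentum i) x
    simp only [map_add, map_sum, Dt_Dx, Dx_Dx k, map_zero] at this ⊢
    exact this
  stress := fun i j x => by
    have := Dx_congr k ht (hs.stress i j) x
    simpa only [map_add, map_sum, Derivation.map_smul, Dt_Dx, Dx_Dx k] using this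
  wave := fun i x => by
    have := Dx_congr k ht (hs.wave i) x
    simp only [map_add, map_sub, map_sum, Derivation.map_smul, Dt_Dx] at this ⊢
    rw [← this]
    simp only [Dx_Dx k]

theorem energy_identity {ε δ t : ℝ} (hε : 0 < ε) (hδ : 0 < δ) (ht : t ∈ Set.Ioo a b) {q : Fd a b}
    {v : Fin 2 → Fd a b} {V : Fin 2 → Fin 2 → Fd a b} {g : Fd a b} {H : Fin 2 → Fin 2 → Fd a b}
    {h : Fin 2 → Fd a b} (hs : LinSys ε δ t q v V g H h) :
    Int t (Dt (energyForm ε δ q v V)) =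
      Int t ((2 * ε) • (g * q) - ∑ i, ∑ j, V i j ^ 2 + ∑ i, ∑ j, H i j * V i j
        - (ε / 4) • ∑ i, Dt (v i) ^ 2 - ∑ i, ∑ j, Dx j (v i) ^ 2
        + (1 / 4 : ℝ) • (∑ i, Dx i (v i)) ^ 2
        - (δ + ε / 4) • (g * ∑ i, Dx i (v i))
        + ∑ i, h i * (v i + (δ + ε / 4) • Dt (v i))) := by
  have key : ∀ x, (Dt (energyForm ε δ q v V)).1 (t, x) =
      ((2 * ε) • (g * q) - ∑ i, ∑ j, V i j ^ 2 + ∑ i, ∑ j, H i j * V i j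
        - (ε / 4) • ∑ i, Dt (v i) ^ 2 - ∑ i, ∑ j, Dx j (v i) ^ 2
        + (1 / 4 : ℝ) • (∑ i, Dx i (v i)) ^ 2
        - (δ + ε / 4) • (g * ∑ i, Dx i (v i))
        + ∑ i, h i * (v i + (δ + ε / 4) • Dt (v i))
        + ∑ k, Dx k (∑ i, (v i + (δ + ε / 4) • Dt (v i)) * Dx k (v i) - ∑ i, v i * V i k
          + (δ / ε) • ((v k + (δ + ε / 4) • Dt (v k)) * ∑ i, Dx i (v i))
          - (2 : ℝ) • (q * v k) - (δ + ε / 4) • (Dt (v k) * q))).1 (t, x) := by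
    intro x
    have h1 := hs.mass x
    have h2 := fun i => hs.momentum i x
    have h3 := fun i j => hs.stress i j x
    have h4 := fun i => hs.wave i x
    simp only [Fin.sum_univ_two, Fd.ev_add, Fd.ev_sub, Fd.ev_smul, map_add] at h1 h2 h3 h4
    simp only [energyForm, pow_two, Fin.sum_univ_two, map_add, map_sub, Derivation.map_smul,
      Derivation.leibniz, smul_eq_mul, Dt_Dx, Fd.ev_add, Fd.ev_sub, Fd.ev_smul, Fd.ev_mul]
    have e0 : (Dt q).1 (t, x) = g.1 (t, x) - ε⁻¹ * ((Dx 0 (v 0)).1 (t, x) + (Dx 1 (v 1)).1 (t, x)) := by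
      field_simp; linarith
    have e1 : ∀ i j, (Dt (V i j)).1 (t, x)
        = δ⁻¹ * ((H i j).1 (t, x) - (Dx j (v i)).1 (t, x) - (V i j).1 (t, x)) := by
      intro i j; field_simp; linarith [h3 i j]
    have e2 : ∀ i, (Dt (Dt (v i))).1 (t, x) = δ⁻¹ * ((h i).1 (t, x) - (Dt (v i)).1 (t, x)
        + ((Dx 0 (Dx 0 (v i))).1 (t, x) + (Dx 1 (Dx 1 (v i))).1 (t, x))
        + δ / ε * ((Dx i (Dx 0 (v 0))).1 (t, x) + (Dx i (Dx 1 (v 1))).1 (t, x))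
        - (Dx i q).1 (t, x)) := by
      intro i; rw [eq_inv_mul_iff_mul_eq₀ hδ.ne']; linarith [h4 i]
    rw [e0, e1, e1, e1, e1, e2, e2]
    have m0 := h2 0
    have m1 := h2 1
    clear h1 h2 h3 h4 e0 e1 e2
    field_simp
    linear_combination (8 * ε * (v 0).1 (t, x)) * m0 + (8 * ε * (v 1).1 (t, x)) * m1
  rw [Int_congr key, Int_add ht]
  have : Int t (∑ k, Dx k (∑ i, (v i + (δ + ε / 4) • Dt (v i)) * Dx k (v i) - ∑ i, v i * V i k
          + (δ / ε) • ((v k + (δ + ε / 4) • Dt (v k)) * ∑ i, Dx i (v i))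
          - (2 : ℝ) • (q * v k) - (δ + ε / 4) • (Dt (v k) * q))) = 0 := by
    rw [Fin.sum_univ_two, Int_add ht, Int_Dx 0 ht, Int_Dx 1 ht, add_zero]
  rw [this, add_zero]

end LinearSystem

section LinearEstimate

variable {a b : ℝ}

theorem Int_mono_of_flux {t : ℝ} (ht : t ∈ Set.Ioo a b) {f g F : Fd a b} (hF : Int t F = 0)
    (h : ∀ x, (f + F).1 (t, x) ≤ g.1 (t, x)) : Int t f ≤ Int t g := by
  have := Int_mono ht h
  rwa [Int_add ht, hF, add_zero] at this

theorem energy_le {ε δ t : ℝ} (hε : 0 < ε) (hεδ : ε ≤ δ) (ht : t ∈ Set.Ioo a b) {q : Fd a b}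
    {v : Fin 2 → Fd a b} {V : Fin 2 → Fin 2 → Fd a b} {g : Fd a b} {N G : Fin 2 → Fin 2 → Fd a b}
    {r : Fin 2 → Fd a b} (hs : LinSys ε δ t q v V g (fun i j => N i j + G i j)
      (fun i => r i - ∑ j, Dx j (N i j))) {S : ℝ} (hS : 0 < S) :
    Int t (Dt (energyForm ε δ q v V)) ≤
      Int t ((1 + S) • coreForm ε δ q v V + (2 * ε) • g ^ 2 + ∑ i, ∑ j, G i j ^ 2
        + (3 : ℝ) • ∑ i, ∑ j, N i j ^ 2 + ∑ i, r i ^ 2 - (3 / 8 : ℝ) • ∑ i, ∑ j, Dx j (v i) ^ 2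
        + S⁻¹ • ∑ i, (∑ j, Dx j (N i j)) ^ 2) := by
  have hδ : 0 < δ := hε.trans_le hεδ
  rw [energy_identity hε hδ ht hs]
  have hflux : Int t (∑ k, Dx k (∑ i, N i k * v i)) = 0 := by
    rw [Fin.sum_univ_two, Int_add ht, Int_Dx 0 ht, Int_Dx 1 ht, add_zero]
  refine Int_mono_of_flux ht hflux fun x => ?_
  simp only [coreForm, Fin.sum_univ_two, map_add, Derivation.leibniz, smul_eq_mul, Fd.ev_add,
    Fd.ev_sub, Fd.ev_smul, Fd.ev_mul, Fd.ev_pow]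
  generalize q.1 (t, x) = Q
  generalize g.1 (t, x) = g
  generalize (Dt (v 0)).1 (t, x) = W0
  generalize (Dt (v 1)).1 (t, x) = W1
  generalize (Dx 0 (N 0 0)).1 (t, x) = n00
  generalize (Dx 1 (N 0 1)).1 (t, x) = n01
  generalize (Dx 0 (N 1 0)).1 (t, x) = n10
  generalize (Dx 1 (N 1 1)).1 (t, x) = n11
  generalize (Dx 0 (v 0)).1 (t, x) = d00
  generalize (Dx 1 (v 0)).1 (t, x) = d01
  generalize (Dx 0 (v 1)).1 (t, x) = d10
  generalize (Dx 1 (v 1)).1 (t, x) = d11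
  generalize (v 0).1 (t, x) = v0
  generalize (v 1).1 (t, x) = v1
  generalize (r 0).1 (t, x) = r0
  generalize (r 1).1 (t, x) = r1
  have b1 : 2 * ε * (g * Q) ≤ ε * g ^ 2 + ε * Q ^ 2 := by nlinarith [sq_nonneg (g - Q)]
  have b2 : ∀ N G V : ℝ, (N + G) * V - V ^ 2 ≤ 1 / 2 * N ^ 2 + 1 / 2 * G ^ 2 := by
    intro N G V; nlinarith [sq_nonneg (V - (N + G) / 2), sq_nonneg (N - G)]
  have b3 : 1 / 4 * (d00 + d11) ^ 2 ≤ 1 / 2 * (d00 ^ 2 + d11 ^ 2) := by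
    nlinarith [sq_nonneg (d00 - d11)]
  have b4 : -((δ + ε / 4) * (g * (d00 + d11))) ≤ ε * g ^ 2 + δ ^ 2 / ε * (d00 + d11) ^ 2 := by
    generalize d00 + d11 = D
    have e : ε * g ^ 2 + δ ^ 2 / ε * D ^ 2 + (δ + ε / 4) * (g * D)
        = ε⁻¹ * ((ε * g) ^ 2 + (δ + ε / 4) * D * (ε * g) + δ ^ 2 * D ^ 2) := by
      field_simp
      ring
    have : 0 ≤ ε⁻¹ * ((ε * g) ^ 2 + (δ + ε / 4) * D * (ε * g) + δ ^ 2 * D ^ 2) := by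
      refine mul_nonneg (inv_nonneg.2 hε.le) ?_
      nlinarith [sq_nonneg (ε * g + (δ + ε / 4) * D / 2), sq_nonneg D,
        mul_nonneg (sub_nonneg.2 hεδ) (mul_nonneg hδ.le (sq_nonneg D)),
        mul_nonneg (mul_nonneg (sub_nonneg.2 hεδ) hε.le) (sq_nonneg D),
        mul_nonneg (mul_nonneg hε.le hε.le) (sq_nonneg D),
        mul_nonneg (mul_nonneg hε.le hδ.le) (sq_nonneg D), sq_nonneg (δ * D)]
    linarith
  have b5 : ∀ N d : ℝ, N * d ≤ 1 / 8 * d ^ 2 + 2 * N ^ 2 := by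
    intro N d; nlinarith [sq_nonneg (d - 4 * N)]
  have hm : (δ + ε / 4) ^ 2 ≤ 25 / 16 * δ ^ 2 := by nlinarith
  have b6 : ∀ r v w : ℝ, r * (v + (δ + ε / 4) * w) ≤ r ^ 2 + v ^ 2 + δ ^ 2 * w ^ 2 := by
    intro r v w
    nlinarith [sq_nonneg (r - 2 * v), sq_nonneg (r - (δ + ε / 4) * w), sq_nonneg v, sq_nonneg r,
      mul_le_mul_of_nonneg_right hm (sq_nonneg w), sq_nonneg (r - v), sq_nonneg (δ * w)]
  have b7 : ∀ X w : ℝ, -X * ((δ + ε / 4) * w) ≤ S * (δ ^ 2 * w ^ 2) + S⁻¹ * X ^ 2 := by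
    intro X w
    have e : S * (δ ^ 2 * w ^ 2) + S⁻¹ * X ^ 2 + X * ((δ + ε / 4) * w)
        = S⁻¹ * (X ^ 2 + (δ + ε / 4) * w * S * X + (S * δ * w) ^ 2) := by
      field_simp
      ring
    have : 0 ≤ S⁻¹ * (X ^ 2 + (δ + ε / 4) * w * S * X + (S * δ * w) ^ 2) := by
      refine mul_nonneg (inv_nonneg.2 hS.le) ?_
      nlinarith [sq_nonneg (X + (δ + ε / 4) * w * S / 2), sq_nonneg (S * δ * w),
        mul_le_mul_of_nonneg_right hm (sq_nonneg (S * w))]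
    linarith
  have c1 := b2 ((N 0 0).1 (t, x)) ((G 0 0).1 (t, x)) ((V 0 0).1 (t, x))
  have c2 := b2 ((N 0 1).1 (t, x)) ((G 0 1).1 (t, x)) ((V 0 1).1 (t, x))
  have c3 := b2 ((N 1 0).1 (t, x)) ((G 1 0).1 (t, x)) ((V 1 0).1 (t, x))
  have c4 := b2 ((N 1 1).1 (t, x)) ((G 1 1).1 (t, x)) ((V 1 1).1 (t, x))
  have c5 := b5 ((N 0 0).1 (t, x)) d00
  have c6 := b5 ((N 0 1).1 (t, x)) d01
  have c7 := b5 ((N 1 0).1 (t, x)) d10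
  have c8 := b5 ((N 1 1).1 (t, x)) d11
  have c9 := b6 r0 v0 W0
  have c10 := b6 r1 v1 W1
  have c11 := b7 (n00 + n01) W0
  have c12 := b7 (n10 + n11) W1
  have z1 : 0 ≤ ε / 4 * (W0 ^ 2 + W1 ^ 2) := by positivity
  have z2 : 0 ≤ δ * (((V 0 0).1 (t, x)) ^ 2 + ((V 0 1).1 (t, x)) ^ 2
    + (((V 1 0).1 (t, x)) ^ 2 + ((V 1 1).1 (t, x)) ^ 2)) := by positivity
  have z3 : 0 ≤ δ * (d00 ^ 2 + d01 ^ 2 + (d10 ^ 2 + d11 ^ 2)) := by positivity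
  have z4 : 0 ≤ S * (ε * Q ^ 2 + (v0 ^ 2 + v1 ^ 2) + δ * (((V 0 0).1 (t, x)) ^ 2
    + ((V 0 1).1 (t, x)) ^ 2 + (((V 1 0).1 (t, x)) ^ 2 + ((V 1 1).1 (t, x)) ^ 2))
    + δ * (d00 ^ 2 + d01 ^ 2 + (d10 ^ 2 + d11 ^ 2)) + δ ^ 2 / ε * (d00 + d11) ^ 2) := by positivity
  have z5 := sq_nonneg ((N 0 0).1 (t, x))
  have z6 := sq_nonneg ((N 0 1).1 (t, x))
  have z7 := sq_nonneg ((N 1 0).1 (t, x))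
  have z8 := sq_nonneg ((N 1 1).1 (t, x))
  have y5 := sq_nonneg ((G 0 0).1 (t, x))
  have y6 := sq_nonneg ((G 0 1).1 (t, x))
  have y7 := sq_nonneg ((G 1 0).1 (t, x))
  have y8 := sq_nonneg ((G 1 1).1 (t, x))
  linarith [sq_nonneg d01, sq_nonneg d10]

end LinearEstimate

section Nonlinear

variable {a b : ℝ}

/-- The difference of the quadratic stresses of `u + v` and `u`. -/
def nonlin (u v : Fin 2 → Fd a b) (i j : Fin 2) : Fd a b := v i * v j + u i * v j + v i * u j

/-- Sum of squares of the components. -/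
def sumSq (v : Fin 2 → Fd a b) : Fd a b := ∑ i, v i ^ 2

/-- Sum of squares of the first derivatives. -/
def sumSqD (v : Fin 2 → Fd a b) : Fd a b := ∑ i, ∑ j, Dx j (v i) ^ 2

/-- Sum of squares of the second derivatives. -/
def sumSqDD (v : Fin 2 → Fd a b) : Fd a b := ∑ i, ∑ j, ∑ k, Dx k (Dx j (v i)) ^ 2

theorem sq_le_sumSq (v : Fin 2 → Fd a b) (i : Fin 2) (z : ℝ × Spc 2) :
    (v i).1 z ^ 2 ≤ (sumSq v).1 z := by
  simp only [sumSq, Fd.ev_sum, Fd.ev_pow]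
  exact Finset.single_le_sum (f := fun i => (v i).1 z ^ 2) (fun _ _ => sq_nonneg _)
    (Finset.mem_univ i)

theorem sq_le_sumSqD (v : Fin 2 → Fd a b) (i j : Fin 2) (z : ℝ × Spc 2) :
    (Dx j (v i)).1 z ^ 2 ≤ (sumSqD v).1 z := by
  simp only [sumSqD, Fd.ev_sum, Fd.ev_pow]
  exact (Finset.single_le_sum (f := fun j => (Dx j (v i)).1 z ^ 2) (fun _ _ => sq_nonneg _)
    (Finset.mem_univ j)).trans (Finset.single_le_sum (f := fun i => ∑ j, (Dx j (v i)).1 z ^ 2)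
      (fun _ _ => Finset.sum_nonneg fun _ _ => sq_nonneg _) (Finset.mem_univ i))

theorem sq_le_sumSqDD (v : Fin 2 → Fd a b) (i j k : Fin 2) (z : ℝ × Spc 2) :
    (Dx k (Dx j (v i))).1 z ^ 2 ≤ (sumSqDD v).1 z := by
  simp only [sumSqDD, Fd.ev_sum, Fd.ev_pow]
  exact ((Finset.single_le_sum (f := fun k => (Dx k (Dx j (v i))).1 z ^ 2)
    (fun _ _ => sq_nonneg _) (Finset.mem_univ k)).trans
    (Finset.single_le_sum (f := fun j => ∑ k, (Dx k (Dx j (v i))).1 z ^ 2)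
      (fun _ _ => Finset.sum_nonneg fun _ _ => sq_nonneg _) (Finset.mem_univ j))).trans
    (Finset.single_le_sum (f := fun i => ∑ j, ∑ k, (Dx k (Dx j (v i))).1 z ^ 2)
      (fun _ _ => Finset.sum_nonneg fun _ _ => Finset.sum_nonneg fun _ _ => sq_nonneg _)
      (Finset.mem_univ i))

theorem mul_sq_le {x y S A : ℝ} (hx : x ^ 2 ≤ S) (hy : y ^ 2 ≤ A) : (x * y) ^ 2 ≤ S * A := by
  rw [mul_pow]
  exact mul_le_mul hx hy (sq_nonneg _) ((sq_nonneg _).trans hx)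

theorem six_sq_le (a b c d e f : ℝ) : (a + b + c + d + e + f) ^ 2
    ≤ 6 * (a ^ 2 + b ^ 2 + c ^ 2 + d ^ 2 + e ^ 2 + f ^ 2) := by
  nlinarith [sq_nonneg (a - b), sq_nonneg (a - c), sq_nonneg (a - d), sq_nonneg (a - e),
    sq_nonneg (a - f), sq_nonneg (b - c), sq_nonneg (b - d), sq_nonneg (b - e), sq_nonneg (b - f),
    sq_nonneg (c - d), sq_nonneg (c - e), sq_nonneg (c - f), sq_nonneg (d - e), sq_nonneg (d - f),
    sq_nonneg (e - f)]

theorem nonlin_sq_le {u v : Fin 2 → Fd a b} {z : ℝ × Spc 2} {S : ℝ}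
    (hv : ∀ i, (v i).1 z ^ 2 ≤ S) (hu : ∀ i, (u i).1 z ^ 2 ≤ S) (i j : Fin 2) :
    (nonlin u v i j).1 z ^ 2 ≤ 9 * (S * (sumSq v).1 z) := by
  simp only [nonlin, Fd.ev_add, Fd.ev_mul]
  have h1 := mul_sq_le (hv i) (sq_le_sumSq v j z)
  have h2 := mul_sq_le (hu i) (sq_le_sumSq v j z)
  have h3 := mul_sq_le (hu j) (sq_le_sumSq v i z)
  have := six_sq_le ((v i).1 z * (v j).1 z) ((u i).1 z * (v j).1 z) ((u j).1 z * (v i).1 z) 0 0 0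
  generalize (v i).1 z = vi at *
  generalize (v j).1 z = vj at *
  generalize (u i).1 z = ui at *
  generalize (u j).1 z = uj at *
  rw [mul_comm vi uj]
  nlinarith [sq_nonneg (vi * vj - ui * vj), sq_nonneg (vi * vj - uj * vi),
    sq_nonneg (ui * vj - uj * vi)]

theorem Dx_nonlin_sq_le {u v : Fin 2 → Fd a b} {z : ℝ × Spc 2} {S : ℝ}
    (hv : ∀ i, (v i).1 z ^ 2 ≤ S) (hu : ∀ i, (u i).1 z ^ 2 ≤ S)
    (hdu : ∀ i j, (Dx j (u i)).1 z ^ 2 ≤ S) (l i j : Fin 2) :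
    (Dx l (nonlin u v i j)).1 z ^ 2 ≤ 24 * (S * (sumSq v + sumSqD v).1 z) := by
  simp only [nonlin, map_add, Derivation.leibniz, smul_eq_mul, Fd.ev_add, Fd.ev_mul]
  have h1 := mul_sq_le (hv i) (sq_le_sumSqD v j l z)
  have h2 := mul_sq_le (hv j) (sq_le_sumSqD v i l z)
  have h3 := mul_sq_le (hu i) (sq_le_sumSqD v j l z)
  have h4 := mul_sq_le (hdu i l) (sq_le_sumSq v j z)
  have h5 := mul_sq_le (hdu j l) (sq_le_sumSq v i z)
  have h6 := mul_sq_le (hu j) (sq_le_sumSqD v i l z)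
  have h7 : 0 ≤ S * (sumSq v).1 z := (sq_nonneg _).trans h4
  rw [mul_comm ((v j).1 z) ((Dx l (u i)).1 z), mul_comm ((v i).1 z) ((Dx l (u j)).1 z),
    ← add_assoc, ← add_assoc]
  refine (six_sq_le _ _ _ _ _ _).trans ?_
  linarith

theorem Dx_Dx_nonlin_sq_le {u v : Fin 2 → Fd a b} {z : ℝ × Spc 2} {S : ℝ}
    (hv : ∀ i, (v i).1 z ^ 2 ≤ S) (hu : ∀ i, (u i).1 z ^ 2 ≤ S)
    (hdu : ∀ i j, (Dx j (u i)).1 z ^ 2 ≤ S) (hddu : ∀ i j k, (Dx k (Dx j (u i))).1 z ^ 2 ≤ S)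
    (k l i j : Fin 2) :
    (Dx k (Dx l (nonlin u v i j))).1 z ^ 2
      ≤ 48 * (S * (sumSq v + sumSqD v + sumSqDD v).1 z) + 24 * ∑ i, ∑ j, (Dx j (v i)).1 z ^ 4 := by
  have hq : ∀ i j i' j', ((Dx j (v i)).1 z * (Dx j' (v i')).1 z) ^ 2
      ≤ ∑ i, ∑ j, (Dx j (v i)).1 z ^ 4 := by
    have h4 : ∀ i j, (Dx j (v i)).1 z ^ 4 ≤ ∑ i, ∑ j, (Dx j (v i)).1 z ^ 4 := fun i j =>
      (Finset.single_le_sum (f := fun j => (Dx j (v i)).1 z ^ 4) (fun _ _ => by positivity)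
        (Finset.mem_univ j)).trans (Finset.single_le_sum (f := fun i => ∑ j, (Dx j (v i)).1 z ^ 4)
          (fun _ _ => Finset.sum_nonneg fun _ _ => by positivity) (Finset.mem_univ i))
    intro i j i' j'
    have e1 := h4 i j
    have e2 := h4 i' j'
    nlinarith [sq_nonneg ((Dx j (v i)).1 z ^ 2 - (Dx j' (v i')).1 z ^ 2)]
  simp only [nonlin, map_add, Derivation.leibniz, smul_eq_mul, Fd.ev_add, Fd.ev_mul]
  have g1 := mul_sq_le (hv i) (sq_le_sumSqDD v j l k z)
  have g2 := hq i k j l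
  have g3 := hq i l j k
  have g4 := mul_sq_le (hv j) (sq_le_sumSqDD v i l k z)
  have h1 := mul_sq_le (hu i) (sq_le_sumSqDD v j l k z)
  have h2 := mul_sq_le (hdu i k) (sq_le_sumSqD v j l z)
  have h3 := mul_sq_le (hdu i l) (sq_le_sumSqD v j k z)
  have h4 := mul_sq_le (hddu i l k) (sq_le_sumSq v j z)
  have f1 := mul_sq_le (hu j) (sq_le_sumSqDD v i l k z)
  have f2 := mul_sq_le (hdu j k) (sq_le_sumSqD v i l z)
  have f3 := mul_sq_le (hdu j l) (sq_le_sumSqD v i k z)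
  have f4 := mul_sq_le (hddu j l k) (sq_le_sumSq v i z)
  have s1 := six_sq_le ((v i).1 z * (Dx k (Dx l (v j))).1 z) ((Dx k (v i)).1 z * (Dx l (v j)).1 z)
    ((Dx l (v i)).1 z * (Dx k (v j)).1 z) ((v j).1 z * (Dx k (Dx l (v i))).1 z)
    ((u i).1 z * (Dx k (Dx l (v j))).1 z) ((Dx k (u i)).1 z * (Dx l (v j)).1 z)
  have s2 := six_sq_le ((Dx l (u i)).1 z * (Dx k (v j)).1 z) ((Dx k (Dx l (u i))).1 z * (v j).1 z)
    ((u j).1 z * (Dx k (Dx l (v i))).1 z) ((Dx k (u j)).1 z * (Dx l (v i)).1 z)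
    ((Dx l (u j)).1 z * (Dx k (v i)).1 z) ((Dx k (Dx l (u j))).1 z * (v i).1 z)
  have s3 : ∀ A B : ℝ, (A + B) ^ 2 ≤ 2 * A ^ 2 + 2 * B ^ 2 := fun A B => by
    nlinarith [sq_nonneg (A - B)]
  have s4 := s3 ((v i).1 z * (Dx k (Dx l (v j))).1 z + (Dx k (v i)).1 z * (Dx l (v j)).1 z
    + (Dx l (v i)).1 z * (Dx k (v j)).1 z + (v j).1 z * (Dx k (Dx l (v i))).1 z
    + (u i).1 z * (Dx k (Dx l (v j))).1 z + (Dx k (u i)).1 z * (Dx l (v j)).1 z)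
    ((Dx l (u i)).1 z * (Dx k (v j)).1 z + (Dx k (Dx l (u i))).1 z * (v j).1 z
    + (u j).1 z * (Dx k (Dx l (v i))).1 z + (Dx k (u j)).1 z * (Dx l (v i)).1 z
    + (Dx l (u j)).1 z * (Dx k (v i)).1 z + (Dx k (Dx l (u j))).1 z * (v i).1 z)
  have h7 : 0 ≤ S * (sumSq v).1 z := (sq_nonneg _).trans h4
  refine (le_of_eq ?_).trans (s4.trans ?_)
  · ring
  · linarith

end Nonlinear

section TotalEnergy

variable {a b : ℝ}

theorem sumSq_le_coreForm {ε δ : ℝ} (hε : 0 < ε) (hδ : 0 < δ) (q : Fd a b) (v : Fin 2 → Fd a b)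
    (V : Fin 2 → Fin 2 → Fd a b) (z : ℝ × Spc 2) :
    (sumSq v).1 z ≤ (coreForm ε δ q v V).1 z := by
  simp only [sumSq, coreForm, Fd.ev_add, Fd.ev_sum, Fd.ev_smul, Fd.ev_pow]
  have h1 : 0 ≤ ε * q.1 z ^ 2 := by positivity
  have h2 : 0 ≤ δ * ∑ i, ∑ j, (V i j).1 z ^ 2 := by positivity
  have h3 : 0 ≤ δ ^ 2 * ∑ i, (Dt (v i)).1 z ^ 2 := by positivity
  have h4 : 0 ≤ δ * ∑ i, ∑ j, (Dx j (v i)).1 z ^ 2 := by positivity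
  have h5 : 0 ≤ δ ^ 2 / ε * (∑ i, (Dx i (v i)).1 z) ^ 2 := by positivity
  linarith

theorem Int_pow_four_le {t : ℝ} (ht : t ∈ Set.Ioo a b) {v : Fin 2 → Fd a b} {S : ℝ}
    (hv : ∀ i x, (v i).1 (t, x) ^ 2 ≤ S) :
    Int t (∑ i, ∑ j, Dx j (v i) ^ 4) ≤ 9 * S * Int t (sumSqDD v) := by
  have hS : 0 ≤ S := (sq_nonneg _).trans (hv 0 0)
  have h := fun i j => Int_Dx_pow_four ht (v i) j (hv i)
  have h0 : ∀ i j k, 0 ≤ Int t (Dx k (Dx j (v i)) ^ 2) := fun i j k =>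
    Int_nonneg fun x => sq_nonneg _
  have h1 := mul_nonneg hS (h0 0 0 1)
  have h2 := mul_nonneg hS (h0 0 1 0)
  have h3 := mul_nonneg hS (h0 1 0 1)
  have h4 := mul_nonneg hS (h0 1 1 0)
  simp only [sumSqDD, Fin.sum_univ_two, Int_add ht]
  linarith [h 0 0, h 0 1, h 1 0, h 1 1]

theorem Int_one (t : ℝ) : Int t (1 : Fd a b) = 1 := by
  have : ∀ x : Spc 2, (1 : Fd a b).1 (t, x) = 1 := fun _ => rfl
  simp [Int, this, measureReal_def]

theorem base_energy_le {ε δ t : ℝ} (hε : 0 < ε) (hεδ : ε ≤ δ) (hδ1 : δ ≤ 1) (ht : t ∈ Set.Ioo a b)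
    {q : Fd a b} {u v : Fin 2 → Fd a b} {V : Fin 2 → Fin 2 → Fd a b} {g : Fd a b}
    {G : Fin 2 → Fin 2 → Fd a b} {r : Fin 2 → Fd a b}
    (hs : LinSys ε δ t q v V g (fun i j => nonlin u v i j + G i j)
      (fun i => r i - ∑ j, Dx j (nonlin u v i j))) {S K : ℝ} (hS : 1 ≤ S)
    (hv : ∀ i x, (v i).1 (t, x) ^ 2 ≤ S) (hu : ∀ i x, (u i).1 (t, x) ^ 2 ≤ S)
    (hdu : ∀ i j x, (Dx j (u i)).1 (t, x) ^ 2 ≤ S)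
    (hg : ∀ x, g.1 (t, x) ^ 2 ≤ K) (hG : ∀ i j x, (G i j).1 (t, x) ^ 2 ≤ δ ^ 2 * K)
    (hr : ∀ i x, (r i).1 (t, x) ^ 2 ≤ δ ^ 2 * K) :
    Int t (Dt (energyForm ε δ q v V)) ≤ 40200 * S * Int t (coreForm ε δ q v V)
      + 8 * δ * K - 1 / 4 * Int t (sumSqD v) := by
  have hδ : 0 < δ := hε.trans_le hεδ
  have hK : 0 ≤ K := (sq_nonneg _).trans (hg 0)
  have hS0 : (0 : ℝ) < S := by linarith
  refine (energy_le hε hεδ ht hs (S := 40000 * S) (by positivity)).trans ?_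
  have : Int t ((40200 * S) • coreForm ε δ q v V + (8 * δ * K) • (1 : Fd a b)
      - (1 / 4 : ℝ) • sumSqD v) = 40200 * S * Int t (coreForm ε δ q v V)
      + 8 * δ * K - 1 / 4 * Int t (sumSqD v) := by
    rw [Int_sub ht, Int_add ht, Int_smul, Int_smul, Int_smul, Int_one]; ring
  rw [← this]
  refine Int_mono ht fun x => ?_
  have hn := fun i j => nonlin_sq_le (fun i => hv i x) (fun i => hu i x) i j
  have hd := fun l i j => Dx_nonlin_sq_le (fun i => hv i x) (fun i => hu i x)
    (fun i j => hdu i j x) l i j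
  have hP := sumSq_le_coreForm hε hδ q v V (t, x)
  have hP0 : 0 ≤ (sumSq v).1 (t, x) := (sq_nonneg _).trans (sq_le_sumSq v 0 _)
  have hP1 : 0 ≤ (sumSqD v).1 (t, x) := (sq_nonneg _).trans (sq_le_sumSqD v 0 0 _)
  have e1 : (∑ i, ∑ j, (Dx j (v i)).1 (t, x) ^ 2) = (sumSqD v).1 (t, x) := by
    simp only [sumSqD, Fd.ev_sum, Fd.ev_pow]
  simp only [Fd.ev_add, Fd.ev_sub, Fd.ev_smul, Fd.ev_sum, Fd.ev_pow, e1] at hd ⊢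
  generalize (coreForm ε δ q v V).1 (t, x) = F at *
  generalize (sumSqD v).1 (t, x) = P3 at *
  generalize (sumSq v).1 (t, x) = P2 at *
  have o1 : (1 : Fd a b).1 (t, x) = 1 := rfl
  rw [o1]
  simp only [Fin.sum_univ_two]
  have i1 : (40000 * S)⁻¹ * (((Dx 0 (nonlin u v 0 0)).1 (t, x) + (Dx 1 (nonlin u v 0 1)).1 (t, x)) ^ 2
      + ((Dx 0 (nonlin u v 1 0)).1 (t, x) + (Dx 1 (nonlin u v 1 1)).1 (t, x)) ^ 2)
      ≤ 1 / 100 * (P2 + P3) := by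
    rw [inv_mul_le_iff₀ (by positivity)]
    have s3 : ∀ A B : ℝ, (A + B) ^ 2 ≤ 2 * A ^ 2 + 2 * B ^ 2 := fun A B => by
      nlinarith [sq_nonneg (A - B)]
    have := s3 ((Dx 0 (nonlin u v 0 0)).1 (t, x)) ((Dx 1 (nonlin u v 0 1)).1 (t, x))
    have := s3 ((Dx 0 (nonlin u v 1 0)).1 (t, x)) ((Dx 1 (nonlin u v 1 1)).1 (t, x))
    have : 0 ≤ S * (P2 + P3) := by positivity
    linarith [hd 0 0 0, hd 1 0 1, hd 0 1 0, hd 1 1 1]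
  have i2 : S * P2 ≤ S * F := by gcongr
  have i3 : F ≤ S * F := by nlinarith
  have i4 : ε * g.1 (t, x) ^ 2 ≤ δ * K :=
    mul_le_mul hεδ (hg x) (sq_nonneg _) hδ.le
  have i5 : δ ^ 2 * K ≤ δ * K := by nlinarith [mul_nonneg hδ.le hK]
  linarith [hn 0 0, hn 0 1, hn 1 0, hn 1 1, hG 0 0 x, hG 0 1 x, hG 1 0 x, hG 1 1 x, hr 0 x, hr 1 x]

theorem deriv_energy_le {ε δ t : ℝ} (hε : 0 < ε) (hεδ : ε ≤ δ) (hδ1 : δ ≤ 1)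
    (ht : t ∈ Set.Ioo a b) {q : Fd a b} {u v : Fin 2 → Fd a b} {V : Fin 2 → Fin 2 → Fd a b}
    {g : Fd a b} {G : Fin 2 → Fin 2 → Fd a b} {r : Fin 2 → Fd a b}
    (hs : LinSys ε δ t q v V g (fun i j => nonlin u v i j + G i j)
      (fun i => r i - ∑ j, Dx j (nonlin u v i j))) {S K : ℝ} (hS : 1 ≤ S)
    (hv : ∀ i x, (v i).1 (t, x) ^ 2 ≤ S) (hu : ∀ i x, (u i).1 (t, x) ^ 2 ≤ S)
    (hdu : ∀ i j x, (Dx j (u i)).1 (t, x) ^ 2 ≤ S)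
    (hddu : ∀ i j k x, (Dx k (Dx j (u i))).1 (t, x) ^ 2 ≤ S) (k : Fin 2)
    (hg : ∀ x, (Dx k g).1 (t, x) ^ 2 ≤ K) (hG : ∀ i j x, (Dx k (G i j)).1 (t, x) ^ 2 ≤ δ ^ 2 * K)
    (hr : ∀ i x, (Dx k (r i)).1 (t, x) ^ 2 ≤ δ ^ 2 * K) :
    Int t (Dt (energyForm ε δ (Dx k q) (fun i => Dx k (v i)) (fun i j => Dx k (V i j))))
      ≤ 40100 * S * Int t (coreForm ε δ (Dx k q) (fun i => Dx k (v i)) (fun i j => Dx k (V i j)))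
      + 8 * K + 300 * S * Int t (sumSq v + sumSqD v) - 3 / 8 * Int t (sumSqD fun i => Dx k (v i))
      + 6 / 100 * Int t (sumSqDD v) := by
  have hδ : 0 < δ := hε.trans_le hεδ
  have hK : 0 ≤ K := (sq_nonneg _).trans (hg 0)
  have hS0 : (0 : ℝ) < S := by linarith
  have hs' : LinSys ε δ t (Dx k q) (fun i => Dx k (v i)) (fun i j => Dx k (V i j)) (Dx k g)
      (fun i j => Dx k (nonlin u v i j) + Dx k (G i j))
      (fun i => Dx k (r i) - ∑ j, Dx j (Dx k (nonlin u v i j))) := by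
    convert hs.dx ht k using 2
    · simp only [map_add]
    · simp only [map_sub, map_sum, Dx_Dx k]
  refine (energy_le hε hεδ ht hs' (S := 40000 * S) (by positivity)).trans ?_
  set F := coreForm ε δ (Dx k q) (fun i => Dx k (v i)) (fun i j => Dx k (V i j))
  have hQ := Int_pow_four_le ht hv
  have : Int t ((40100 * S) • F + (8 * K) • (1 : Fd a b) + (299 * S) • (sumSq v + sumSqD v)
      - (3 / 8 : ℝ) • (sumSqD fun i => Dx k (v i)) + (1 / 100 : ℝ) • (sumSq v + sumSqD v + sumSqDD v)
      + (192 * (40000 * S)⁻¹) • (∑ i, ∑ j, Dx j (v i) ^ 4))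
      ≤ 40100 * S * Int t F
      + 8 * K + 300 * S * Int t (sumSq v + sumSqD v) - 3 / 8 * Int t (sumSqD fun i => Dx k (v i))
      + 6 / 100 * Int t (sumSqDD v) := by
    rw [Int_add ht, Int_add ht, Int_sub ht, Int_add ht, Int_add ht, Int_smul, Int_smul, Int_smul,
      Int_smul, Int_smul, Int_smul, Int_one, Int_add ht _ (sumSqDD v)]
    have h1 : 192 * (40000 * S)⁻¹ * Int t (∑ i, ∑ j, Dx j (v i) ^ 4)
        ≤ 192 * (40000 * S)⁻¹ * (9 * S * Int t (sumSqDD v)) := by gcongr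
    have h2 : 192 * (40000 * S)⁻¹ * (9 * S * Int t (sumSqDD v))
        = 1728 / 40000 * Int t (sumSqDD v) := by field_simp; ring
    have h3 : 0 ≤ Int t (sumSqDD v) :=
      Int_nonneg fun x => (sq_nonneg _).trans (sq_le_sumSqDD v 0 0 0 _)
    have h4 : 0 ≤ Int t (sumSq v + sumSqD v) :=
      Int_nonneg fun x => add_nonneg ((sq_nonneg _).trans (sq_le_sumSq v 0 _))
        ((sq_nonneg _).trans (sq_le_sumSqD v 0 0 _))
    have h5 : Int t (sumSq v + sumSqD v) ≤ S * Int t (sumSq v + sumSqD v) := by nlinarith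
    linarith
  refine le_trans (Int_mono ht fun x => ?_) this
  have hd := fun l i j => Dx_nonlin_sq_le (fun i => hv i x) (fun i => hu i x)
    (fun i j => hdu i j x) l i j
  have hdd := fun l i j => Dx_Dx_nonlin_sq_le (fun i => hv i x) (fun i => hu i x)
    (fun i j => hdu i j x) (fun i j k => hddu i j k x) l k i j
  have hP0 : 0 ≤ (sumSq v).1 (t, x) := (sq_nonneg _).trans (sq_le_sumSq v 0 _)
  have hP1 : 0 ≤ (sumSqD v).1 (t, x) := (sq_nonneg _).trans (sq_le_sumSqD v 0 0 _)
  have hP2 : 0 ≤ (sumSqDD v).1 (t, x) := (sq_nonneg _).trans (sq_le_sumSqDD v 0 0 0 _)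
  have hF : 0 ≤ F.1 (t, x) := ((sq_nonneg _).trans (sq_le_sumSq _ 0 _)).trans
    (sumSq_le_coreForm hε hδ (Dx k q) (fun i => Dx k (v i)) (fun i j => Dx k (V i j)) (t, x))
  have e1 : (∑ i, ∑ j, (Dx j (Dx k (v i))).1 (t, x) ^ 2)
      = (sumSqD fun i => Dx k (v i)).1 (t, x) := by
    simp only [sumSqD, Fd.ev_sum, Fd.ev_pow]
  simp only [Fd.ev_add, Fd.ev_sub, Fd.ev_smul, Fd.ev_sum, Fd.ev_pow, e1] at hd hdd ⊢
  have hQ0 : 0 ≤ ∑ i, ∑ j, (Dx j (v i)).1 (t, x) ^ 4 :=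
    Finset.sum_nonneg fun _ _ => Finset.sum_nonneg fun _ _ => by positivity
  generalize (∑ i, ∑ j, (Dx j (v i)).1 (t, x) ^ 4) = Q4 at *
  generalize F.1 (t, x) = F at *
  generalize (sumSqD fun i => Dx k (v i)).1 (t, x) = PP at *
  generalize (sumSqD v).1 (t, x) = P3 at *
  generalize (sumSqDD v).1 (t, x) = P4 at *
  generalize (sumSq v).1 (t, x) = P2 at *
  have o1 : (1 : Fd a b).1 (t, x) = 1 := rfl
  rw [o1]
  simp only [Fin.sum_univ_two]
  have i1 : (40000 * S)⁻¹ * (((Dx 0 (Dx k (nonlin u v 0 0))).1 (t, x)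
        + (Dx 1 (Dx k (nonlin u v 0 1))).1 (t, x)) ^ 2
      + ((Dx 0 (Dx k (nonlin u v 1 0))).1 (t, x) + (Dx 1 (Dx k (nonlin u v 1 1))).1 (t, x)) ^ 2)
      ≤ 1 / 100 * (P2 + P3 + P4) + 192 * (40000 * S)⁻¹ * Q4 := by
    have e : 1 / 100 * (P2 + P3 + P4) + 192 * (40000 * S)⁻¹ * Q4
        = (40000 * S)⁻¹ * (400 * (S * (P2 + P3 + P4)) + 192 * Q4) := by field_simp; ring
    rw [e]
    refine mul_le_mul_of_nonneg_left ?_ (by positivity)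
    have s3 : ∀ A B : ℝ, (A + B) ^ 2 ≤ 2 * A ^ 2 + 2 * B ^ 2 := fun A B => by
      nlinarith [sq_nonneg (A - B)]
    have := s3 ((Dx 0 (Dx k (nonlin u v 0 0))).1 (t, x)) ((Dx 1 (Dx k (nonlin u v 0 1))).1 (t, x))
    have := s3 ((Dx 0 (Dx k (nonlin u v 1 0))).1 (t, x)) ((Dx 1 (Dx k (nonlin u v 1 1))).1 (t, x))
    have : 0 ≤ S * (P2 + P3 + P4) := by positivity
    linarith [hdd 0 0 0, hdd 1 0 1, hdd 0 1 0, hdd 1 1 1]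
  have i3 : F ≤ S * F := by nlinarith
  have i4 : ε * (Dx k g).1 (t, x) ^ 2 ≤ 1 * K :=
    mul_le_mul (hεδ.trans hδ1) (hg x) (sq_nonneg _) zero_le_one
  have i5 : δ ^ 2 * K ≤ K := mul_le_of_le_one_left hK (pow_le_one₀ hδ.le hδ1)
  have i6 : 0 ≤ S * (P2 + P3) := by positivity
  have i7 : 0 ≤ S * F := by positivity
  linarith [hd k 0 0, hd k 0 1, hd k 1 0, hd k 1 1, hG 0 0 x, hG 0 1 x, hG 1 0 x, hG 1 1 x,
    hr 0 x, hr 1 x]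

end TotalEnergy

section FullEnergy

variable {a b : ℝ}

/-- The full energy density: weighted base energy plus first-order energies. -/
def totE (ε δ : ℝ) (q : Fd a b) (v : Fin 2 → Fd a b) (V : Fin 2 → Fin 2 → Fd a b) : Fd a b :=
  δ⁻¹ • energyForm ε δ q v V
    + ∑ k, energyForm ε δ (Dx k q) (fun i => Dx k (v i)) (fun i j => Dx k (V i j))

/-- The quadratic form equivalent to `totE`. -/
def totF (ε δ : ℝ) (q : Fd a b) (v : Fin 2 → Fd a b) (V : Fin 2 → Fin 2 → Fd a b) : Fd a b :=
  δ⁻¹ • coreForm ε δ q v V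
    + ∑ k, coreForm ε δ (Dx k q) (fun i => Dx k (v i)) (fun i j => Dx k (V i j))

/-- The dissipation controlled by the full energy inequality. -/
def diss (δ : ℝ) (v : Fin 2 → Fd a b) : Fd a b := δ⁻¹ • sumSqD v + sumSqDD v

theorem totF_le_totE {ε δ : ℝ} (hε : 0 < ε) (hεδ : ε ≤ δ) (q : Fd a b)
    (v : Fin 2 → Fd a b) (V : Fin 2 → Fin 2 → Fd a b) (z : ℝ × Spc 2) :
    (totF ε δ q v V).1 z ≤ 12 * (totE ε δ q v V).1 z := by
  have hδ : 0 < δ⁻¹ := inv_pos.2 (hε.trans_le hεδ)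
  simp only [totF, totE, Fd.ev_add, Fd.ev_smul, Fin.sum_univ_two]
  have h := fun q v V => coreForm_le_energyForm (a := a) (b := b) hε hεδ q v V z
  have h0 := mul_le_mul_of_nonneg_left (h q v V) hδ.le
  linarith [h (Dx 0 q) (fun i => Dx 0 (v i)) (fun i j => Dx 0 (V i j)),
    h (Dx 1 q) (fun i => Dx 1 (v i)) (fun i j => Dx 1 (V i j))]

theorem totE_le_totF {ε δ : ℝ} (hε : 0 < ε) (hεδ : ε ≤ δ) (q : Fd a b)
    (v : Fin 2 → Fd a b) (V : Fin 2 → Fin 2 → Fd a b) (z : ℝ × Spc 2) :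
    (totE ε δ q v V).1 z ≤ 3 * (totF ε δ q v V).1 z := by
  have hδ : 0 < δ⁻¹ := inv_pos.2 (hε.trans_le hεδ)
  simp only [totF, totE, Fd.ev_add, Fd.ev_smul, Fin.sum_univ_two]
  have h := fun q v V => energyForm_le_coreForm (a := a) (b := b) hε hεδ q v V z
  have h0 := mul_le_mul_of_nonneg_left (h q v V) hδ.le
  linarith [h (Dx 0 q) (fun i => Dx 0 (v i)) (fun i j => Dx 0 (V i j)),
    h (Dx 1 q) (fun i => Dx 1 (v i)) (fun i j => Dx 1 (V i j))]

theorem sumSqD_eq (v : Fin 2 → Fd a b) : sumSqD v = ∑ k, sumSq fun i => Dx k (v i) := by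
  simp only [sumSqD, sumSq]
  exact Finset.sum_comm

theorem sumSqDD_eq (v : Fin 2 → Fd a b) : sumSqDD v = ∑ k, sumSqD fun i => Dx k (v i) := by
  simp only [sumSqDD, sumSqD]
  exact Finset.sum_comm

theorem sumSq_le_totF {ε δ : ℝ} (hε : 0 < ε) (hδ : 0 < δ) (q : Fd a b) (v : Fin 2 → Fd a b)
    (V : Fin 2 → Fin 2 → Fd a b) (z : ℝ × Spc 2) :
    δ⁻¹ * (sumSq v).1 z + (sumSqD v).1 z ≤ (totF ε δ q v V).1 z := by
  rw [sumSqD_eq]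
  simp only [totF, Fd.ev_add, Fd.ev_smul, Fd.ev_sum]
  have h := fun q v V => sumSq_le_coreForm (a := a) (b := b) hε hδ q v V z
  exact add_le_add (mul_le_mul_of_nonneg_left (h q v V) (inv_nonneg.2 hδ.le))
    (Finset.sum_le_sum fun k _ => h _ _ _)

theorem sumSq_nonneg (v : Fin 2 → Fd a b) (z : ℝ × Spc 2) : 0 ≤ (sumSq v).1 z :=
  (sq_nonneg _).trans (sq_le_sumSq v 0 z)

theorem sumSqD_nonneg (v : Fin 2 → Fd a b) (z : ℝ × Spc 2) : 0 ≤ (sumSqD v).1 z :=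
  (sq_nonneg _).trans (sq_le_sumSqD v 0 0 z)

theorem sumSqDD_nonneg (v : Fin 2 → Fd a b) (z : ℝ × Spc 2) : 0 ≤ (sumSqDD v).1 z :=
  (sq_nonneg _).trans (sq_le_sumSqDD v 0 0 0 z)

theorem deriv_totE_le {ε δ t : ℝ} (hε : 0 < ε) (hεδ : ε ≤ δ) (hδ1 : δ ≤ 1)
    (ht : t ∈ Set.Ioo a b) {q : Fd a b} {u v : Fin 2 → Fd a b} {V : Fin 2 → Fin 2 → Fd a b}
    {g : Fd a b} {G : Fin 2 → Fin 2 → Fd a b} {r : Fin 2 → Fd a b}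
    (hs : LinSys ε δ t q v V g (fun i j => nonlin u v i j + G i j)
      (fun i => r i - ∑ j, Dx j (nonlin u v i j))) {S K : ℝ} (hS : 1 ≤ S)
    (hv : ∀ i x, (v i).1 (t, x) ^ 2 ≤ S) (hu : ∀ i x, (u i).1 (t, x) ^ 2 ≤ S)
    (hdu : ∀ i j x, (Dx j (u i)).1 (t, x) ^ 2 ≤ S)
    (hddu : ∀ i j k x, (Dx k (Dx j (u i))).1 (t, x) ^ 2 ≤ S)
    (hg : ∀ x, g.1 (t, x) ^ 2 ≤ K) (hG : ∀ i j x, (G i j).1 (t, x) ^ 2 ≤ δ ^ 2 * K)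
    (hr : ∀ i x, (r i).1 (t, x) ^ 2 ≤ δ ^ 2 * K)
    (hdg : ∀ k x, (Dx k g).1 (t, x) ^ 2 ≤ K)
    (hdG : ∀ k i j x, (Dx k (G i j)).1 (t, x) ^ 2 ≤ δ ^ 2 * K)
    (hdr : ∀ k i x, (Dx k (r i)).1 (t, x) ^ 2 ≤ δ ^ 2 * K) :
    Int t (Dt (totE ε δ q v V)) ≤ 1000000 * S * Int t (totE ε δ q v V) + 24 * K
      - 1 / 4 * Int t (diss δ v) := by
  have hδ : 0 < δ := hε.trans_le hεδ
  have hS0 : (0 : ℝ) < S := by linarith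
  have hδi : 1 ≤ δ⁻¹ := (one_le_inv₀ hδ).2 hδ1
  have h0 := mul_le_mul_of_nonneg_left
    (base_energy_le hε hεδ hδ1 ht hs hS hv hu hdu hg hG hr) (inv_nonneg.2 hδ.le)
  have h1 := fun k => deriv_energy_le hε hεδ hδ1 ht hs hS hv hu hdu hddu k (hdg k) (hdG k) (hdr k)
  have hF : Int t (totF ε δ q v V) ≤ 12 * Int t (totE ε δ q v V) := by
    rw [← Int_smul]
    exact Int_mono ht fun x => totF_le_totE hε hεδ q v V (t, x)
  have hP : Int t (sumSq v + sumSqD v) ≤ Int t (totF ε δ q v V) :=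
    Int_mono ht fun x => by
      have := sumSq_le_totF hε hδ q v V (t, x)
      rw [Fd.ev_add]
      nlinarith [sumSq_nonneg v (t, x)]
  have hDD : Int t (sumSqDD v) = Int t (sumSqD fun i => Dx 0 (v i))
      + Int t (sumSqD fun i => Dx 1 (v i)) := by
    rw [sumSqDD_eq, Fin.sum_univ_two, Int_add ht]
  have hDD0 : 0 ≤ Int t (sumSqDD v) := Int_nonneg fun x => sumSqDD_nonneg v _
  have eF : Int t (totF ε δ q v V) = δ⁻¹ * Int t (coreForm ε δ q v V)
      + (Int t (coreForm ε δ (Dx 0 q) (fun i => Dx 0 (v i)) (fun i j => Dx 0 (V i j)))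
      + Int t (coreForm ε δ (Dx 1 q) (fun i => Dx 1 (v i)) (fun i j => Dx 1 (V i j)))) := by
    rw [totF, Int_add ht, Int_smul, Fin.sum_univ_two, Int_add ht]
  have eE : Int t (Dt (totE ε δ q v V)) = δ⁻¹ * Int t (Dt (energyForm ε δ q v V))
      + (Int t (Dt (energyForm ε δ (Dx 0 q) (fun i => Dx 0 (v i)) (fun i j => Dx 0 (V i j))))
      + Int t (Dt (energyForm ε δ (Dx 1 q) (fun i => Dx 1 (v i)) (fun i j => Dx 1 (V i j))))) := by
    rw [totE, map_add, Derivation.map_smul, Int_add ht, Int_smul, Fin.sum_univ_two, map_add,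
      Int_add ht]
  have eD : Int t (diss δ v) = δ⁻¹ * Int t (sumSqD v) + Int t (sumSqDD v) := by
    rw [diss, Int_add ht, Int_smul]
  have hc0 : 0 ≤ δ⁻¹ * Int t (coreForm ε δ q v V) := mul_nonneg (inv_nonneg.2 hδ.le)
    (Int_nonneg fun x => (sumSq_nonneg v _).trans (sumSq_le_coreForm hε hδ q v V _))
  have hc := fun k => Int_nonneg (t := t) fun x => (sumSq_nonneg _ _).trans
    (sumSq_le_coreForm hε hδ (Dx k q) (fun i => Dx k (v i)) (fun i j => Dx k (V i j)) (t, x))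
  have e0 : δ⁻¹ * (40200 * S * Int t (coreForm ε δ q v V) + 8 * δ * K
      - 1 / 4 * Int t (sumSqD v)) = 40200 * (S * (δ⁻¹ * Int t (coreForm ε δ q v V)))
      + 8 * K - 1 / 4 * (δ⁻¹ * Int t (sumSqD v)) := by
    field_simp
  rw [e0] at h0
  have m0 := mul_nonneg hS0.le hc0
  have m1 := mul_nonneg hS0.le (hc 0)
  have m2 := mul_nonneg hS0.le (hc 1)
  have m3 := mul_le_mul_of_nonneg_left hP hS0.le
  have m4 := mul_le_mul_of_nonneg_left hF hS0.le
  have hF0 : 0 ≤ Int t (totF ε δ q v V) := by rw [eF]; linarith [hc 0, hc 1]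
  have m5 := mul_nonneg hS0.le hF0
  have m6 : S * Int t (totF ε δ q v V) = S * (δ⁻¹ * Int t (coreForm ε δ q v V))
      + (S * Int t (coreForm ε δ (Dx 0 q) (fun i => Dx 0 (v i)) (fun i j => Dx 0 (V i j)))
      + S * Int t (coreForm ε δ (Dx 1 q) (fun i => Dx 1 (v i)) (fun i j => Dx 1 (V i j)))) := by
    rw [eF]; ring
  have h10 := h1 0
  have h11 := h1 1
  simp only [mul_assoc] at h10 h11 ⊢
  rw [eE, eD]
  linarith

theorem sq_le_energy {ε δ t : ℝ} (hε : 0 < ε) (hεδ : ε ≤ δ) (hδ1 : δ ≤ 1)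
    (ht : t ∈ Set.Ioo a b) (q : Fd a b) (v : Fin 2 → Fd a b) (V : Fin 2 → Fin 2 → Fd a b)
    {s : ℝ} (hs : 0 < s) (hsδ : s ^ 2 = δ) (i : Fin 2) (x : Spc 2) :
    (v i).1 (t, x) ^ 2 ≤ s * (48 * Int t (totE ε δ q v V) + 3 * Int t (diss δ v)) := by
  have hδ : 0 < δ := hε.trans_le hεδ
  have hs1 : s ≤ 1 := by nlinarith
  have h := Fd.sq_le ht (v i) (inv_pos.2 hs) x
  rw [inv_inv] at h
  have hF : Int t (totF ε δ q v V) ≤ 12 * Int t (totE ε δ q v V) := by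
    rw [← Int_smul]
    exact Int_mono ht fun x => totF_le_totE hε hεδ q v V (t, x)
  have h1 : Int t (v i ^ 2) ≤ δ * Int t (totF ε δ q v V) := by
    rw [← Int_smul]
    refine Int_mono ht fun x => ?_
    rw [Fd.ev_smul, Fd.ev_pow]
    have h1 := sumSq_le_totF hε hδ q v V (t, x)
    have h2 := sumSqD_nonneg v (t, x)
    have h3 := sq_le_sumSq v i (t, x)
    have h4 : δ⁻¹ * (v i).1 (t, x) ^ 2 ≤ (totF ε δ q v V).1 (t, x) := by
      have := mul_le_mul_of_nonneg_left h3 (inv_nonneg.2 hδ.le)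
      linarith
    rwa [inv_mul_le_iff₀ hδ] at h4
  have eD : Int t (diss δ v) = δ⁻¹ * Int t (sumSqD v) + Int t (sumSqDD v) := by
    rw [diss, Int_add ht, Int_smul]
  have h20 : 0 ≤ Int t (sumSqD v) := Int_nonneg fun x => sumSqD_nonneg v _
  have h30 : 0 ≤ Int t (sumSqDD v) := Int_nonneg fun x => sumSqDD_nonneg v _
  have h2 : Int t (Dx 0 (v i) ^ 2) + Int t (Dx 1 (v i) ^ 2) ≤ Int t (sumSqD v) := by
    rw [← Int_add ht]
    refine Int_mono ht fun x => ?_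
    simp only [sumSqD, Fin.sum_univ_two, Fd.ev_add, Fd.ev_pow]
    fin_cases i <;> simp only [Fin.isValue, Fin.zero_eta, Fin.mk_one] <;> nlinarith [sq_nonneg ((Dx 0 (v 0)).1 (t, x)), sq_nonneg ((Dx 1 (v 0)).1 (t, x)),
      sq_nonneg ((Dx 0 (v 1)).1 (t, x)), sq_nonneg ((Dx 1 (v 1)).1 (t, x))]
  have h3 : Int t (Dx 1 (Dx 0 (v i)) ^ 2) ≤ Int t (sumSqDD v) :=
    Int_mono ht fun x => sq_le_sumSqDD v i 0 1 (t, x)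
  have hF0 : 0 ≤ Int t (totF ε δ q v V) := Int_nonneg fun x => by
    have := sumSq_le_totF hε hδ q v V (t, x)
    have h5 := sumSqD_nonneg v (t, x)
    have h6 := mul_nonneg (inv_nonneg.2 hδ.le) (sumSq_nonneg v (t, x))
    linarith
  have k1 : (3 + s⁻¹) * Int t (v i ^ 2) ≤ 4 * s * Int t (totF ε δ q v V) := by
    calc (3 + s⁻¹) * Int t (v i ^ 2) ≤ (3 + s⁻¹) * (δ * Int t (totF ε δ q v V)) := by gcongr
      _ = (3 * s ^ 2 + s) * Int t (totF ε δ q v V) := by rw [← hsδ]; field_simp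
      _ ≤ _ := by
        gcongr
        nlinarith
  have k2 : Int t (sumSqD v) ≤ s * (δ⁻¹ * Int t (sumSqD v)) := by
    rw [← hsδ]
    have : s * ((s ^ 2)⁻¹ * Int t (sumSqD v)) = s⁻¹ * Int t (sumSqD v) := by field_simp
    rw [this]
    exact le_mul_of_one_le_left h20 ((one_le_inv₀ hs).2 hs1)
  have k3 : s * Int t (Dx 1 (Dx 0 (v i)) ^ 2) ≤ s * Int t (sumSqDD v) := by gcongr
  have k4 : s * Int t (totF ε δ q v V) ≤ s * (12 * Int t (totE ε δ q v V)) := by gcongr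
  have k5 : 0 ≤ s * (δ⁻¹ * Int t (sumSqD v)) := by positivity
  have k6 : 0 ≤ s * Int t (sumSqDD v) := by positivity
  rw [eD]
  linarith

theorem deriv_totE_le_of_le {ε δ t : ℝ} (hε : 0 < ε) (hεδ : ε ≤ δ) (hδ1 : δ ≤ 1)
    (ht : t ∈ Set.Ioo a b) {q : Fd a b} {u v : Fin 2 → Fd a b} {V : Fin 2 → Fin 2 → Fd a b}
    {g : Fd a b} {G : Fin 2 → Fin 2 → Fd a b} {r : Fin 2 → Fd a b}
    (hs : LinSys ε δ t q v V g (fun i j => nonlin u v i j + G i j)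
      (fun i => r i - ∑ j, Dx j (nonlin u v i j))) {K : ℝ} (hK : 1 ≤ K)
    (hu : ∀ i x, (u i).1 (t, x) ^ 2 ≤ K)
    (hdu : ∀ i j x, (Dx j (u i)).1 (t, x) ^ 2 ≤ K)
    (hddu : ∀ i j k x, (Dx k (Dx j (u i))).1 (t, x) ^ 2 ≤ K)
    (hg : ∀ x, g.1 (t, x) ^ 2 ≤ K) (hG : ∀ i j x, (G i j).1 (t, x) ^ 2 ≤ δ ^ 2 * K)
    (hr : ∀ i x, (r i).1 (t, x) ^ 2 ≤ δ ^ 2 * K)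
    (hdg : ∀ k x, (Dx k g).1 (t, x) ^ 2 ≤ K)
    (hdG : ∀ k i j x, (Dx k (G i j)).1 (t, x) ^ 2 ≤ δ ^ 2 * K)
    (hdr : ∀ k i x, (Dx k (r i)).1 (t, x) ^ 2 ≤ δ ^ 2 * K)
    {s M : ℝ} (hs0 : 0 < s) (hsδ : s ^ 2 = δ) (hM : Int t (totE ε δ q v V) ≤ M)
    (hsM : 12000000 * (s * M) ≤ 1) :
    Int t (Dt (totE ε δ q v V)) ≤ (1000000 * K + 4) * Int t (totE ε δ q v V) + 24 * K := by
  have hδ : 0 < δ := hε.trans_le hεδ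
  have hE0 : 0 ≤ Int t (totE ε δ q v V) := Int_nonneg fun x => by
    have h1 := totF_le_totE hε hεδ q v V (t, x)
    have h2 := sumSq_le_totF hε hδ q v V (t, x)
    have h5 := sumSqD_nonneg v (t, x)
    have h6 := mul_nonneg (inv_nonneg.2 hδ.le) (sumSq_nonneg v (t, x))
    linarith
  have hD0 : 0 ≤ Int t (diss δ v) := Int_nonneg fun x => by
    have h5 := sumSqDD_nonneg v (t, x)
    have h6 := mul_nonneg (inv_nonneg.2 hδ.le) (sumSqD_nonneg v (t, x))
    simp only [diss, Fd.ev_add, Fd.ev_smul]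
    linarith
  set E := Int t (totE ε δ q v V)
  set D := Int t (diss δ v)
  have hB : 0 ≤ s * (48 * E + 3 * D) := by positivity
  have hb : ∀ {y : ℝ}, y ≤ K → y ≤ K + s * (48 * E + 3 * D) := fun h => by linarith
  have := deriv_totE_le hε hεδ hδ1 ht hs (S := K + s * (48 * E + 3 * D)) (hb hK)
    (fun i x => (sq_le_energy hε hεδ hδ1 ht q v V hs0 hsδ i x).trans (by linarith))
    (fun i x => hb (hu i x)) (fun i j x => hb (hdu i j x)) (fun i j k x => hb (hddu i j k x))
    hg hG hr hdg hdG hdr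
  refine this.trans ?_
  have hsE : 12000000 * (s * E) ≤ 1 := by nlinarith
  have k1 : 12000000 * (s * E) * D ≤ 1 * D := by gcongr
  have k2 : 12000000 * (s * E) * E ≤ 1 * E := by gcongr
  change 1000000 * (K + s * (48 * E + 3 * D)) * E + 24 * K - 1 / 4 * D
    ≤ (1000000 * K + 4) * E + 24 * K
  linarith

end FullEnergy

section Difference

variable {a b : ℝ}

theorem Dd_congr (e : ℝ × Spc 2) {f g : Fd a b} (h : ∀ z ∈ slab a b, f.1 z = g.1 z)
    {z : ℝ × Spc 2} (hz : z ∈ slab a b) : (Dd e f).1 z = (Dd e g).1 z := by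
  rw [Dd_apply e f hz, Dd_apply e g hz]
  have : f.1 =ᶠ[nhds z] g.1 := by
    filter_upwards [(isOpen_slab a b).mem_nhds hz] with r hr using h r hr
  rw [this.fderiv_eq]

/-- The relaxation system for fields on a slab. -/
structure RelSys (ε δ : ℝ) (p : Fd a b) (u : Fin 2 → Fd a b) (U : Fin 2 → Fin 2 → Fd a b) :
    Prop where
  mass : ∀ z ∈ slab a b, (ε • Dt p + ∑ i, Dx i (u i)).1 z = 0
  momentum : ∀ i, ∀ z ∈ slab a b, (Dt (u i) + ∑ j, Dx j (U i j) + Dx i p).1 z = 0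
  stress : ∀ i j, ∀ z ∈ slab a b, (δ • Dt (U i j) + Dx j (u i) + U i j).1 z = (u i * u j).1 z

/-- The Navier–Stokes equations at a fixed time for fields on a slab. -/
structure NSAt (t : ℝ) (p : Fd a b) (u : Fin 2 → Fd a b) : Prop where
  div_free : ∀ x, (∑ i, Dx i (u i)).1 (t, x) = 0
  momentum : ∀ i x, (Dt (u i) + ∑ j, Dx j (u i * u j) - ∑ j, Dx j (Dx j (u i))
    + Dx i p).1 (t, x) = 0

theorem RelSys.wave {ε δ : ℝ} (hε : 0 < ε) {p : Fd a b} {u : Fin 2 → Fd a b}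
    {U : Fin 2 → Fin 2 → Fd a b} (h : RelSys ε δ p u U) (i : Fin 2) {z : ℝ × Spc 2}
    (hz : z ∈ slab a b) :
    (δ • Dt (Dt (u i)) + Dt (u i) - ∑ j, Dx j (Dx j (u i)) - (δ / ε) • Dx i (∑ j, Dx j (u j))
      + Dx i p + ∑ j, Dx j (u i * u j)).1 z = 0 := by
  have h1 := Dd_congr (1, 0) (g := 0) (h.momentum i) hz
  have h2 := Dd_congr (0, Pi.single i 1) (g := 0) h.mass hz
  have h3 := fun j => Dd_congr (0, Pi.single j 1) (h.stress i j) hz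
  have h30 := h3 0
  have h31 := h3 1
  have h4 := h.momentum i z hz
  simp only [map_add, Derivation.map_smul, map_zero, Fin.sum_univ_two, Fd.ev_add,
    Fd.ev_sub, Fd.ev_smul, Dt_Dx] at h1 h2 h30 h31 h4 ⊢
  simp only [show (0 : Fd a b).1 z = 0 from rfl] at h1 h2
  have h2' : (Dx i (Dt p)).1 z = -(ε⁻¹ * ((Dx i (Dx 0 (u 0))).1 z + (Dx i (Dx 1 (u 1))).1 z)) := by
    field_simp
    linarith
  rw [h2'] at h1
  have e : δ * (-(ε⁻¹ * ((Dx i (Dx 0 (u 0))).1 z + (Dx i (Dx 1 (u 1))).1 z)))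
      = -(δ / ε * ((Dx i (Dx 0 (u 0))).1 z + (Dx i (Dx 1 (u 1))).1 z)) := by ring
  have h1' := congrArg (δ * ·) h1
  simp only [mul_add, mul_zero] at h1'
  rw [mul_add] at e
  linarith

/-- The Navier–Stokes stress tensor as a field. -/
def nsStress (u : Fin 2 → Fd a b) (i j : Fin 2) : Fd a b := u i * u j - Dx j (u i)

theorem linSys_sub {ε δ : ℝ} (hε : 0 < ε) {p pE : Fd a b} {u uE : Fin 2 → Fd a b}
    {UE : Fin 2 → Fin 2 → Fd a b} {t : ℝ} (ht : t ∈ Set.Ioo a b) (h : RelSys ε δ pE uE UE)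
    (hN : NSAt t p u) :
    LinSys ε δ t (pE - p) (uE - u) (UE - nsStress u) (-Dt p)
      (fun i j => nonlin u (uE - u) i j + -(δ • Dt (nsStress u i j)))
      (fun i => -(δ • Dt (Dt (u i))) - ∑ j, Dx j (nonlin u (uE - u) i j)) where
  mass x := by
    have h1 := h.mass (t, x) (mem_slab.2 ht)
    have h2 := hN.div_free x
    simp only [map_sub, Fin.sum_univ_two, Fd.ev_add, Fd.ev_sub,
      Fd.ev_smul, Fd.ev_neg, Pi.sub_apply] at h1 h2 ⊢
    linarith
  momentum i x := by
    have h1 := h.momentum i (t, x) (mem_slab.2 ht)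
    have h2 := hN.momentum i x
    simp only [nsStress, map_sub, Fin.sum_univ_two, Fd.ev_add, Fd.ev_sub,
      Pi.sub_apply] at h1 h2 ⊢
    linarith
  stress i j x := by
    have h1 := h.stress i j (t, x) (mem_slab.2 ht)
    simp only [nsStress, nonlin, map_sub, Fd.ev_add, Fd.ev_sub, Fd.ev_mul,
      Fd.ev_smul, Fd.ev_neg, Pi.sub_apply] at h1 ⊢
    linear_combination h1
  wave i x := by
    have h1 := h.wave hε i (mem_slab.2 ht : ((t, x) : ℝ × Spc 2) ∈ slab a b)
    have h2 := hN.momentum i x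
    have h3 := Dx_congr i ht (g := 0) hN.div_free x
    have e : ∀ j, nonlin u (uE - u) i j = uE i * uE j - u i * u j := fun j => by
      simp only [nonlin, Pi.sub_apply]; ring
    simp only [e, map_add, map_sub, map_zero, Fin.sum_univ_two, Fd.ev_add,
      Fd.ev_sub, Fd.ev_smul, Fd.ev_neg, Pi.sub_apply] at h1 h2 h3 ⊢
    simp only [show (0 : Fd a b).1 (t, x) = 0 from rfl] at h3
    linear_combination h1 - h2 + (δ / ε) * h3

end Difference

section Bounds

variable {a b A B : ℝ}

theorem Per.exists_cube {f : Spc 2 → ℝ} (hf : Per f) (x : Spc 2) : ∃ y ∈ cube 2, f y = f x := by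
  refine ⟨fun i => x i + ((-⌊x i⌋ : ℤ) : ℝ), ?_, hf x fun i => -⌊x i⌋⟩
  intro i _
  have : x i + ((-⌊x i⌋ : ℤ) : ℝ) = Int.fract (x i) := by
    push_cast
    rw [← sub_eq_add_neg, Int.self_sub_floor]
  simp only [this]
  exact ⟨Int.fract_nonneg _, (Int.fract_lt_one _).le⟩

theorem Fd.exists_sq_le {T : ℝ} (hA : A < 0) (hB : T < B) (f : Fd A B) :
    ∃ K : ℝ, 0 ≤ K ∧ ∀ t ∈ Set.Icc 0 T, ∀ x, f.1 (t, x) ^ 2 ≤ K := by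
  have hsub : Set.Icc 0 T ×ˢ cube 2 ⊆ slab A B := fun z hz =>
    mem_slab.2 ⟨hA.trans_le hz.1.1, hz.1.2.trans_lt hB⟩
  obtain ⟨C, hC⟩ := (isCompact_Icc.prod isCompact_cube).exists_bound_of_continuousOn
    (f.contDiffOn.continuousOn.mono hsub)
  refine ⟨C ^ 2, sq_nonneg _, fun t ht x => ?_⟩
  obtain ⟨y, hy, hxy⟩ := (f.per ⟨hA.trans_le ht.1, ht.2.trans_lt hB⟩).exists_cube x
  rw [← hxy]
  exact sq_le_sq' (abs_le.1 (hC (t, y) ⟨ht, hy⟩)).1 (abs_le.1 (hC (t, y) ⟨ht, hy⟩)).2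

theorem Fd.exists_sq_le_family {T : ℝ} (hA : A < 0) (hB : T < B) {ι : Type*} [Fintype ι]
    (f : ι → Fd A B) :
    ∃ K : ℝ, 0 ≤ K ∧ ∀ i, ∀ t ∈ Set.Icc 0 T, ∀ x, (f i).1 (t, x) ^ 2 ≤ K := by
  choose K hK0 hK using fun i => (f i).exists_sq_le hA hB
  exact ⟨∑ i, K i, Finset.sum_nonneg fun i _ => hK0 i, fun i t ht x => (hK i t ht x).trans
    (Finset.single_le_sum (fun i _ => hK0 i) (Finset.mem_univ i))⟩

/-- Restriction of fields to a smaller slab. -/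
def res (ha : A ≤ a) (hb : b ≤ B) : Fd A B →ₐ[ℝ] Fd a b where
  toFun f := ⟨f.1, f.2.1.mono (Set.prod_mono (Set.Ioo_subset_Ioo ha hb) subset_rfl),
    fun t ht => f.2.2 t (Set.Ioo_subset_Ioo ha hb ht)⟩
  map_one' := rfl
  map_mul' _ _ := rfl
  map_zero' := rfl
  map_add' _ _ := rfl
  commutes' _ := rfl

theorem res_apply (ha : A ≤ a) (hb : b ≤ B) (f : Fd A B) (z : ℝ × Spc 2) :
    (res ha hb f).1 z = f.1 z := rfl

theorem slab_mono (ha : A ≤ a) (hb : b ≤ B) : slab a b ⊆ slab A B :=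
  Set.prod_mono (Set.Ioo_subset_Ioo ha hb) subset_rfl

theorem Dd_res (ha : A ≤ a) (hb : b ≤ B) (e : ℝ × Spc 2) {f : Fd A B} {g : Fd a b}
    (h : ∀ z ∈ slab a b, g.1 z = f.1 z) :
    ∀ z ∈ slab a b, (Dd e g).1 z = (Dd e f).1 z := fun z hz => by
  rw [Dd_congr e (g := res ha hb f) h hz, Dd_apply _ _ hz, Dd_apply _ _ (slab_mono ha hb hz)]
  rfl

/-- Pointwise bounds on a Navier–Stokes solution at a fixed time. -/
structure NSBd (K t : ℝ) (p : Fd a b) (u : Fin 2 → Fd a b) : Prop where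
  u0 : ∀ i x, (u i).1 (t, x) ^ 2 ≤ K
  u1 : ∀ i j x, (Dx j (u i)).1 (t, x) ^ 2 ≤ K
  u2 : ∀ i j k x, (Dx k (Dx j (u i))).1 (t, x) ^ 2 ≤ K
  pt : ∀ x, (Dt p).1 (t, x) ^ 2 ≤ K
  pt1 : ∀ k x, (Dx k (Dt p)).1 (t, x) ^ 2 ≤ K
  st : ∀ i j x, (Dt (nsStress u i j)).1 (t, x) ^ 2 ≤ K
  st1 : ∀ k i j x, (Dx k (Dt (nsStress u i j))).1 (t, x) ^ 2 ≤ K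
  utt : ∀ i x, (Dt (Dt (u i))).1 (t, x) ^ 2 ≤ K
  utt1 : ∀ k i x, (Dx k (Dt (Dt (u i)))).1 (t, x) ^ 2 ≤ K
  p0 : ∀ x, p.1 (t, x) ^ 2 ≤ K
  p1 : ∀ i x, (Dx i p).1 (t, x) ^ 2 ≤ K
  p2 : ∀ i j x, (Dx j (Dx i p)).1 (t, x) ^ 2 ≤ K
  s0 : ∀ i j x, (nsStress u i j).1 (t, x) ^ 2 ≤ K
  s1 : ∀ k i j x, (Dx k (nsStress u i j)).1 (t, x) ^ 2 ≤ K
  s2 : ∀ k l i j x, (Dx k (Dx l (nsStress u i j))).1 (t, x) ^ 2 ≤ K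

theorem exists_NSBd {T : ℝ} (hA : A < 0) (hB : T < B) (p : Fd A B) (u : Fin 2 → Fd A B) :
    ∃ K : ℝ, 1 ≤ K ∧ ∀ t ∈ Set.Icc 0 T, NSBd K t p u := by
  have key : ∀ {ι : Type} [Fintype ι] (f : ι → Fd A B),
      ∃ K : ℝ, 0 ≤ K ∧ ∀ i, ∀ t ∈ Set.Icc 0 T, ∀ x, (f i).1 (t, x) ^ 2 ≤ K := fun f =>
    Fd.exists_sq_le_family hA hB f
  obtain ⟨K1, h1, k1⟩ := key u
  obtain ⟨K2, h2, k2⟩ := key fun m : Fin 2 × Fin 2 => Dx m.2 (u m.1)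
  obtain ⟨K3, h3, k3⟩ := key fun m : Fin 2 × Fin 2 × Fin 2 => Dx m.2.2 (Dx m.2.1 (u m.1))
  obtain ⟨K4, h4, k4⟩ := key fun _ : Fin 1 => Dt p
  obtain ⟨K5, h5, k5⟩ := key fun k : Fin 2 => Dx k (Dt p)
  obtain ⟨K6, h6, k6⟩ := key fun m : Fin 2 × Fin 2 => Dt (nsStress u m.1 m.2)
  obtain ⟨K7, h7, k7⟩ := key fun m : Fin 2 × Fin 2 × Fin 2 =>
    Dx m.1 (Dt (nsStress u m.2.1 m.2.2))
  obtain ⟨K8, h8, k8⟩ := key fun i : Fin 2 => Dt (Dt (u i))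
  obtain ⟨K9, h9, k9⟩ := key fun m : Fin 2 × Fin 2 => Dx m.1 (Dt (Dt (u m.2)))
  obtain ⟨K10, h10, k10⟩ := key fun _ : Fin 1 => p
  obtain ⟨K11, h11, k11⟩ := key fun k : Fin 2 => Dx k p
  obtain ⟨K12, h12, k12⟩ := key fun m : Fin 2 × Fin 2 => Dx m.2 (Dx m.1 p)
  obtain ⟨K13, h13, k13⟩ := key fun m : Fin 2 × Fin 2 => nsStress u m.1 m.2
  obtain ⟨K14, h14, k14⟩ := key fun m : Fin 2 × Fin 2 × Fin 2 => Dx m.1 (nsStress u m.2.1 m.2.2)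
  obtain ⟨K15, h15, k15⟩ := key fun m : Fin 2 × Fin 2 × Fin 2 × Fin 2 =>
    Dx m.1 (Dx m.2.1 (nsStress u m.2.2.1 m.2.2.2))
  refine ⟨1 + K1 + K2 + K3 + K4 + K5 + K6 + K7 + K8 + K9 + K10 + K11 + K12 + K13 + K14 + K15,
    by linarith, fun t ht => ?_⟩
  exact
    { u0 := fun i x => (k1 i t ht x).trans (by linarith)
      u1 := fun i j x => (k2 (i, j) t ht x).trans (by linarith)
      u2 := fun i j k x => (k3 (i, j, k) t ht x).trans (by linarith)
      pt := fun x => (k4 0 t ht x).trans (by linarith)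
      pt1 := fun k x => (k5 k t ht x).trans (by linarith)
      st := fun i j x => (k6 (i, j) t ht x).trans (by linarith)
      st1 := fun k i j x => (k7 (k, i, j) t ht x).trans (by linarith)
      utt := fun i x => (k8 i t ht x).trans (by linarith)
      utt1 := fun k i x => (k9 (k, i) t ht x).trans (by linarith)
      p0 := fun x => (k10 0 t ht x).trans (by linarith)
      p1 := fun k x => (k11 k t ht x).trans (by linarith)
      p2 := fun i j x => (k12 (i, j) t ht x).trans (by linarith)
      s0 := fun i j x => (k13 (i, j) t ht x).trans (by linarith)
      s1 := fun k i j x => (k14 (k, i, j) t ht x).trans (by linarith)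
      s2 := fun k l i j x => (k15 (k, l, i, j) t ht x).trans (by linarith) }

theorem NSBd.res {K t : ℝ} (ht : t ∈ Set.Ioo a b) (ha : A ≤ a) (hb : b ≤ B) {p : Fd A B}
    {u : Fin 2 → Fd A B} (h : NSBd K t p u) :
    NSBd K t (res ha hb p) (fun i => res ha hb (u i)) := by
  have hz : ∀ x, ((t, x) : ℝ × Spc 2) ∈ slab a b := fun x => mem_slab.2 ht
  have r0 : ∀ f : Fd A B, ∀ z ∈ slab a b, (NSRelax.res ha hb f).1 z = f.1 z := fun _ _ _ => rfl
  have rs : ∀ i j, ∀ z ∈ slab a b,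
      (nsStress (fun i => NSRelax.res ha hb (u i)) i j).1 z = (nsStress u i j).1 z := by
    intro i j z hz
    simp only [nsStress, Fd.ev_sub, Fd.ev_mul, res_apply, Dd_res ha hb _ (r0 _) z hz]
  have d := fun e {f : Fd A B} {g : Fd a b} => Dd_res ha hb e (f := f) (g := g)
  constructor
  · exact h.u0
  · intro i j x; rw [d _ (r0 _) _ (hz x)]; exact h.u1 i j x
  · intro i j k x; rw [d _ (d _ (r0 _)) _ (hz x)]; exact h.u2 i j k x
  · intro x; rw [d _ (r0 _) _ (hz x)]; exact h.pt x
  · intro k x; rw [d _ (d _ (r0 _)) _ (hz x)]; exact h.pt1 k x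
  · intro i j x; rw [d _ (rs _ _) _ (hz x)]; exact h.st i j x
  · intro k i j x; rw [d _ (d _ (rs _ _)) _ (hz x)]; exact h.st1 k i j x
  · intro i x; rw [d _ (d _ (r0 _)) _ (hz x)]; exact h.utt i x
  · intro k i x; rw [d _ (d _ (d _ (r0 _))) _ (hz x)]; exact h.utt1 k i x
  · exact h.p0
  · intro i x; rw [d _ (r0 _) _ (hz x)]; exact h.p1 i x
  · intro i j x; rw [d _ (d _ (r0 _)) _ (hz x)]; exact h.p2 i j x
  · intro i j x; rw [rs _ _ _ (hz x)]; exact h.s0 i j x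
  · intro k i j x; rw [d _ (rs _ _) _ (hz x)]; exact h.s1 k i j x
  · intro k l i j x; rw [d _ (d _ (rs _ _)) _ (hz x)]; exact h.s2 k l i j x

theorem NSAt.res {t : ℝ} (ht : t ∈ Set.Ioo a b) (ha : A ≤ a) (hb : b ≤ B) {p : Fd A B}
    {u : Fin 2 → Fd A B} (h : NSAt t p u) :
    NSAt t (res ha hb p) (fun i => res ha hb (u i)) := by
  have hz : ∀ x, ((t, x) : ℝ × Spc 2) ∈ slab a b := fun x => mem_slab.2 ht
  have r0 : ∀ f : Fd A B, ∀ z ∈ slab a b, (NSRelax.res ha hb f).1 z = f.1 z := fun _ _ _ => rfl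
  have d := fun e {f : Fd A B} {g : Fd a b} => Dd_res ha hb e (f := f) (g := g)
  constructor
  · intro x
    have e := h.div_free x
    rw [Fin.sum_univ_two, Fd.ev_add] at e ⊢
    rw [← e, d _ (r0 _) _ (hz x), d _ (r0 _) _ (hz x)]
  · intro i x
    have e := h.momentum i x
    simp only [Fin.sum_univ_two, Fd.ev_add, Fd.ev_sub] at e ⊢
    rw [← e]
    have hm : ∀ j, (Dx j (NSRelax.res ha hb (u i) * NSRelax.res ha hb (u j))).1 (t, x)
        = (Dx j (u i * u j)).1 (t, x) := fun j => d _ (fun z _ => rfl) _ (hz x)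
    rw [hm, hm, d _ (r0 _) _ (hz x), d _ (r0 _) _ (hz x), d _ (d _ (r0 _)) _ (hz x),
      d _ (d _ (r0 _)) _ (hz x)]

/-- The continuity argument closing the energy inequality. -/
theorem bootstrap {f f' : ℝ → ℝ} {T T0 E0 L D M : ℝ} (hTT : T ≤ T0) (hE0 : 0 ≤ E0) (hL : 0 ≤ L)
    (hD : 0 ≤ D) (hM : M = (E0 + D + 1) * exp ((L + 1) * T0)) (h0 : f 0 ≤ E0)
    (hd : ∀ t ∈ Set.Icc 0 T, HasDerivAt f (f' t) t)
    (hf' : ∀ t ∈ Set.Icc 0 T, f t ≤ M → f' t ≤ L * f t + D) :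
    ∀ t ∈ Set.Icc 0 T, f t ≤ M := by
  set Bd : ℝ → ℝ := fun t => (E0 + D + 1) * exp ((L + 1) * t)
  have hBd : ∀ t, HasDerivAt Bd ((L + 1) * Bd t) t := fun t => by
    have h1 : HasDerivAt (fun t => (L + 1) * t) (L + 1) t := by
      simpa using (hasDerivAt_id t).const_mul (L + 1)
    have := (h1.exp).const_mul (E0 + D + 1)
    exact this.congr_deriv (by simp only [Bd]; ring)
  have hBM : ∀ t ∈ Set.Icc 0 T, Bd t ≤ M := fun t ht => by
    rw [hM]
    have := ht.2.trans hTT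
    simp only [Bd]
    gcongr
  have key := image_le_of_deriv_right_lt_deriv_boundary' (f := f) (f' := f') (B := Bd)
    (B' := fun t => (L + 1) * Bd t) (a := 0) (b := T)
    (fun t ht => (hd t ht).continuousAt.continuousWithinAt)
    (fun t ht => (hd t ⟨ht.1, ht.2.le⟩).hasDerivWithinAt)
    (by simp only [Bd, mul_zero, exp_zero]; linarith)
    (fun t _ => (hBd t).continuousAt.continuousWithinAt)
    (fun t _ => (hBd t).hasDerivWithinAt)
    (fun t ht hft => by
      have ht' : t ∈ Set.Icc 0 T := ⟨ht.1, ht.2.le⟩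
      have h1 := hf' t ht' (hft ▸ hBM t ht')
      rw [hft] at h1
      have h2 : E0 + D + 1 ≤ Bd t := by
        simp only [Bd]
        have : 1 ≤ exp ((L + 1) * t) := one_le_exp (mul_nonneg (by linarith) ht.1)
        exact le_mul_of_one_le_right (by linarith) this
      change _ < (L + 1) * Bd t
      linarith)
  exact fun t ht => (key ht).trans (hBM t ht)

theorem totE_le_of_init {ε δ T T0 K E0 s M : ℝ} (hε : 0 < ε) (hεδ : ε ≤ δ) (hδ1 : δ ≤ 1)
    (ha : a < 0) (hb : T < b) (hTT : T ≤ T0) {p pE : Fd a b} {u uE : Fin 2 → Fd a b}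
    {UE : Fin 2 → Fin 2 → Fd a b} (h : RelSys ε δ pE uE UE)
    (hN : ∀ t ∈ Set.Icc 0 T, NSAt t p u) (hK : 1 ≤ K) (hB : ∀ t ∈ Set.Icc 0 T, NSBd K t p u)
    (hs0 : 0 < s) (hsδ : s ^ 2 = δ) (hE0 : 0 ≤ E0)
    (hM : M = (E0 + 24 * K + 1) * exp ((1000000 * K + 4 + 1) * T0))
    (hsM : 12000000 * (s * M) ≤ 1)
    (h0 : Int 0 (totE ε δ (pE - p) (uE - u) (UE - nsStress u)) ≤ E0) :
    ∀ t ∈ Set.Icc 0 T, Int t (totE ε δ (pE - p) (uE - u) (UE - nsStress u)) ≤ M := by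
  have hI : ∀ t ∈ Set.Icc 0 T, t ∈ Set.Ioo a b := fun t ht =>
    ⟨ha.trans_le ht.1, ht.2.trans_lt hb⟩
  refine bootstrap hTT hE0 (by positivity) (by positivity) hM h0
    (fun t ht => hasDerivAt_Int (hI t ht) _) fun t ht hfM => ?_
  have hb := hB t ht
  have hsq : ∀ y : ℝ, (-(δ * y)) ^ 2 = δ ^ 2 * y ^ 2 := fun y => by ring
  have hn : ∀ y : ℝ, (-y) ^ 2 = y ^ 2 := fun y => by ring
  refine deriv_totE_le_of_le hε hεδ hδ1 (hI t ht) (linSys_sub hε (hI t ht) h (hN t ht)) hK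
    hb.u0 hb.u1 hb.u2 (fun x => ?_) (fun i j x => ?_) (fun i x => ?_) (fun k x => ?_)
    (fun k i j x => ?_) (fun k i x => ?_) hs0 hsδ hfM hsM
  · rw [Fd.ev_neg, hn]; exact hb.pt x
  · rw [Fd.ev_neg, Fd.ev_smul, hsq]
    exact mul_le_mul_of_nonneg_left (hb.st i j x) (sq_nonneg _)
  · rw [Fd.ev_neg, Fd.ev_smul, hsq]
    exact mul_le_mul_of_nonneg_left (hb.utt i x) (sq_nonneg _)
  · rw [map_neg, Fd.ev_neg, hn]; exact hb.pt1 k x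
  · rw [map_neg, Derivation.map_smul, Fd.ev_neg, Fd.ev_smul, hsq]
    exact mul_le_mul_of_nonneg_left (hb.st1 k i j x) (sq_nonneg _)
  · rw [map_neg, Derivation.map_smul, Fd.ev_neg, Fd.ev_smul, hsq]
    exact mul_le_mul_of_nonneg_left (hb.utt1 k i x) (sq_nonneg _)

end Bounds

section DataBounds

variable {a b : ℝ}

theorem Int_le_add {t : ℝ} (ht : t ∈ Set.Ioo a b) {f g : Fd a b} {c : ℝ}
    (h : ∀ x, f.1 (t, x) ≤ g.1 (t, x) + c) : Int t f ≤ Int t g + c := by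
  have : Int t (g + c • (1 : Fd a b)) = Int t g + c := by
    rw [Int_add ht, Int_smul, Int_one, mul_one]
  rw [← this]
  refine Int_mono ht fun x => ?_
  rw [Fd.ev_add, Fd.ev_smul, show (1 : Fd a b).1 (t, x) = 1 from rfl, mul_one]
  exact h x

/-- Planar vorticity of a field. -/
def vort (u : Fin 2 → Fd a b) : Fd a b := Dx 0 (u 1) - Dx 1 (u 0)

/-- Divergence of a field. -/
def dive (u : Fin 2 → Fd a b) : Fd a b := ∑ i, Dx i (u i)

/-- Squared gradient of a scalar field. -/
def gradSq (f : Fd a b) : Fd a b := ∑ i, Dx i f ^ 2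

/-- Squared Hessian of a scalar field. -/
def hessSq (f : Fd a b) : Fd a b := ∑ i, ∑ j, Dx i (Dx j f) ^ 2

/-- Squared size of a matrix field. -/
def matSq (U : Fin 2 → Fin 2 → Fd a b) : Fd a b := ∑ i, ∑ j, U i j ^ 2

/-- Row-wise divergence of a matrix field. -/
def rowDiv (U : Fin 2 → Fin 2 → Fd a b) (i : Fin 2) : Fd a b := ∑ j, Dx j (U i j)

theorem Int_sumSqD {t : ℝ} (ht : t ∈ Set.Ioo a b) (u : Fin 2 → Fd a b) :
    Int t (sumSqD u) = Int t (vort u ^ 2) + Int t (dive u ^ 2) := by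
  have e : sumSqD u = vort u ^ 2 + dive u ^ 2
      + ((2 : ℝ) • Dx 1 (u 0 * Dx 0 (u 1)) - (2 : ℝ) • Dx 0 (u 0 * Dx 1 (u 1))) := by
    have h2 : ∀ f : Fd a b, (2 : ℝ) • f = 2 * f := fun f => by
      rw [two_smul, two_mul]
    simp only [sumSqD, vort, dive, Fin.sum_univ_two, Derivation.leibniz, smul_eq_mul, h2,
      Dx_Dx 1 0]
    ring
  rw [e, Int_add ht, Int_sub ht, Int_smul, Int_smul, Int_Dx 1 ht, Int_Dx 0 ht, Int_add ht]
  ring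

theorem Int_sumSqDD {t : ℝ} (ht : t ∈ Set.Ioo a b) (u : Fin 2 → Fd a b) :
    Int t (sumSqDD u) = Int t (gradSq (vort u)) + Int t (gradSq (dive u)) := by
  have hv : ∀ k, (vort fun i => Dx k (u i)) = Dx k (vort u) := fun k => by
    simp only [vort, map_sub, Dx_Dx k]
  have hd : ∀ k, (dive fun i => Dx k (u i)) = Dx k (dive u) := fun k => by
    simp only [dive, map_sum, Dx_Dx k]
  rw [sumSqDD_eq, gradSq, gradSq, Fin.sum_univ_two, Fin.sum_univ_two, Fin.sum_univ_two,
    Int_add ht, Int_add ht, Int_add ht, Int_sumSqD ht, Int_sumSqD ht]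
  simp only [hv, hd]
  ring

theorem sub_sq_le_two {x y K : ℝ} (h : y ^ 2 ≤ K) : (x - y) ^ 2 ≤ 2 * x ^ 2 + 2 * K := by
  nlinarith [sq_nonneg (x + y)]

theorem le_sub_sq_two {x y K : ℝ} (h : y ^ 2 ≤ K) : x ^ 2 ≤ 2 * (x - y) ^ 2 + 2 * K := by
  nlinarith [sq_nonneg (x - 2 * y)]

theorem six_term_sq {a b c d e f K : ℝ} (hc : c ^ 2 ≤ K) (hd : d ^ 2 ≤ K) (hf : f ^ 2 ≤ K) :
    (a - c + (b - d) + (e - f)) ^ 2 ≤ 4 * (a + b) ^ 2 + 4 * e ^ 2 + 20 * K := by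
  have h1 : (a - c + (b - d) + (e - f)) ^ 2
      ≤ 4 * (a + b) ^ 2 + 4 * e ^ 2 + 4 * (c + d) ^ 2 + 4 * f ^ 2 := by
    nlinarith [sq_nonneg (a + b - e), sq_nonneg (a + b + (c + d)), sq_nonneg (a + b + f),
      sq_nonneg (e + (c + d)), sq_nonneg (e + f), sq_nonneg (c + d - f)]
  nlinarith [sq_nonneg (c - d)]

theorem Int_coreForm {ε δ t : ℝ} (ht : t ∈ Set.Ioo a b) (q : Fd a b) (v : Fin 2 → Fd a b)
    (V : Fin 2 → Fin 2 → Fd a b) :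
    Int t (coreForm ε δ q v V) = ε * Int t (q ^ 2) + Int t (sumSq v) + δ * Int t (matSq V)
      + δ ^ 2 * Int t (sumSq fun i => Dt (v i)) + δ * Int t (sumSqD v)
      + δ ^ 2 / ε * Int t (dive v ^ 2) := by
  have e : coreForm ε δ q v V = ε • q ^ 2 + sumSq v + δ • matSq V
      + δ ^ 2 • (sumSq fun i => Dt (v i)) + δ • sumSqD v + (δ ^ 2 / ε) • dive v ^ 2 := rfl
  rw [e]
  simp only [Int_add ht, Int_smul]

theorem Int_totF {ε δ t : ℝ} (ht : t ∈ Set.Ioo a b) (q : Fd a b) (v : Fin 2 → Fd a b)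
    (V : Fin 2 → Fin 2 → Fd a b) :
    Int t (totF ε δ q v V) = δ⁻¹ * (ε * Int t (q ^ 2) + Int t (sumSq v) + δ * Int t (matSq V)
        + δ ^ 2 * Int t (sumSq fun i => Dt (v i)) + δ * Int t (sumSqD v)
        + δ ^ 2 / ε * Int t (dive v ^ 2))
      + (ε * (Int t (Dx 0 q ^ 2) + Int t (Dx 1 q ^ 2)) + Int t (sumSqD v)
        + δ * (Int t (matSq fun i j => Dx 0 (V i j)) + Int t (matSq fun i j => Dx 1 (V i j)))
        + δ ^ 2 * (Int t (sumSq fun i => Dt (Dx 0 (v i))) + Int t (sumSq fun i => Dt (Dx 1 (v i))))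
        + δ * Int t (sumSqDD v)
        + δ ^ 2 / ε * (Int t (dive (fun i => Dx 0 (v i)) ^ 2)
          + Int t (dive (fun i => Dx 1 (v i)) ^ 2))) := by
  have e0 : Int t (sumSqD v)
      = Int t (sumSq fun i => Dx 0 (v i)) + Int t (sumSq fun i => Dx 1 (v i)) := by
    rw [sumSqD_eq v, Fin.sum_univ_two, Int_add ht]
  have e1 : Int t (sumSqDD v)
      = Int t (sumSqD fun i => Dx 0 (v i)) + Int t (sumSqD fun i => Dx 1 (v i)) := by
    rw [sumSqDD_eq v, Fin.sum_univ_two, Int_add ht]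
  rw [totF, Fin.sum_univ_two, Int_add ht, Int_add ht, Int_smul, Int_coreForm ht, Int_coreForm ht,
    Int_coreForm ht, e1]
  linear_combination -e0

theorem init_arith {ε δ K C0 X1 X2 X3 X4 X5 X6 X7 X8 X9 P0 P1 P2 U0 U1 W0 W1 D0 D1 O0 O1 : ℝ}
    (hε : 0 < ε) (hδ : 0 < δ) (hεδ : ε ≤ δ) (hδ1 : δ ≤ 1) (hK : 0 ≤ K) (hu : X2 ≤ C0 * δ)
    (hcurl : O0 + δ * (O0 + O1) ≤ C0) (hdiv : D0 + δ * (D0 + D1) ≤ C0 * δ⁻¹ * ε)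
    (hp : ε * P0 + δ ^ 2 * (P0 + P1) + δ ^ 3 * (P0 + P1 + P2) ≤ C0 * δ)
    (hU : U0 + δ * (U0 + U1) + δ ^ 2 * (W0 + W1) ≤ C0)
    (q1 : X1 ≤ 2 * P0 + 2 * K) (q2 : X3 ≤ 2 * U0 + 8 * K) (q3 : X4 ≤ 8 * U1 + 4 * P1 + 40 * K)
    (q4 : X5 ≤ 2 * (O0 + D0) + 8 * K) (q6 : X6 ≤ 2 * P1 + 4 * K) (q8 : X7 ≤ 2 * U1 + 16 * K)
    (q9 : X8 ≤ 4 * W1 + 4 * P2 + 80 * K) (q10 : X9 ≤ 2 * (O1 + D1) + 16 * K)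
    (nU : 0 ≤ U0) (nU1 : 0 ≤ U1) (nw : 0 ≤ W0) (nw1 : 0 ≤ W1) (np : 0 ≤ P0) (ngp : 0 ≤ P1)
    (nhp : 0 ≤ P2) (nd : 0 ≤ D0) (ngd : 0 ≤ D1) (nc : 0 ≤ O0) (ngc : 0 ≤ O1) :
    δ⁻¹ * (ε * X1 + X2 + δ * X3 + δ ^ 2 * X4 + δ * X5 + δ ^ 2 / ε * D0)
      + (ε * X6 + X5 + δ * X7 + δ ^ 2 * X8 + δ * X9 + δ ^ 2 / ε * D1)
      ≤ 100 * C0 + 1000 * K := by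
  have ρ1 : ε / δ ≤ 1 := (div_le_one hδ).2 hεδ
  have ρ0 : 0 < ε / δ := by positivity
  have hC0 : 0 ≤ C0 := le_trans (by positivity) hcurl
  have f0 : δ⁻¹ * (ε * X1 + X2 + δ * X3 + δ ^ 2 * X4 + δ * X5 + δ ^ 2 / ε * D0)
      = ε / δ * X1 + δ⁻¹ * X2 + X3 + δ * X4 + X5 + δ / ε * D0 := by
    field_simp
  rw [f0]
  have g1 : ε / δ * X1 ≤ 2 * C0 + 2 * K := by
    have : ε * P0 ≤ C0 * δ := by
      have : 0 ≤ δ ^ 2 * (P0 + P1) + δ ^ 3 * (P0 + P1 + P2) := by positivity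
      linarith
    have h2 : ε / δ * P0 ≤ C0 := by rw [div_mul_eq_mul_div, div_le_iff₀ hδ]; exact this
    calc ε / δ * X1 ≤ ε / δ * (2 * P0 + 2 * K) := by gcongr
      _ = 2 * (ε / δ * P0) + ε / δ * (2 * K) := by ring
      _ ≤ 2 * C0 + 1 * (2 * K) := by gcongr
      _ = _ := by ring
  have g2 : δ⁻¹ * X2 ≤ C0 := by rw [inv_mul_le_iff₀ hδ]; linarith
  have hU0 : U0 ≤ C0 ∧ δ * U1 ≤ C0 ∧ δ ^ 2 * W1 ≤ C0 := by
    have a1 : 0 ≤ δ * U0 := by positivity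
    have a2 : 0 ≤ δ * U1 := by positivity
    have a3 : 0 ≤ δ ^ 2 * W0 := by positivity
    have a4 : 0 ≤ δ ^ 2 * W1 := by positivity
    refine ⟨?_, ?_, ?_⟩ <;> linarith
  have hP1 : δ * P1 ≤ C0 := by
    have : 0 ≤ ε * P0 + δ ^ 2 * P0 + δ ^ 3 * (P0 + P1 + P2) := by positivity
    have : δ * (δ * P1) ≤ δ * C0 := by linarith
    exact le_of_mul_le_mul_left this hδ
  have hP2 : δ ^ 2 * P2 ≤ C0 := by
    have : 0 ≤ ε * P0 + δ ^ 2 * (P0 + P1) + δ ^ 3 * (P0 + P1) := by positivity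
    have : δ * (δ ^ 2 * P2) ≤ δ * C0 := by linarith
    exact le_of_mul_le_mul_left this hδ
  have hCe : C0 * δ⁻¹ * ε = C0 * (ε / δ) := by ring
  rw [hCe] at hdiv
  have hd0 : D0 ≤ C0 * (ε / δ) := by
    have : 0 ≤ δ * (D0 + D1) := by positivity
    linarith
  have hd1 : δ * D1 ≤ C0 * (ε / δ) := by
    have : 0 ≤ D0 + δ * D0 := by positivity
    linarith
  have hrr : C0 * (ε / δ) ≤ C0 := mul_le_of_le_one_right hC0 ρ1
  have g6 : δ / ε * D0 ≤ C0 := by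
    calc δ / ε * D0 ≤ δ / ε * (C0 * (ε / δ)) := by gcongr
      _ = C0 := by field_simp
  have g12 : δ ^ 2 / ε * D1 ≤ C0 := by
    calc δ ^ 2 / ε * D1 = δ / ε * (δ * D1) := by ring
      _ ≤ δ / ε * (C0 * (ε / δ)) := by gcongr
      _ = C0 := by field_simp
  have hO0 : O0 ≤ C0 := by
    have : 0 ≤ δ * (O0 + O1) := by positivity
    linarith
  have hO1 : δ * O1 ≤ C0 := by
    have : 0 ≤ O0 + δ * O0 := by positivity
    linarith
  have hδK : δ * K ≤ K := mul_le_of_le_one_left hK hδ1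
  have hδK2 : δ ^ 2 * K ≤ K := mul_le_of_le_one_left hK (pow_le_one₀ hδ.le hδ1)
  have g4 : δ * X4 ≤ 12 * C0 + 40 * K := by
    have := mul_le_mul_of_nonneg_left q3 hδ.le
    linarith [hU0.2.1]
  have g7 : ε * X6 ≤ 2 * C0 + 4 * K := by
    have h1 := mul_le_mul_of_nonneg_left q6 hε.le
    have h2 : ε * P1 ≤ δ * P1 := by gcongr
    have h3 : ε * K ≤ δ * K := by gcongr
    linarith
  have g9 : δ * X7 ≤ 2 * C0 + 16 * K := by
    have := mul_le_mul_of_nonneg_left q8 hδ.le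
    linarith [hU0.2.1]
  have g10 : δ ^ 2 * X8 ≤ 8 * C0 + 80 * K := by
    have := mul_le_mul_of_nonneg_left q9 (sq_nonneg δ)
    linarith [hU0.2.2]
  have g11 : δ * X9 ≤ 4 * C0 + 16 * K := by
    have := mul_le_mul_of_nonneg_left q10 hδ.le
    linarith
  linarith [hU0.1]

theorem init_totF_le {ε δ K C0 : ℝ} (hε : 0 < ε) (hεδ : ε ≤ δ) (hδ1 : δ ≤ 1) {t : ℝ}
    (ht : t ∈ Set.Ioo a b) {p pE : Fd a b} {u uE : Fin 2 → Fd a b}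
    {UE : Fin 2 → Fin 2 → Fd a b} (h : RelSys ε δ pE uE UE) (hN : NSAt t p u)
    (hB : NSBd K t p u)
    (hu : Int t (sumSq (uE - u)) ≤ C0 * δ)
    (hcurl : Int t (vort uE ^ 2) + δ * (Int t (vort uE ^ 2) + Int t (gradSq (vort uE))) ≤ C0)
    (hdiv : Int t (dive uE ^ 2) + δ * (Int t (dive uE ^ 2) + Int t (gradSq (dive uE)))
      ≤ C0 * δ⁻¹ * ε)
    (hp : ε * Int t (pE ^ 2) + δ ^ 2 * (Int t (pE ^ 2) + Int t (gradSq pE))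
      + δ ^ 3 * (Int t (pE ^ 2) + Int t (gradSq pE) + Int t (hessSq pE)) ≤ C0 * δ)
    (hU : Int t (matSq UE) + δ * (Int t (matSq UE) + Int t (∑ k, matSq fun i j => Dx k (UE i j)))
      + δ ^ 2 * (Int t (sumSq (rowDiv UE)) + Int t (sumSqD (rowDiv UE))) ≤ C0) :
    Int t (totF ε δ (pE - p) (uE - u) (UE - nsStress u)) ≤ 100 * C0 + 1000 * K := by
  have hδ : 0 < δ := hε.trans_le hεδ
  have hK : 0 ≤ K := (sq_nonneg _).trans (hB.p0 0)
  have hz := (mem_slab.2 ht : ∀ {x}, ((t, x) : ℝ × Spc 2) ∈ slab a b)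
  have hw := (linSys_sub hε ht h hN).momentum
  have hw1 := ((linSys_sub hε ht h hN).dx ht 0).momentum
  have hw2 := ((linSys_sub hε ht h hN).dx ht 1).momentum
  have n0 := fun (f : Fd a b) => Int_nonneg (t := t) (f := f ^ 2) fun x => sq_nonneg _
  have q1 : Int t ((pE - p) ^ 2) ≤ 2 * Int t (pE ^ 2) + 2 * K := by
    rw [← Int_smul]
    exact Int_le_add ht fun x => sub_sq_le_two (hB.p0 x)
  have q2 : Int t (∑ i, ∑ j, (UE - nsStress u) i j ^ 2) ≤ 2 * Int t (matSq UE) + 8 * K := by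
    rw [← Int_smul]
    refine Int_le_add ht fun x => ?_
    simp only [matSq, Fin.sum_univ_two, Fd.ev_add, Fd.ev_pow, Fd.ev_smul, Fd.ev_sub, Pi.sub_apply]
    have k := fun i j => sub_sq_le_two (x := (UE i j).1 (t, x)) (hB.s0 i j x)
    linarith [k 0 0, k 0 1, k 1 0, k 1 1]
  have q3 : Int t (∑ i, Dt ((uE - u) i) ^ 2)
      ≤ 8 * Int t (∑ k, matSq fun i j => Dx k (UE i j)) + 4 * Int t (gradSq pE) + 40 * K := by
    rw [← Int_smul, ← Int_smul, ← Int_add ht]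
    refine Int_le_add ht fun x => ?_
    have k := fun i => six_term_sq (a := (Dx 0 (UE i 0)).1 (t, x)) (b := (Dx 1 (UE i 1)).1 (t, x))
      (e := (Dx i pE).1 (t, x)) (hB.s1 0 i 0 x) (hB.s1 1 i 1 x) (hB.p1 i x)
    have e := fun i => hw i x
    simp only [Fin.sum_univ_two, Fd.ev_add, Fd.ev_sub, Pi.sub_apply, map_sub] at e
    have e' := fun i => congrArg (· ^ 2) (eq_neg_of_add_eq_zero_left ((add_assoc _ _ _).symm.trans
      (e i)))
    simp only [neg_sq] at e'
    simp only [matSq, gradSq, Fin.sum_univ_two, Fd.ev_add, Fd.ev_pow, Fd.ev_smul, Fd.ev_sub,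
      Pi.sub_apply, map_sub]
    have k2 : ∀ y z : ℝ, (y + z) ^ 2 ≤ 2 * y ^ 2 + 2 * z ^ 2 := fun y z => by
      nlinarith [sq_nonneg (y - z)]
    have m0 := k2 ((Dx 0 (UE 0 0)).1 (t, x)) ((Dx 1 (UE 0 1)).1 (t, x))
    have m1 := k2 ((Dx 0 (UE 1 0)).1 (t, x)) ((Dx 1 (UE 1 1)).1 (t, x))
    rw [e' 0, e' 1]
    linarith [k 0, k 1, sq_nonneg ((Dx 0 (UE 0 1)).1 (t, x)), sq_nonneg ((Dx 1 (UE 0 0)).1 (t, x)),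
      sq_nonneg ((Dx 0 (UE 1 1)).1 (t, x)), sq_nonneg ((Dx 1 (UE 1 0)).1 (t, x))]
  have q4 : Int t (sumSqD (uE - u)) ≤ 2 * Int t (sumSqD uE) + 8 * K := by
    rw [← Int_smul]
    refine Int_le_add ht fun x => ?_
    simp only [sumSqD, Fin.sum_univ_two, Fd.ev_add, Fd.ev_pow, Fd.ev_smul, Fd.ev_sub, map_sub,
      Pi.sub_apply]
    have k := fun i j => sub_sq_le_two (x := (Dx j (uE i)).1 (t, x)) (hB.u1 i j x)
    linarith [k 0 0, k 0 1, k 1 0, k 1 1]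
  have q5 : Int t ((∑ i, Dx i ((uE - u) i)) ^ 2) = Int t (dive uE ^ 2) := by
    refine Int_congr fun x => ?_
    have e := hN.div_free x
    simp only [dive, Fin.sum_univ_two, Fd.ev_add, Fd.ev_pow, Fd.ev_sub, map_sub,
      Pi.sub_apply] at e ⊢
    congr 1
    linarith
  have q6 : Int t (Dx 0 (pE - p) ^ 2) + Int t (Dx 1 (pE - p) ^ 2)
      ≤ 2 * Int t (gradSq pE) + 4 * K := by
    rw [← Int_smul, ← Int_add ht]
    refine Int_le_add ht fun x => ?_
    simp only [gradSq, Fin.sum_univ_two, Fd.ev_add, Fd.ev_pow, Fd.ev_smul, Fd.ev_sub, map_sub]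
    have k := fun i => sub_sq_le_two (x := (Dx i pE).1 (t, x)) (hB.p1 i x)
    linarith [k 0, k 1]
  have q8 : Int t (∑ i, ∑ j, Dx 0 ((UE - nsStress u) i j) ^ 2)
      + Int t (∑ i, ∑ j, Dx 1 ((UE - nsStress u) i j) ^ 2)
      ≤ 2 * Int t (∑ k, matSq fun i j => Dx k (UE i j)) + 16 * K := by
    rw [← Int_smul, ← Int_add ht]
    refine Int_le_add ht fun x => ?_
    simp only [matSq, Fin.sum_univ_two, Fd.ev_add, Fd.ev_pow, Fd.ev_smul, Fd.ev_sub, Pi.sub_apply,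
      map_sub]
    have k := fun l i j => sub_sq_le_two (x := (Dx l (UE i j)).1 (t, x)) (hB.s1 l i j x)
    linarith [k 0 0 0, k 0 0 1, k 0 1 0, k 0 1 1, k 1 0 0, k 1 0 1, k 1 1 0, k 1 1 1]
  have q9 : Int t (∑ i, Dt (Dx 0 ((uE - u) i)) ^ 2) + Int t (∑ i, Dt (Dx 1 ((uE - u) i)) ^ 2)
      ≤ 4 * Int t (sumSqD (rowDiv UE)) + 4 * Int t (hessSq pE) + 80 * K := by
    rw [← Int_smul, ← Int_smul, ← Int_add ht, ← Int_add ht]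
    refine Int_le_add ht fun x => ?_
    have k := fun l i => six_term_sq (a := (Dx 0 (Dx l (UE i 0))).1 (t, x))
      (b := (Dx 1 (Dx l (UE i 1))).1 (t, x))
      (e := (Dx i (Dx l pE)).1 (t, x)) (hB.s2 0 l i 0 x) (hB.s2 1 l i 1 x) (hB.p2 l i x)
    have e1 := fun i => hw1 i x
    have e2 := fun i => hw2 i x
    simp only [Fin.sum_univ_two, Fd.ev_add, Fd.ev_sub, Pi.sub_apply, map_sub] at e1 e2
    have e1' := fun i => congrArg (· ^ 2) (eq_neg_of_add_eq_zero_left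
      ((add_assoc _ _ _).symm.trans (e1 i)))
    have e2' := fun i => congrArg (· ^ 2) (eq_neg_of_add_eq_zero_left
      ((add_assoc _ _ _).symm.trans (e2 i)))
    simp only [neg_sq] at e1' e2'
    simp only [sumSqD, rowDiv, hessSq, Fin.sum_univ_two, Fd.ev_add, Fd.ev_pow, Fd.ev_smul,
      Fd.ev_sub, Pi.sub_apply, map_sub, map_add]
    rw [e1' 0, e1' 1, e2' 0, e2' 1]
    have s : ∀ f : Fd a b, Dx 1 (Dx 0 f) = Dx 0 (Dx 1 f) := Dx_Dx 1 0
    have k00 := k 0 0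
    have k01 := k 0 1
    have k10 := k 1 0
    have k11 := k 1 1
    simp only [s] at k00 k01 k10 k11 ⊢
    linarith only [k00, k01, k10, k11]
  have q10 : Int t (sumSqDD (uE - u)) ≤ 2 * Int t (sumSqDD uE) + 16 * K := by
    rw [← Int_smul]
    refine Int_le_add ht fun x => ?_
    simp only [sumSqDD, Fin.sum_univ_two, Fd.ev_add, Fd.ev_pow, Fd.ev_smul, Fd.ev_sub, map_sub,
      Pi.sub_apply]
    have k := fun i j l => sub_sq_le_two (x := (Dx l (Dx j (uE i))).1 (t, x)) (hB.u2 i j l x)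
    linarith [k 0 0 0, k 0 0 1, k 0 1 0, k 0 1 1, k 1 0 0, k 1 0 1, k 1 1 0, k 1 1 1]
  have q11 : Int t ((∑ i, Dx i (Dx 0 ((uE - u) i))) ^ 2)
      + Int t ((∑ i, Dx i (Dx 1 ((uE - u) i))) ^ 2) = Int t (gradSq (dive uE)) := by
    rw [← Int_add ht]
    refine Int_congr fun x => ?_
    have e0 := Dx_congr 0 ht (g := 0) hN.div_free x
    have e1 := Dx_congr 1 ht (g := 0) hN.div_free x
    have s : ∀ f : Fd a b, Dx 1 (Dx 0 f) = Dx 0 (Dx 1 f) := Dx_Dx 1 0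
    simp only [dive, gradSq, Fin.sum_univ_two, Fd.ev_add, Fd.ev_pow, Fd.ev_sub, map_sub, map_add,
      map_zero, Pi.sub_apply, s] at e0 e1 ⊢
    simp only [show (0 : Fd a b).1 (t, x) = 0 from rfl] at e0 e1
    congr 2 <;> linarith
  rw [Int_totF ht]
  have nm : ∀ V : Fin 2 → Fin 2 → Fd a b, 0 ≤ Int t (matSq V) := fun V => Int_nonneg fun x => by
    simp only [matSq, Fin.sum_univ_two, Fd.ev_add, Fd.ev_pow]; positivity
  have nU1 : 0 ≤ Int t (∑ k, matSq fun i j => Dx k (UE i j)) := by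
    rw [Fin.sum_univ_two, Int_add ht]
    exact add_nonneg (nm _) (nm _)
  have ng : ∀ f : Fd a b, 0 ≤ Int t (gradSq f) := fun f => Int_nonneg fun x => by
    simp only [gradSq, Fin.sum_univ_two, Fd.ev_add, Fd.ev_pow]; positivity
  have nh : ∀ f : Fd a b, 0 ≤ Int t (hessSq f) := fun f => Int_nonneg fun x => by
    simp only [hessSq, Fin.sum_univ_two, Fd.ev_add, Fd.ev_pow]; positivity
  have nw : 0 ≤ Int t (sumSq (rowDiv UE)) := Int_nonneg fun x => sumSq_nonneg _ _
  have nw1 : 0 ≤ Int t (sumSqD (rowDiv UE)) := Int_nonneg fun x => sumSqD_nonneg _ _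
  rw [Int_sumSqD ht uE] at q4
  rw [Int_sumSqDD ht uE] at q10
  have r5 : Int t (dive (uE - u) ^ 2) = Int t (dive uE ^ 2) := q5
  have r11 : Int t (dive (fun i => Dx 0 ((uE - u) i)) ^ 2)
      + Int t (dive (fun i => Dx 1 ((uE - u) i)) ^ 2) = Int t (gradSq (dive uE)) := q11
  rw [r5, r11]
  exact init_arith hε hδ hεδ hδ1 hK hu hcurl hdiv hp hU q1 q2 q3 q4 q6 q8 q9 q10 (nm _) nU1 nw nw1
    (n0 pE) (ng pE) (nh pE) (n0 (dive uE)) (ng (dive uE)) (n0 (vort uE)) (ng (vort uE))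

end DataBounds

section FinalBounds

variable {a b : ℝ}

theorem final_bounds {ε δ K M : ℝ} (hε : 0 < ε) (hεδ : ε ≤ δ) (hδ1 : δ ≤ 1) {t : ℝ}
    (ht : t ∈ Set.Ioo a b) {p pE : Fd a b} {u uE : Fin 2 → Fd a b}
    {UE : Fin 2 → Fin 2 → Fd a b} (hN : NSAt t p u) (hB : NSBd K t p u)
    (hM : Int t (totE ε δ (pE - p) (uE - u) (UE - nsStress u)) ≤ M) :
    Int t (sumSq (uE - u)) ≤ (72 * M + 32 * K) * δ ∧
    Int t (vort uE ^ 2) + δ * (Int t (vort uE ^ 2) + Int t (gradSq (vort uE)))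
      ≤ 72 * M + 32 * K ∧
    Int t (dive uE ^ 2) + δ * (Int t (dive uE ^ 2) + Int t (gradSq (dive uE)))
      ≤ (72 * M + 32 * K) * δ⁻¹ * ε ∧
    δ * Int t (sumSqDD uE) ≤ 72 * M + 32 * K := by
  have hδ : 0 < δ := hε.trans_le hεδ
  have hK : 0 ≤ K := (sq_nonneg _).trans (hB.p0 0)
  have hF : Int t (totF ε δ (pE - p) (uE - u) (UE - nsStress u)) ≤ 12 * M := by
    have : Int t (totF ε δ (pE - p) (uE - u) (UE - nsStress u))
        ≤ Int t ((12 : ℝ) • totE ε δ (pE - p) (uE - u) (UE - nsStress u)) :=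
      Int_mono ht fun x => by
        rw [Fd.ev_smul]
        exact totF_le_totE hε hεδ _ _ _ _
    rw [Int_smul] at this
    linarith
  have n0 := fun (f : Fd a b) => Int_nonneg (t := t) (f := f ^ 2) fun x => sq_nonneg _
  have nm : ∀ V : Fin 2 → Fin 2 → Fd a b, 0 ≤ Int t (matSq V) := fun V => Int_nonneg fun x => by
    simp only [matSq, Fin.sum_univ_two, Fd.ev_add, Fd.ev_pow]; positivity
  have ng : ∀ f : Fd a b, 0 ≤ Int t (gradSq f) := fun f => Int_nonneg fun x => by
    simp only [gradSq, Fin.sum_univ_two, Fd.ev_add, Fd.ev_pow]; positivity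
  have ns : ∀ v : Fin 2 → Fd a b, 0 ≤ Int t (sumSq v) := fun v =>
    Int_nonneg fun x => sumSq_nonneg _ _
  have ns1 : ∀ v : Fin 2 → Fd a b, 0 ≤ Int t (sumSqD v) := fun v =>
    Int_nonneg fun x => sumSqD_nonneg _ _
  have ns2 : ∀ v : Fin 2 → Fd a b, 0 ≤ Int t (sumSqDD v) := fun v =>
    Int_nonneg fun x => sumSqDD_nonneg _ _
  have q5 : Int t (dive (uE - u) ^ 2) = Int t (dive uE ^ 2) := by
    refine Int_congr fun x => ?_
    have e := hN.div_free x
    simp only [dive, Fin.sum_univ_two, Fd.ev_add, Fd.ev_pow, Fd.ev_sub, map_sub,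
      Pi.sub_apply] at e ⊢
    congr 1
    linarith
  have q11 : Int t (dive (fun i => Dx 0 ((uE - u) i)) ^ 2)
      + Int t (dive (fun i => Dx 1 ((uE - u) i)) ^ 2) = Int t (gradSq (dive uE)) := by
    rw [← Int_add ht]
    refine Int_congr fun x => ?_
    have e0 := Dx_congr 0 ht (g := 0) hN.div_free x
    have e1 := Dx_congr 1 ht (g := 0) hN.div_free x
    have s : ∀ f : Fd a b, Dx 1 (Dx 0 f) = Dx 0 (Dx 1 f) := Dx_Dx 1 0
    simp only [dive, gradSq, Fin.sum_univ_two, Fd.ev_add, Fd.ev_pow, Fd.ev_sub, map_sub, map_add,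
      map_zero, Pi.sub_apply, s] at e0 e1 ⊢
    simp only [show (0 : Fd a b).1 (t, x) = 0 from rfl] at e0 e1
    congr 2 <;> linarith
  have q4 : Int t (sumSqD uE) ≤ 2 * Int t (sumSqD (uE - u)) + 8 * K := by
    rw [← Int_smul]
    refine Int_le_add ht fun x => ?_
    simp only [sumSqD, Fin.sum_univ_two, Fd.ev_add, Fd.ev_pow, Fd.ev_smul, Fd.ev_sub, map_sub,
      Pi.sub_apply]
    have k := fun i j => le_sub_sq_two (x := (Dx j (uE i)).1 (t, x)) (hB.u1 i j x)
    linarith [k 0 0, k 0 1, k 1 0, k 1 1]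
  have q10 : Int t (sumSqDD uE) ≤ 2 * Int t (sumSqDD (uE - u)) + 16 * K := by
    rw [← Int_smul]
    refine Int_le_add ht fun x => ?_
    simp only [sumSqDD, Fin.sum_univ_two, Fd.ev_add, Fd.ev_pow, Fd.ev_smul, Fd.ev_sub, map_sub,
      Pi.sub_apply]
    have k := fun i j l => le_sub_sq_two (x := (Dx l (Dx j (uE i))).1 (t, x)) (hB.u2 i j l x)
    linarith [k 0 0 0, k 0 0 1, k 0 1 0, k 0 1 1, k 1 0 0, k 1 0 1, k 1 1 0, k 1 1 1]
  rw [Int_totF ht, q5, q11] at hF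
  have hO := Int_sumSqD ht uE
  have hO1 := Int_sumSqDD ht uE
  have p1 := n0 (pE - p)
  have p2 := ns (uE - u)
  have p3 := nm (UE - nsStress u)
  have p4 := ns fun i => Dt ((uE - u) i)
  have p5 := ns1 (uE - u)
  have p6 := add_nonneg (n0 (Dx 0 (pE - p))) (n0 (Dx 1 (pE - p)))
  have p7 := add_nonneg (nm fun i j => Dx 0 ((UE - nsStress u) i j))
    (nm fun i j => Dx 1 ((UE - nsStress u) i j))
  have p8 := add_nonneg (ns fun i => Dt (Dx 0 ((uE - u) i))) (ns fun i => Dt (Dx 1 ((uE - u) i)))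
  have p9 := ns2 (uE - u)
  have pd0 := n0 (dive uE)
  have pd1 := ng (dive uE)
  have po0 := n0 (vort uE)
  have po1 := ng (vort uE)
  have po2 := ns2 uE
  generalize Int t ((pE - p) ^ 2) = X1 at *
  generalize Int t (sumSq (uE - u)) = X2 at *
  generalize Int t (matSq (UE - nsStress u)) = X3 at *
  generalize Int t (sumSq fun i => Dt ((uE - u) i)) = X4 at *
  generalize Int t (sumSqD (uE - u)) = X5 at *
  generalize Int t (Dx 0 (pE - p) ^ 2) + Int t (Dx 1 (pE - p) ^ 2) = X6 at *
  generalize Int t (matSq fun i j => Dx 0 ((UE - nsStress u) i j))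
    + Int t (matSq fun i j => Dx 1 ((UE - nsStress u) i j)) = X7 at *
  generalize Int t (sumSq fun i => Dt (Dx 0 ((uE - u) i)))
    + Int t (sumSq fun i => Dt (Dx 1 ((uE - u) i))) = X8 at *
  generalize Int t (sumSqDD (uE - u)) = X9 at *
  generalize Int t (dive uE ^ 2) = D0 at *
  generalize Int t (gradSq (dive uE)) = D1 at *
  generalize Int t (vort uE ^ 2) = O0 at *
  generalize Int t (gradSq (vort uE)) = O1 at *
  generalize Int t (sumSqD uE) = Y1 at *
  generalize Int t (sumSqDD uE) = Y2 at *
  clear hM n0 nm ng ns ns1 ns2 hN hB q5 q11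
  have hS : ε / δ * X1 + δ⁻¹ * X2 + X3 + δ * X4 + X5 + δ / ε * D0
      + (ε * X6 + X5 + δ * X7 + δ ^ 2 * X8 + δ * X9 + δ ^ 2 / ε * D1) ≤ 12 * M := by
    refine le_of_eq_of_le ?_ hF
    field_simp
  have z1 : 0 ≤ ε / δ * X1 := by positivity
  have z2 : 0 ≤ δ⁻¹ * X2 := by positivity
  have z4 : 0 ≤ δ * X4 := by positivity
  have z5 : 0 ≤ δ / ε * D0 := by positivity
  have z6 : 0 ≤ ε * X6 := by positivity
  have z7 : 0 ≤ δ * X7 := by positivity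
  have z8 : 0 ≤ δ ^ 2 * X8 := by positivity
  have z9 : 0 ≤ δ * X9 := by positivity
  have z10 : 0 ≤ δ ^ 2 / ε * D1 := by positivity
  have hMp : 0 ≤ M := by linarith
  have hδK : δ * K ≤ K := mul_le_of_le_one_left hK hδ1
  have hX9 : δ * X9 ≤ 12 * M := by linarith
  have hY2 : δ * Y2 ≤ 24 * M + 16 * K := by
    have := mul_le_mul_of_nonneg_left q10 hδ.le
    linarith
  have hδO : δ * O1 ≤ δ * Y2 := by gcongr; linarith
  have hδO0 : δ * O0 ≤ O0 := mul_le_of_le_one_left po0 hδ1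
  have hδD0 : δ * D0 ≤ D0 := mul_le_of_le_one_left pd0 hδ1
  refine ⟨?_, by linarith, ?_, by linarith⟩
  · have : δ⁻¹ * X2 ≤ 72 * M + 32 * K := by linarith
    rwa [inv_mul_le_iff₀ hδ, mul_comm] at this
  · have h0 : D0 ≤ 12 * M * (ε / δ) := by
      have : δ / ε * D0 ≤ 12 * M := by linarith
      calc D0 = δ / ε * D0 * (ε / δ) := by field_simp
        _ ≤ _ := by gcongr
    have h1 : δ * D1 ≤ 12 * M * (ε / δ) := by
      have : δ ^ 2 / ε * D1 ≤ 12 * M := by linarith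
      calc δ * D1 = δ ^ 2 / ε * D1 * (ε / δ) := by field_simp
        _ ≤ _ := by gcongr
    have hr : 0 ≤ ε / δ := by positivity
    calc D0 + δ * (D0 + D1) ≤ 3 * (12 * M * (ε / δ)) := by linarith
      _ = (36 * M) * (ε / δ) := by ring
      _ ≤ (72 * M + 32 * K) * (ε / δ) := by gcongr; linarith
      _ = _ := by ring

end FinalBounds

section Sequences

open scoped lp NNReal

/-- The frequency lattice. -/
abbrev Lat := Fin 2 → ℤ

/-- Absolutely summable sequences of Fourier coefficients. -/
abbrev Sq (ι : Type) [Fintype ι] := lp (fun _ : Lat => EuclideanSpace ℂ ι) 1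

variable {ι : Type} [Fintype ι]

namespace Sq

theorem hasSum_norm (Z : Sq ι) : HasSum (fun k => ‖Z k‖) ‖Z‖ := by
  have := lp.hasSum_norm (p := 1) (by simp) Z
  simpa using this

theorem norm_apply_le (Z : Sq ι) (k : Lat) : ‖Z k‖ ≤ ‖Z‖ :=
  lp.norm_apply_le_norm one_ne_zero Z k

/-- A sequence built from a summable family. -/
def of (f : Lat → EuclideanSpace ℂ ι) (h : Summable fun k => ‖f k‖) : Sq ι :=
  ⟨f, memℓp_gen (by simpa using h)⟩

@[simp] theorem of_apply (f : Lat → EuclideanSpace ℂ ι) (h) (k : Lat) : of f h k = f k := rfl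

theorem norm_le_of_hasSum (Z : Sq ι) {b : Lat → ℝ} {C : ℝ} (hb : HasSum b C)
    (h : ∀ k, ‖Z k‖ ≤ b k) : ‖Z‖ ≤ C :=
  hasSum_le h (hasSum_norm Z) hb

/-- Fibrewise action of a uniformly bounded family of operators. -/
def fib (T : Lat → EuclideanSpace ℂ ι →L[ℂ] EuclideanSpace ℂ ι) {K : ℝ} (hK : 0 ≤ K)
    (hT : ∀ k, ‖T k‖ ≤ K) : Sq ι →L[ℂ] Sq ι := lp.mapCLM 1 T hK hT

@[simp] theorem fib_apply (T : Lat → EuclideanSpace ℂ ι →L[ℂ] EuclideanSpace ℂ ι) {K : ℝ}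
    (hK : 0 ≤ K) (hT : ∀ k, ‖T k‖ ≤ K) (Z : Sq ι) (k : Lat) : fib T hK hT Z k = T k (Z k) := rfl

theorem norm_fib_le (T : Lat → EuclideanSpace ℂ ι →L[ℂ] EuclideanSpace ℂ ι) {K : ℝ} (hK : 0 ≤ K)
    (hT : ∀ k, ‖T k‖ ≤ K) (Z : Sq ι) : ‖fib T hK hT Z‖ ≤ K * ‖Z‖ :=
  (fib T hK hT).le_of_opNorm_le (lp.norm_mapCLM_le 1 T hK hT) Z

end Sq

theorem hasSum_conv {a b : Lat → ℝ} {A B : ℝ} (ha : HasSum a A) (hb : HasSum b B)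
    (ha0 : ∀ k, 0 ≤ a k) (hb0 : ∀ k, 0 ≤ b k) :
    (∀ k, Summable fun l => a l * b (k - l)) ∧
      HasSum (fun k => ∑' l, a l * b (k - l)) (A * B) := by
  have h1 : HasSum (fun x : Lat × Lat => a x.1 * b x.2) (A * B) :=
    ha.mul hb (ha.summable.mul_of_nonneg hb.summable ha0 hb0)
  let e : Lat × Lat ≃ Lat × Lat :=
    { toFun := fun x => (x.2, x.1 - x.2)
      invFun := fun y => (y.1 + y.2, y.1)
      left_inv := fun x => by simp
      right_inv := fun y => by simp }
  have h2 : HasSum (fun x : Lat × Lat => a x.2 * b (x.1 - x.2)) (A * B) :=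
    (e.hasSum_iff (f := fun x : Lat × Lat => a x.1 * b x.2)).2 h1
  have h3 : ∀ k, Summable fun l => a l * b (k - l) := fun k => h2.summable.prod_factor k
  exact ⟨h3, h2.prod_fiberwise fun k => (h3 k).hasSum⟩

namespace Sq

variable (q : EuclideanSpace ℂ ι →L[ℂ] EuclideanSpace ℂ ι →L[ℂ] EuclideanSpace ℂ ι)

theorem summable_conv_norm (Z Y : Sq ι) (k : Lat) :
    Summable fun l => ‖q (Z l) (Y (k - l))‖ := by
  have h := (hasSum_conv (hasSum_norm Z) (hasSum_norm Y) (fun _ => norm_nonneg _)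
    fun _ => norm_nonneg _).1 k
  refine Summable.of_nonneg_of_le (fun _ => norm_nonneg _) (fun l => ?_) (h.mul_left ‖q‖)
  calc _ ≤ ‖q‖ * ‖Z l‖ * ‖Y (k - l)‖ := q.le_opNorm₂ _ _
    _ = _ := mul_assoc _ _ _

theorem norm_conv_apply_le (Z Y : Sq ι) (k : Lat) :
    ‖∑' l, q (Z l) (Y (k - l))‖ ≤ ‖q‖ * ∑' l, ‖Z l‖ * ‖Y (k - l)‖ := by
  have h := (hasSum_conv (hasSum_norm Z) (hasSum_norm Y) (fun _ => norm_nonneg _)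
    fun _ => norm_nonneg _).1 k
  rw [← tsum_mul_left]
  refine (norm_tsum_le_tsum_norm (summable_conv_norm q Z Y k)).trans
    ((summable_conv_norm q Z Y k).tsum_le_tsum (fun l => ?_) (h.mul_left _))
  calc _ ≤ ‖q‖ * ‖Z l‖ * ‖Y (k - l)‖ := q.le_opNorm₂ _ _
    _ = _ := mul_assoc _ _ _

/-- Convolution of two sequences through a bilinear map. -/
def conv (Z Y : Sq ι) : Sq ι :=
  of (fun k => ∑' l, q (Z l) (Y (k - l))) <| by
    have h := (hasSum_conv (hasSum_norm Z) (hasSum_norm Y) (fun _ => norm_nonneg _)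
      fun _ => norm_nonneg _).2
    exact Summable.of_nonneg_of_le (fun _ => norm_nonneg _) (norm_conv_apply_le q Z Y)
      (h.summable.mul_left _)

@[simp] theorem conv_apply (Z Y : Sq ι) (k : Lat) :
    conv q Z Y k = ∑' l, q (Z l) (Y (k - l)) := rfl

theorem norm_conv_le (Z Y : Sq ι) : ‖conv q Z Y‖ ≤ ‖q‖ * (‖Z‖ * ‖Y‖) :=
  norm_le_of_hasSum _ ((hasSum_conv (hasSum_norm Z) (hasSum_norm Y) (fun _ => norm_nonneg _)
    fun _ => norm_nonneg _).2.mul_left _) (norm_conv_apply_le q Z Y)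

theorem conv_sub_left (Z Z' Y : Sq ι) : conv q (Z - Z') Y = conv q Z Y - conv q Z' Y := by
  apply lp.ext
  funext k
  rw [lp.coeFn_sub, Pi.sub_apply, conv_apply, conv_apply, conv_apply,
    ← (summable_conv_norm q Z Y k).of_norm.tsum_sub (summable_conv_norm q Z' Y k).of_norm]
  simp

theorem conv_sub_right (Z Y Y' : Sq ι) : conv q Z (Y - Y') = conv q Z Y - conv q Z Y' := by
  apply lp.ext
  funext k
  rw [lp.coeFn_sub, Pi.sub_apply, conv_apply, conv_apply, conv_apply,
    ← (summable_conv_norm q Z Y k).of_norm.tsum_sub (summable_conv_norm q Z Y' k).of_norm]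
  simp

/-- Tame estimate for a bounded Fourier multiplier of a convolution. -/
theorem norm_weight_conv_le {ω : Lat → ℝ} {K c : ℝ} (hω0 : ∀ k, 0 ≤ ω k)
    (hωc : ∀ l k, ω k ≤ c * (ω l + ω (k - l))) (hK : 0 ≤ K) (T)
    (hT : ∀ k, ‖T k‖ ≤ K) (hTω : ∀ k v, T k v = (ω k : ℂ) • v) (Z Y : Sq ι) :
    ‖fib T hK hT (conv q Z Y)‖
      ≤ c * ‖q‖ * (‖fib T hK hT Z‖ * ‖Y‖ + ‖Z‖ * ‖fib T hK hT Y‖) := by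
  have hn : ∀ (V : Sq ι) k, ‖fib T hK hT V k‖ = ω k * ‖V k‖ := fun V k => by
    rw [fib_apply, hTω, norm_smul, Complex.norm_real, Real.norm_of_nonneg (hω0 k)]
  have h1 := hasSum_conv (hasSum_norm (fib T hK hT Z)) (hasSum_norm Y) (fun _ => norm_nonneg _)
    fun _ => norm_nonneg _
  have h2 := hasSum_conv (hasSum_norm Z) (hasSum_norm (fib T hK hT Y)) (fun _ => norm_nonneg _)
    fun _ => norm_nonneg _
  have h0 := hasSum_conv (hasSum_norm Z) (hasSum_norm Y) (fun _ => norm_nonneg _)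
    fun _ => norm_nonneg _
  refine norm_le_of_hasSum _ ((h1.2.add h2.2).mul_left (c * ‖q‖)) fun k => ?_
  rw [hn, conv_apply, ← (h1.1 k).tsum_add (h2.1 k)]
  calc ω k * ‖∑' l, q (Z l) (Y (k - l))‖
      ≤ ω k * (‖q‖ * ∑' l, ‖Z l‖ * ‖Y (k - l)‖) :=
        mul_le_mul_of_nonneg_left (norm_conv_apply_le q Z Y k) (hω0 k)
    _ = ‖q‖ * ∑' l, ω k * (‖Z l‖ * ‖Y (k - l)‖) := by rw [tsum_mul_left]; ring
    _ ≤ ‖q‖ * ∑' l, c * (‖fib T hK hT Z l‖ * ‖Y (k - l)‖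
          + ‖Z l‖ * ‖fib T hK hT Y (k - l)‖) := by
        refine mul_le_mul_of_nonneg_left (Summable.tsum_le_tsum (fun l => ?_)
          ((h0.1 k).mul_left _) (((h1.1 k).add (h2.1 k)).mul_left _)) q.opNorm_nonneg
        rw [hn, hn]
        calc ω k * (‖Z l‖ * ‖Y (k - l)‖)
            ≤ c * (ω l + ω (k - l)) * (‖Z l‖ * ‖Y (k - l)‖) := by
              gcongr
              exact hωc l k
          _ = _ := by ring
    _ = _ := by rw [tsum_mul_left]; ring

end Sq

end Sequences

section TruncatedFlow

open scoped NNReal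

/-- Piecewise linear cutoff: equal to `1` on `[0, R]` and to `0` beyond `2 * R`. -/
def cut (R r : ℝ) : ℝ := max 0 (min 1 (2 - r / R))

theorem cut_nonneg (R r : ℝ) : 0 ≤ cut R r := le_max_left _ _

theorem cut_le_one (R r : ℝ) : cut R r ≤ 1 := max_le zero_le_one (min_le_left _ _)

theorem cut_eq_one {R r : ℝ} (hR : 0 < R) (h : r ≤ R) : cut R r = 1 := by
  have : r / R ≤ 1 := (div_le_one hR).2 h
  rw [cut, min_eq_left (by linarith), max_eq_right zero_le_one]

theorem cut_eq_zero {R r : ℝ} (hR : 0 < R) (h : 2 * R ≤ r) : cut R r = 0 := by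
  have : 2 ≤ r / R := (le_div_iff₀ hR).2 h
  exact max_eq_left ((min_le_right _ _).trans (by linarith))

theorem abs_cut_sub_le {R : ℝ} (hR : 0 < R) (r s : ℝ) : |cut R r - cut R s| ≤ |r - s| / R := by
  have h1 : |cut R r - cut R s| ≤ |min 1 (2 - r / R) - min 1 (2 - s / R)| := by
    have := abs_max_sub_max_le_max 0 (min 1 (2 - r / R)) 0 (min 1 (2 - s / R))
    simpa [cut] using this
  have h2 := abs_min_sub_min_le_max 1 (2 - r / R) 1 (2 - s / R)
  have h3 : |2 - r / R - (2 - s / R)| = |r - s| / R := by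
    rw [← abs_of_pos hR, ← abs_div, abs_of_pos hR, ← abs_neg]
    congr 1
    ring
  rw [h3, sub_self, abs_zero, max_eq_right (by positivity)] at h2
  exact h1.trans h2

variable {E : Type*} [NormedAddCommGroup E] [NormedSpace ℝ E]

/-- A time-dependent vector field with locally Lipschitz dependence, vanishing at the origin. -/
structure TameField (N : ℝ → E → E) (m κ : ℝ) : Prop where
  m_nonneg : 0 ≤ m
  κ_nonneg : 0 ≤ κ
  zero : ∀ t, N t 0 = 0
  lip : ∀ t x y, ‖N t x - N t y‖ ≤ (m + κ * (‖x‖ + ‖y‖)) * ‖x - y‖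
  cont : ∀ x, Continuous fun t => N t x

/-- Truncation of a vector field outside a ball. -/
def truncField (R : ℝ) (N : ℝ → E → E) (t : ℝ) (x : E) : E := cut R ‖x‖ • N t x

namespace TameField

variable {N : ℝ → E → E} {m κ R : ℝ}

theorem norm_le (h : TameField N m κ) (t : ℝ) (x : E) : ‖N t x‖ ≤ (m + κ * ‖x‖) * ‖x‖ := by
  simpa [h.zero] using h.lip t x 0

theorem norm_trunc_sub_le (h : TameField N m κ) (hR : 0 < R) (t : ℝ) (x y : E)
    (hxy : ‖y‖ ≤ ‖x‖) :
    ‖truncField R N t x - truncField R N t y‖ ≤ (3 * m + 8 * κ * R) * ‖x - y‖ := by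
  have hm := h.m_nonneg
  have hκ := h.κ_nonneg
  have hd : |cut R ‖x‖ - cut R ‖y‖| ≤ ‖x - y‖ / R :=
    (abs_cut_sub_le hR _ _).trans (by gcongr; exact abs_norm_sub_norm_le x y)
  rcases le_total (2 * R) ‖y‖ with hy | hy
  · rw [truncField, truncField, cut_eq_zero hR hy, cut_eq_zero hR (hy.trans hxy)]
    simp only [zero_smul, sub_self, norm_zero]
    positivity
  have hNy : ‖(cut R ‖x‖ - cut R ‖y‖) • N t y‖ ≤ (2 * m + 4 * κ * R) * ‖x - y‖ := by
    rw [norm_smul, Real.norm_eq_abs]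
    calc _ ≤ ‖x - y‖ / R * ((m + κ * (2 * R)) * (2 * R)) := by
          gcongr
          refine (h.norm_le t y).trans ?_
          gcongr
      _ = _ := by field_simp; ring
  rcases le_total (2 * R) ‖x‖ with hx | hx
  · have h0 : truncField R N t x - truncField R N t y
        = (cut R ‖x‖ - cut R ‖y‖) • N t y := by
      rw [truncField, truncField, cut_eq_zero hR hx, zero_smul, sub_smul, zero_smul]
    rw [h0]
    refine hNy.trans ?_
    gcongr <;> nlinarith [mul_nonneg hκ hR.le]
  have he : truncField R N t x - truncField R N t y
      = cut R ‖x‖ • (N t x - N t y) + (cut R ‖x‖ - cut R ‖y‖) • N t y := by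
    simp only [truncField, smul_sub, sub_smul]
    abel
  have h1 : ‖cut R ‖x‖ • (N t x - N t y)‖ ≤ (m + κ * (2 * R + 2 * R)) * ‖x - y‖ := by
    rw [norm_smul, Real.norm_of_nonneg (cut_nonneg _ _)]
    calc _ ≤ 1 * ((m + κ * (2 * R + 2 * R)) * ‖x - y‖) := by
          gcongr
          · exact cut_le_one _ _
          · refine (h.lip t x y).trans ?_
            gcongr
      _ = _ := one_mul _
  rw [he]
  refine (norm_add_le _ _).trans ((add_le_add h1 hNy).trans (le_of_eq ?_))
  ring

theorem lipschitz_trunc (h : TameField N m κ) (hR : 0 < R) (t : ℝ) :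
    LipschitzWith (3 * m + 8 * κ * R).toNNReal (truncField R N t) := by
  have hm := h.m_nonneg
  have hκ := h.κ_nonneg
  refine LipschitzWith.of_dist_le_mul fun x y => ?_
  rw [Real.coe_toNNReal _ (by positivity)]
  rcases le_total ‖y‖ ‖x‖ with hxy | hxy
  · rw [dist_eq_norm, dist_eq_norm]
    exact h.norm_trunc_sub_le hR t x y hxy
  · rw [dist_comm, dist_comm x, dist_eq_norm, dist_eq_norm]
    exact h.norm_trunc_sub_le hR t y x hxy

theorem norm_trunc_le (h : TameField N m κ) (hR : 0 < R) (t : ℝ) (x : E) :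
    ‖truncField R N t x‖ ≤ (m + κ * (2 * R)) * (2 * R) := by
  have hm := h.m_nonneg
  have hκ := h.κ_nonneg
  rcases le_total (2 * R) ‖x‖ with hx | hx
  · rw [truncField, cut_eq_zero hR hx, zero_smul, norm_zero]
    positivity
  · rw [truncField, norm_smul, Real.norm_of_nonneg (cut_nonneg _ _)]
    calc _ ≤ 1 * ((m + κ * (2 * R)) * (2 * R)) := by
          gcongr
          · exact cut_le_one _ _
          · refine (h.norm_le t x).trans ?_
            gcongr
      _ = _ := one_mul _

theorem exists_flow [CompleteSpace E] (h : TameField N m κ) (hR : 0 < R) (x₀ : E) {T : ℝ}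
    (hT : 0 ≤ T) :
    ∃ Z : ℝ → E, Z 0 = x₀ ∧
      ∀ t ∈ Set.Ioo (-1) (T + 1), HasDerivAt Z (truncField R N t (Z t)) t := by
  have hm := h.m_nonneg
  have hκ := h.κ_nonneg
  set L : ℝ := (m + κ * (2 * R)) * (2 * R)
  have hL : 0 ≤ L := by positivity
  have hP : IsPicardLindelof (truncField R N) (tmin := -1) (tmax := T + 1)
      ⟨0, by constructor <;> linarith⟩ x₀ (L * (T + 1)).toNNReal 0 L.toNNReal
      (3 * m + 8 * κ * R).toNNReal :=
    { lipschitzOnWith := fun t _ => (h.lipschitz_trunc hR t).lipschitzOnWith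
      continuousOn := fun x _ => (continuous_const.smul (h.cont x)).continuousOn
      norm_le := fun t _ x _ => by
        rw [Real.coe_toNNReal _ hL]
        exact h.norm_trunc_le hR t x
      mul_max_le := by
        rw [Real.coe_toNNReal _ hL, Real.coe_toNNReal _ (by positivity)]
        simp only [sub_zero, zero_sub, neg_neg, NNReal.coe_zero]
        rw [max_eq_left (by linarith)] }
  obtain ⟨Z, h0, hZ⟩ := hP.exists_eq_forall_mem_Icc_hasDerivWithinAt₀
  exact ⟨Z, h0, fun t ht => (hZ t (Set.Ioo_subset_Icc_self ht)).hasDerivAt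
    (Icc_mem_nhds ht.1 ht.2)⟩

theorem flow_unique (h : TameField N m κ) (hR : 0 < R) {T : ℝ} (hT : 0 ≤ T) {Z Y : ℝ → E}
    (hZ : ∀ t ∈ Set.Ioo (-1) (T + 1), HasDerivAt Z (truncField R N t (Z t)) t)
    (hY : ∀ t ∈ Set.Ioo (-1) (T + 1), HasDerivAt Y (truncField R N t (Y t)) t)
    (h0 : Z 0 = Y 0) : Set.EqOn Z Y (Set.Ioo (-1) (T + 1)) :=
  ODE_solution_unique_of_mem_Ioo (s := fun _ => Set.univ) (v := truncField R N)
    (fun t _ => (h.lipschitz_trunc hR t).lipschitzOnWith)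
    (t₀ := 0) ⟨by norm_num, by linarith⟩ (fun t ht => ⟨hZ t ht, trivial⟩)
    (fun t ht => ⟨hY t ht, trivial⟩) h0

/-- Propagation of a seminorm which is tame for the vector field. -/
theorem flow_persist {N : ℝ → E → E} (hR : 0 < R) {T : ℝ} (hT : 0 ≤ T)
    {Z : ℝ → E} (hZ : ∀ t ∈ Set.Ioo (-1) (T + 1), HasDerivAt Z (truncField R N t (Z t)) t)
    {E' : Type*} [NormedAddCommGroup E'] [NormedSpace ℝ E'] (P : E →L[ℝ] E') {m' κ' : ℝ}
    (hm' : 0 ≤ m') (hκ' : 0 ≤ κ') (hP : ∀ t x, ‖P (N t x)‖ ≤ (m' + κ' * ‖x‖) * ‖P x‖) :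
    ∀ t ∈ Set.Ioo (-1) (T + 1),
      ‖P (Z t)‖ ≤ ‖P (Z 0)‖ * exp ((m' + κ' * (2 * R)) * (T + 1)) := by
  set K := m' + κ' * (2 * R)
  have hK : 0 ≤ K := by positivity
  have hb : ∀ t x, ‖P (truncField R N t x)‖ ≤ K * ‖P x‖ := fun t x => by
    rcases le_total (2 * R) ‖x‖ with hx | hx
    · rw [truncField, cut_eq_zero hR hx, zero_smul, map_zero, norm_zero]
      positivity
    · rw [truncField, map_smul, norm_smul, Real.norm_of_nonneg (cut_nonneg _ _)]
      calc _ ≤ 1 * (K * ‖P x‖) := by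
            gcongr
            · exact cut_le_one _ _
            · refine (hP t x).trans ?_
              simp only [K]
              gcongr
        _ = _ := one_mul _
  have hPd : ∀ t ∈ Set.Ioo (-1) (T + 1),
      HasDerivAt (fun s => P (Z s)) (P (truncField R N t (Z t))) t := fun t ht =>
    P.hasFDerivAt.comp_hasDerivAt t (hZ t ht)
  intro t ht
  rcases le_total 0 t with h0 | h0
  · have hsub : ∀ s ∈ Set.Icc 0 t, s ∈ Set.Ioo (-1) (T + 1) := fun s hs =>
      ⟨by linarith [hs.1], hs.2.trans_lt ht.2⟩
    have := norm_le_gronwallBound_of_norm_deriv_right_le (f := fun s => P (Z s))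
      (f' := fun s => P (truncField R N s (Z s))) (δ := ‖P (Z 0)‖) (K := K) (ε := 0)
      (fun s hs => (hPd s (hsub s hs)).continuousAt.continuousWithinAt)
      (fun s hs => (hPd s (hsub s (Set.Ico_subset_Icc_self hs))).hasDerivWithinAt) le_rfl
      (fun s hs => by rw [add_zero]; exact hb s (Z s)) t ⟨h0, le_rfl⟩
    rw [gronwallBound_ε0, sub_zero] at this
    refine this.trans ?_
    gcongr
    exact ht.2.le
  · have hsub : ∀ s ∈ Set.Icc 0 (-t), -s ∈ Set.Ioo (-1) (T + 1) := fun s hs =>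
      ⟨by linarith [hs.2, ht.1], by linarith [hs.1]⟩
    have hd : ∀ s ∈ Set.Icc 0 (-t), HasDerivAt (fun s => P (Z (-s)))
        (-P (truncField R N (-s) (Z (-s)))) s := fun s hs => by
      have := (hPd (-s) (hsub s hs)).scomp s (hasDerivAt_neg s)
      rw [neg_one_smul] at this
      exact this
    have := norm_le_gronwallBound_of_norm_deriv_right_le (f := fun s => P (Z (-s)))
      (f' := fun s => -P (truncField R N (-s) (Z (-s)))) (δ := ‖P (Z 0)‖) (K := K) (ε := 0)
      (fun s hs => (hd s hs).continuousAt.continuousWithinAt)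
      (fun s hs => (hd s (Set.Ico_subset_Icc_self hs)).hasDerivWithinAt) (by simp)
      (fun s hs => by rw [add_zero, norm_neg]; exact hb (-s) (Z (-s))) (-t) ⟨by linarith, le_rfl⟩
    rw [gronwallBound_ε0, sub_zero, neg_neg] at this
    refine this.trans ?_
    gcongr
    linarith [ht.1]

/-- An a priori bound on part of the solution keeps it away from the truncation. -/
theorem flow_lt {N : ℝ → E → E} {T : ℝ}
    {Z : ℝ → E} (hZ : ∀ t ∈ Set.Ioo (-1) (T + 1), HasDerivAt Z (truncField R N t (Z t)) t)
    {β : ℝ → E → ℝ} {m κ b : ℝ} (hm : 0 ≤ m) (hκ : 0 ≤ κ) (hb : 0 ≤ b)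
    (hN : ∀ t x, ‖N t x‖ ≤ (m + κ * β t x) * ‖x‖)
    (hZ0 : ‖Z 0‖ * exp ((m + κ * b) * T) < R)
    (hap : ∀ T' ∈ Set.Icc 0 T, (∀ t ∈ Set.Icc 0 T', ‖Z t‖ < R) → ∀ t ∈ Set.Icc 0 T', β t (Z t) ≤ b) :
    ∀ t ∈ Set.Icc 0 T, ‖Z t‖ < R := by
  by_contra! hcon
  set S : Set ℝ := {t | t ∈ Set.Icc 0 T ∧ R ≤ ‖Z t‖}
  have hSne : S.Nonempty := hcon.imp fun t h => ⟨h.1, h.2⟩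
  have hcont : ContinuousOn Z (Set.Icc 0 T) := fun t ht =>
    (hZ t ⟨by linarith [ht.1], by linarith [ht.2]⟩).continuousAt.continuousWithinAt
  have hScl : IsClosed S :=
    hcont.norm.preimage_isClosed_of_isClosed isClosed_Icc isClosed_Ici
  have hSbd : BddBelow S := ⟨0, fun t ht => ht.1.1⟩
  set s := sInf S
  have hs : s ∈ S := hScl.csInf_mem hSne hSbd
  have hlt : ∀ t, 0 ≤ t → t < s → ‖Z t‖ < R := fun t h0 ht => by
    by_contra! h
    exact absurd (csInf_le hSbd ⟨⟨h0, ht.le.trans hs.1.2⟩, h⟩) (not_le.2 ht)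
  have hsub : ∀ t ∈ Set.Icc 0 s, t ∈ Set.Ioo (-1) (T + 1) := fun t ht =>
    ⟨by linarith [ht.1], by linarith [ht.2, hs.1.2]⟩
  have hbd : ∀ t ∈ Set.Ico 0 s, ‖truncField R N t (Z t)‖ ≤ (m + κ * b) * ‖Z t‖ + 0 :=
    fun t ht => by
      have hβ := hap t ⟨ht.1, ht.2.le.trans hs.1.2⟩
        (fun r hr => hlt r hr.1 (hr.2.trans_lt ht.2)) t ⟨ht.1, le_rfl⟩
      rw [truncField, norm_smul, Real.norm_of_nonneg (cut_nonneg _ _), add_zero]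
      calc _ ≤ 1 * ((m + κ * b) * ‖Z t‖) := by
            gcongr
            · exact cut_le_one _ _
            · refine (hN t _).trans ?_
              gcongr
        _ = _ := one_mul _
  have := norm_le_gronwallBound_of_norm_deriv_right_le (f := Z)
      (f' := fun s => truncField R N s (Z s)) (δ := ‖Z 0‖) (K := m + κ * b) (ε := 0)
      (fun s hs => (hZ s (hsub s hs)).continuousAt.continuousWithinAt)
      (fun s hs => (hZ s (hsub s (Set.Ico_subset_Icc_self hs))).hasDerivWithinAt) le_rfl
      hbd s ⟨hs.1.1, le_rfl⟩
  rw [gronwallBound_ε0, sub_zero] at this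
  refine absurd (hs.2.trans this) (not_le.2 (lt_of_le_of_lt ?_ hZ0))
  gcongr
  exact hs.1.2

end TameField

end TruncatedFlow

section Propagator

open scoped lp

/-- First-order symmetric system with constant coefficients and a quadratic term. -/
structure QuadSys (ι : Type) where
  /-- Coefficients of the first-order part. -/
  B : Fin 2 → Matrix ι ι ℝ
  /-- Zeroth-order coefficients. -/
  M : Matrix ι ι ℝ
  /-- Coefficients of the quadratic part. -/
  q : ι → ι → ι → ℝ
  symm : ∀ j a b, B j a b = B j b a

namespace QuadSys

variable {ι : Type} [Fintype ι] [DecidableEq ι] (Q : QuadSys ι)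

/-- Matrix symbol of the first-order part at a frequency. -/
def symb (k : Lat) : Matrix ι ι ℂ :=
  fun a b => 2 * π * Complex.I * ∑ j, (k j : ℂ) * (Q.B j a b : ℂ)

/-- Symbol of the first-order part as an operator. -/
def A (k : Lat) : EuclideanSpace ℂ ι →L[ℂ] EuclideanSpace ℂ ι :=
  Matrix.toEuclideanCLM (𝕜 := ℂ) (n := ι) (Q.symb k)

theorem A_apply (k : Lat) (v : EuclideanSpace ℂ ι) (a : ι) :
    Q.A k v a = ∑ b, 2 * π * Complex.I * (∑ j, (k j : ℂ) * (Q.B j a b : ℂ)) * v b := by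
  have : (Q.A k v).ofLp = Matrix.mulVec (Q.symb k) v.ofLp := Matrix.ofLp_toEuclideanCLM _ _
  exact congrFun this a

theorem A_mem_skewAdjoint (k : Lat) : Q.A k ∈ skewAdjoint _ := by
  rw [skewAdjoint.mem_iff, A, ← map_star, ← map_neg]
  congr 1
  ext a b
  simp only [Matrix.star_apply, symb, Matrix.neg_apply, star_mul', star_sum, RCLike.star_def,
    Complex.conj_I, Complex.conj_ofReal, map_intCast, map_ofNat, Q.symm _ b a]
  ring

/-- Free evolution at a frequency. -/
def G (k : Lat) (t : ℝ) : EuclideanSpace ℂ ι →L[ℂ] EuclideanSpace ℂ ι :=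
  NormedSpace.exp (t • Q.A k)

theorem G_mem_unitary (k : Lat) (t : ℝ) : Q.G k t ∈ unitary _ := by
  let _ : NormedAlgebra ℚ (EuclideanSpace ℂ ι →L[ℂ] EuclideanSpace ℂ ι) := .restrictScalars ℚ ℂ _
  exact NormedSpace.exp_mem_unitary_of_mem_skewAdjoint (skewAdjoint.smul_mem t (Q.A_mem_skewAdjoint k))

theorem norm_G_apply (k : Lat) (t : ℝ) (v : EuclideanSpace ℂ ι) : ‖Q.G k t v‖ = ‖v‖ :=
  ContinuousLinearMap.norm_map_of_mem_unitary (Q.G_mem_unitary k t) v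

theorem norm_G_le (t : ℝ) (k : Lat) : ‖Q.G k t‖ ≤ 1 :=
  ContinuousLinearMap.opNorm_le_bound _ zero_le_one fun v => by rw [norm_G_apply, one_mul]

theorem G_zero (k : Lat) : Q.G k 0 = 1 := by
  rw [G, zero_smul ℝ (Q.A k), NormedSpace.exp_zero]

theorem G_neg_mul (k : Lat) (t : ℝ) : Q.G k t * Q.G k (-t) = 1 := by
  let _ : NormedAlgebra ℚ (EuclideanSpace ℂ ι →L[ℂ] EuclideanSpace ℂ ι) := .restrictScalars ℚ ℂ _
  rw [G, G, neg_smul t (Q.A k)]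
  refine (NormedSpace.exp_add_of_commute (Commute.refl (t • Q.A k)).neg_right).symm.trans ?_
  rw [add_neg_cancel, NormedSpace.exp_zero]

theorem hasDerivAt_G (k : Lat) (t : ℝ) : HasDerivAt (Q.G k) (Q.A k * Q.G k t) t :=
  hasDerivAt_exp_smul_const' (𝕂 := ℝ) (Q.A k) t

theorem hasDerivAt_G_apply (k : Lat) {v : ℝ → EuclideanSpace ℂ ι} {v' : EuclideanSpace ℂ ι} {t : ℝ}
    (hv : HasDerivAt v v' t) :
    HasDerivAt (fun s => Q.G k s (v s)) (Q.A k (Q.G k t (v t)) + Q.G k t v') t := by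
  have h : HasDerivAt (fun s => (Q.G k s).restrictScalars ℝ)
      ((Q.A k * Q.G k t).restrictScalars ℝ) t :=
    (ContinuousLinearMap.restrictScalarsIsometry ℂ (EuclideanSpace ℂ ι) (EuclideanSpace ℂ ι) ℝ
      ℝ).toContinuousLinearMap.hasFDerivAt.comp_hasDerivAt t (Q.hasDerivAt_G k t)
  exact h.clm_apply hv

/-- Free evolution on sequences. -/
def S (t : ℝ) : Sq ι →L[ℂ] Sq ι := Sq.fib (fun k => Q.G k t) zero_le_one (Q.norm_G_le t)

@[simp] theorem S_apply (t : ℝ) (Z : Sq ι) (k : Lat) : Q.S t Z k = Q.G k t (Z k) := rfl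

theorem S_zero (Z : Sq ι) : Q.S 0 Z = Z := by
  apply lp.ext; funext k
  rw [S_apply, G_zero]; rfl

theorem S_S_neg (t : ℝ) (Z : Sq ι) : Q.S t (Q.S (-t) Z) = Z := by
  apply lp.ext; funext k
  rw [S_apply, S_apply, ← ContinuousLinearMap.mul_apply, G_neg_mul]; rfl

theorem norm_S_le (t : ℝ) (Z : Sq ι) : ‖Q.S t Z‖ ≤ ‖Z‖ :=
  (Sq.norm_fib_le _ zero_le_one (Q.norm_G_le t) Z).trans_eq (one_mul _)

theorem norm_S (t : ℝ) (Z : Sq ι) : ‖Q.S t Z‖ = ‖Z‖ := by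
  refine le_antisymm (Q.norm_S_le t Z) ?_
  have := Q.norm_S_le (-t) (Q.S t Z)
  rwa [show Q.S (-t) (Q.S t Z) = Z by simpa using Q.S_S_neg (-t) Z] at this

theorem continuous_G_apply (k : Lat) (v : EuclideanSpace ℂ ι) : Continuous fun t => Q.G k t v :=
  continuous_iff_continuousAt.2 fun t =>
    (Q.hasDerivAt_G_apply k (hasDerivAt_const t v)).continuousAt

theorem continuous_S_apply (Z : Sq ι) : Continuous fun t => Q.S t Z := by
  rw [continuous_iff_continuousAt]
  intro t
  rw [ContinuousAt, tendsto_iff_norm_sub_tendsto_zero]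
  have h : ∀ s, ‖Q.S s Z - Q.S t Z‖ = ∑' k, ‖Q.G k s (Z k) - Q.G k t (Z k)‖ := fun s => by
    rw [← (Sq.hasSum_norm (Q.S s Z - Q.S t Z)).tsum_eq]
    rfl
  simp_rw [h]
  have h0 : (0 : ℝ) = ∑' _ : Lat, (0 : ℝ) := by simp
  rw [h0]
  refine tendsto_tsum_of_dominated_convergence (bound := fun k => 2 * ‖Z k‖)
    ((Sq.hasSum_norm Z).summable.mul_left 2) (fun k => ?_) (Filter.Eventually.of_forall fun s k => ?_)
  · rw [← tendsto_iff_norm_sub_tendsto_zero]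
    exact (Q.continuous_G_apply k (Z k)).tendsto t
  · rw [norm_norm]
    refine (norm_sub_le _ _).trans ?_
    rw [norm_G_apply, norm_G_apply]
    linarith

theorem continuous_S {g : ℝ → Sq ι} {h : ℝ → ℝ} (hg : Continuous g) (hh : Continuous h) :
    Continuous fun t => Q.S (h t) (g t) := by
  rw [continuous_iff_continuousAt]
  intro t
  rw [ContinuousAt, tendsto_iff_norm_sub_tendsto_zero]
  have h1 : Filter.Tendsto (fun s => ‖g s - g t‖ + ‖Q.S (h s) (g t) - Q.S (h t) (g t)‖)
      (nhds t) (nhds (0 + 0)) :=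
    (tendsto_iff_norm_sub_tendsto_zero.1 (hg.tendsto t)).add
      (tendsto_iff_norm_sub_tendsto_zero.1 (((Q.continuous_S_apply (g t)).comp hh).tendsto t))
  rw [add_zero] at h1
  refine squeeze_zero (fun _ => norm_nonneg _) (fun s => ?_) h1
  have : Q.S (h s) (g s) - Q.S (h t) (g t)
      = Q.S (h s) (g s - g t) + (Q.S (h s) (g t) - Q.S (h t) (g t)) := by
    rw [map_sub]; abel
  rw [this]
  exact (norm_add_le _ _).trans (add_le_add (Q.norm_S_le _ _) le_rfl)

/-- Zeroth-order part at a frequency. -/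
def MV : EuclideanSpace ℂ ι →L[ℂ] EuclideanSpace ℂ ι :=
  Matrix.toEuclideanCLM (𝕜 := ℂ) (n := ι) (Q.M.map fun r => (r : ℂ))

theorem MV_apply (v : EuclideanSpace ℂ ι) (a : ι) : Q.MV v a = ∑ b, (Q.M a b : ℂ) * v b := by
  have : (Q.MV v).ofLp = Matrix.mulVec (Q.M.map fun r => (r : ℂ)) v.ofLp :=
    Matrix.ofLp_toEuclideanCLM _ _
  exact congrFun this a

/-- The quadratic part as a bilinear map. -/
def qV : EuclideanSpace ℂ ι →L[ℂ] EuclideanSpace ℂ ι →L[ℂ] EuclideanSpace ℂ ι :=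
  (LinearMap.mk₂ ℂ (fun x y : EuclideanSpace ℂ ι =>
      (WithLp.toLp 2 fun a => ∑ b, ∑ c, (Q.q a b c : ℂ) * x b * y c : EuclideanSpace ℂ ι))
    (fun x x' y => by
      ext a
      simp [mul_add, add_mul, Finset.sum_add_distrib])
    (fun r x y => by
      ext a
      simp only [PiLp.smul_apply, smul_eq_mul, Finset.mul_sum]
      exact Finset.sum_congr rfl fun b _ => Finset.sum_congr rfl fun c _ => by ring)
    (fun x y y' => by
      ext a
      simp [mul_add, Finset.sum_add_distrib])
    (fun r x y => by
      ext a
      simp only [PiLp.smul_apply, smul_eq_mul, Finset.mul_sum]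
      exact Finset.sum_congr rfl fun b _ => Finset.sum_congr rfl fun c _ => by ring)
    ).toContinuousBilinearMap

theorem qV_apply (x y : EuclideanSpace ℂ ι) (a : ι) :
    Q.qV x y a = ∑ b, ∑ c, (Q.q a b c : ℂ) * x b * y c := rfl

/-- Zeroth-order part on sequences. -/
def MS : Sq ι →L[ℂ] Sq ι := Sq.fib (fun _ => Q.MV) (norm_nonneg Q.MV) fun _ => le_rfl

/-- Zeroth-order and quadratic parts together. -/
def N (W : Sq ι) : Sq ι := Q.MS W + Sq.conv Q.qV W W

theorem N_apply (W : Sq ι) (k : Lat) :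
    Q.N W k = Q.MV (W k) + ∑' l, Q.qV (W l) (W (k - l)) := rfl

theorem N_sub (W Y : Sq ι) :
    Q.N W - Q.N Y = Q.MS (W - Y) + (Sq.conv Q.qV (W - Y) W + Sq.conv Q.qV Y (W - Y)) := by
  rw [N, N, map_sub, Sq.conv_sub_left, Sq.conv_sub_right]
  abel

theorem norm_MS_le (W : Sq ι) : ‖Q.MS W‖ ≤ ‖Q.MV‖ * ‖W‖ := Sq.norm_fib_le _ _ _ W

/-- The nonlinearity in the interaction picture. -/
def NI (t : ℝ) (Z : Sq ι) : Sq ι := Q.S (-t) (Q.N (Q.S t Z))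

theorem tameField_NI : TameField Q.NI ‖Q.MV‖ ‖Q.qV‖ where
  m_nonneg := norm_nonneg _
  κ_nonneg := Q.qV.opNorm_nonneg
  zero := fun t => by
    have : Sq.conv Q.qV (0 : Sq ι) 0 = 0 := by
      have := Sq.conv_sub_left Q.qV 0 0 0
      simpa using this
    simp [NI, N, this]
  lip := fun t x y => by
    rw [NI, NI, ← map_sub, norm_S, N_sub]
    have h1 := Q.norm_MS_le (Q.S t x - Q.S t y)
    have h2 := Sq.norm_conv_le Q.qV (Q.S t x - Q.S t y) (Q.S t x)
    have h3 := Sq.norm_conv_le Q.qV (Q.S t y) (Q.S t x - Q.S t y)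
    rw [← map_sub] at h1 h2 h3 ⊢
    simp only [norm_S] at h1 h2 h3
    refine (norm_add_le _ _).trans ((add_le_add h1 ((norm_add_le _ _).trans
      (add_le_add h2 h3))).trans (le_of_eq ?_))
    ring
  cont := fun x => by
    refine Q.continuous_S ?_ continuous_neg
    have hN : Continuous Q.N := by
      rw [continuous_iff_continuousAt]
      intro W
      rw [ContinuousAt, tendsto_iff_norm_sub_tendsto_zero]
      have h1 : Filter.Tendsto (fun Y : Sq ι => ‖Q.MV‖ * ‖Y - W‖
          + (‖Q.qV‖ * (‖Y - W‖ * ‖Y‖) + ‖Q.qV‖ * (‖W‖ * ‖Y - W‖))) (nhds W) (nhds 0) := by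
        have : Continuous (fun Y : Sq ι => ‖Q.MV‖ * ‖Y - W‖
          + (‖Q.qV‖ * (‖Y - W‖ * ‖Y‖) + ‖Q.qV‖ * (‖W‖ * ‖Y - W‖))) := by fun_prop
        simpa using this.tendsto W
      refine squeeze_zero (fun _ => norm_nonneg _) (fun Y => ?_) h1
      rw [N_sub]
      exact (norm_add_le _ _).trans (add_le_add (Q.norm_MS_le _) ((norm_add_le _ _).trans
        (add_le_add (Sq.norm_conv_le _ _ _) (Sq.norm_conv_le _ _ _))))
    exact hN.comp (Q.continuous_S_apply x)

end QuadSys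

end Propagator

section Persistence

open scoped lp

namespace QuadSys

variable {ι : Type} [Fintype ι] [DecidableEq ι] (Q : QuadSys ι)

/-- Truncated polynomial weight on the frequency lattice. -/
def wt (s : ℕ) (r : ℝ) (k : Lat) : ℝ := min ((1 + ‖k‖) ^ s) r

theorem wt_nonneg {s : ℕ} {r : ℝ} (hr : 0 ≤ r) (k : Lat) : 0 ≤ wt s r k :=
  le_min (by positivity) hr

theorem wt_le {s : ℕ} {r : ℝ} (hr : 0 ≤ r) (l k : Lat) :
    wt s r k ≤ 2 ^ s * (wt s r l + wt s r (k - l)) := by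
  have h1 : (1 + ‖k‖) ^ s ≤ 2 ^ s * ((1 + ‖l‖) ^ s + (1 + ‖k - l‖) ^ s) := by
    have h2 : 1 + ‖k‖ ≤ (1 + ‖l‖) + (1 + ‖k - l‖) := by
      have := norm_add_le l (k - l)
      rw [add_sub_cancel] at this
      linarith
    calc _ ≤ ((1 + ‖l‖) + (1 + ‖k - l‖)) ^ s := by gcongr
      _ ≤ 2 ^ (s - 1) * ((1 + ‖l‖) ^ s + (1 + ‖k - l‖) ^ s) :=
        add_pow_le (by positivity) (by positivity) s
      _ ≤ _ := by
        gcongr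
        · norm_num
        · omega
  have h2 : (1 : ℝ) ≤ 2 ^ s := one_le_pow₀ (by norm_num)
  have hl : (0 : ℝ) ≤ (1 + ‖l‖) ^ s := by positivity
  have hk : (0 : ℝ) ≤ (1 + ‖k - l‖) ^ s := by positivity
  have ha := wt_nonneg (s := s) hr l
  have hb := wt_nonneg (s := s) hr (k - l)
  by_cases hA : (1 + ‖l‖) ^ s ≤ r ∧ (1 + ‖k - l‖) ^ s ≤ r
  · rw [wt, wt, wt, min_eq_left hA.1, min_eq_left hA.2]
    exact (min_le_left _ _).trans h1
  · have h3 : r ≤ wt s r l + wt s r (k - l) := by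
      rcases not_and_or.1 hA with h | h
      · have : wt s r l = r := min_eq_right (not_le.1 h).le
        linarith
      · have : wt s r (k - l) = r := min_eq_right (not_le.1 h).le
        linarith
    calc wt s r k ≤ r := min_le_right _ _
      _ ≤ 1 * (wt s r l + wt s r (k - l)) := by rwa [one_mul]
      _ ≤ _ := by gcongr

/-- Multiplication of a sequence by the truncated weight. -/
def wtMul (s : ℕ) {r : ℝ} (hr : 0 ≤ r) : Sq ι →L[ℂ] Sq ι :=
  Sq.fib (fun k => (wt s r k : ℂ) • ContinuousLinearMap.id ℂ _) hr fun k => by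
    refine (norm_smul_le (wt s r k : ℂ) (ContinuousLinearMap.id ℂ (EuclideanSpace ℂ ι))).trans ?_
    rw [Complex.norm_real, Real.norm_of_nonneg (wt_nonneg hr k)]
    calc _ ≤ r * 1 := mul_le_mul (min_le_right _ _) ContinuousLinearMap.norm_id_le
          (norm_nonneg _) hr
      _ = r := mul_one r

theorem wtMul_apply (s : ℕ) {r : ℝ} (hr : 0 ≤ r) (Z : Sq ι) (k : Lat) :
    wtMul s hr Z k = (wt s r k : ℂ) • Z k := rfl

theorem wtMul_S (s : ℕ) {r : ℝ} (hr : 0 ≤ r) (t : ℝ) (Z : Sq ι) :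
    wtMul s hr (Q.S t Z) = Q.S t (wtMul s hr Z) := by
  apply lp.ext; funext k
  rw [wtMul_apply, S_apply, S_apply, wtMul_apply, map_smul]

theorem wtMul_MS (s : ℕ) {r : ℝ} (hr : 0 ≤ r) (Z : Sq ι) :
    wtMul s hr (Q.MS Z) = Q.MS (wtMul s hr Z) := by
  apply lp.ext; funext k
  exact (map_smul Q.MV _ _).symm

theorem norm_wtMul_NI_le (s : ℕ) {r : ℝ} (hr : 0 ≤ r) (t : ℝ) (Z : Sq ι) :
    ‖wtMul s hr (Q.NI t Z)‖ ≤ (‖Q.MV‖ + 2 * 2 ^ s * ‖Q.qV‖ * ‖Z‖) * ‖wtMul s hr Z‖ := by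
  have h1 : ‖wtMul s hr (Q.NI t Z)‖ = ‖wtMul s hr (Q.N (Q.S t Z))‖ := by
    rw [NI, wtMul_S, norm_S]
  have h2 : ‖wtMul s hr (Sq.conv Q.qV (Q.S t Z) (Q.S t Z))‖ ≤ _ :=
    Sq.norm_weight_conv_le Q.qV (wt_nonneg hr) (wt_le hr) hr _ _ (fun k v => rfl) _ _
  change _ ≤ 2 ^ s * ‖Q.qV‖ * (‖wtMul s hr (Q.S t Z)‖ * _ + _ * ‖wtMul s hr (Q.S t Z)‖) at h2
  have h3 := Q.norm_MS_le (wtMul s hr (Q.S t Z))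
  rw [wtMul_S, norm_S] at h2 h3
  rw [norm_S] at h2
  rw [h1, N, map_add, wtMul_MS, wtMul_S]
  refine (norm_add_le _ _).trans ((add_le_add h3 h2).trans (le_of_eq ?_))
  ring

theorem flow_decay {R T : ℝ} (hR : 0 < R) (hT : 0 ≤ T) {Z : ℝ → Sq ι}
    (hZ : ∀ t ∈ Set.Ioo (-1) (T + 1), HasDerivAt Z (truncField R Q.NI t (Z t)) t)
    (h0 : ∀ s : ℕ, Summable fun k => (1 + ‖k‖) ^ s * ‖Z 0 k‖) (s : ℕ) :
    ∃ C, ∀ t ∈ Set.Ioo (-1) (T + 1), ∀ k, (1 + ‖k‖) ^ s * ‖Z t k‖ ≤ C := by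
  refine ⟨(∑' k, (1 + ‖k‖) ^ s * ‖Z 0 k‖)
    * exp ((‖Q.MV‖ + 2 * 2 ^ s * ‖Q.qV‖ * (2 * R)) * (T + 1)), fun t ht k => ?_⟩
  have hr : (0 : ℝ) ≤ (1 + ‖k‖) ^ s := by positivity
  have hq := Q.qV.opNorm_nonneg
  have h1 := TameField.flow_persist hR hT hZ ((wtMul s hr).restrictScalars ℝ)
    (norm_nonneg Q.MV) (by positivity) (fun t x => Q.norm_wtMul_NI_le s hr t x) t ht
  have h2 : ‖wtMul s hr (Z 0)‖ ≤ ∑' k, (1 + ‖k‖) ^ s * ‖Z 0 k‖ :=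
    Sq.norm_le_of_hasSum _ (h0 s).hasSum fun l => by
      rw [wtMul_apply, norm_smul, Complex.norm_real, Real.norm_of_nonneg (wt_nonneg hr l)]
      gcongr
      exact min_le_left _ _
  have h3 : (1 + ‖k‖) ^ s * ‖Z t k‖ ≤ ‖wtMul s hr (Z t)‖ := by
    have := Sq.norm_apply_le (wtMul s hr (Z t)) k
    rw [wtMul_apply, norm_smul, Complex.norm_real, Real.norm_of_nonneg (wt_nonneg hr k), wt,
      min_self] at this
    exact this
  exact h3.trans (h1.trans (mul_le_mul_of_nonneg_right h2 (exp_pos _).le))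

end QuadSys

end Persistence

section Reality

open scoped lp ComplexConjugate

variable {ι : Type} [Fintype ι]

/-- Componentwise complex conjugation. -/
def conjV : EuclideanSpace ℂ ι ≃ₗᵢ[ℝ] EuclideanSpace ℂ ι :=
  LinearIsometryEquiv.piLpCongrRight 2 fun _ => Complex.conjLIE

@[simp] theorem conjV_apply (v : EuclideanSpace ℂ ι) (a : ι) : conjV v a = conj (v a) := rfl

/-- The symmetry of coefficient sequences whose fixed points represent real fields. -/
def conjS : Sq ι →L[ℝ] Sq ι :=
  LinearMap.mkContinuous
    { toFun := fun Z => Sq.of (fun k => conjV (Z (-k))) (by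
        have := (Equiv.neg Lat).summable_iff.2 (Sq.hasSum_norm Z).summable
        refine this.congr fun k => ?_
        rw [LinearIsometryEquiv.norm_map]; rfl)
      map_add' := fun Z Y => by
        apply lp.ext; funext k
        exact map_add conjV _ _
      map_smul' := fun r Z => by
        apply lp.ext; funext k
        exact map_smul conjV r _ } 1 fun Z => by
    rw [one_mul]
    refine Sq.norm_le_of_hasSum _ ((Equiv.neg Lat).hasSum_iff.2 (Sq.hasSum_norm Z)) fun k => ?_
    exact (LinearIsometryEquiv.norm_map _ _).le

theorem conjS_apply (Z : Sq ι) (k : Lat) : conjS Z k = conjV (Z (-k)) := rfl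

theorem norm_conjS (Z : Sq ι) : ‖conjS Z‖ = ‖Z‖ := by
  rw [← (Sq.hasSum_norm (conjS Z)).tsum_eq, ← (Sq.hasSum_norm Z).tsum_eq,
    ← (Equiv.neg Lat).tsum_eq]
  refine tsum_congr fun k => ?_
  rw [Equiv.neg_apply, conjS_apply, neg_neg, LinearIsometryEquiv.norm_map]

namespace QuadSys

variable [DecidableEq ι] (Q : QuadSys ι)

theorem conjV_A (k : Lat) (v : EuclideanSpace ℂ ι) : conjV (Q.A (-k) v) = Q.A k (conjV v) := by
  ext a
  simp only [conjV_apply, A_apply, map_sum, map_mul, Complex.conj_I, Complex.conj_ofReal,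
    map_intCast, map_ofNat, Pi.neg_apply, Int.cast_neg, map_neg]
  refine Finset.sum_congr rfl fun b _ => ?_
  rw [show (∑ j, -(k j : ℂ) * (Q.B j a b : ℂ)) = -∑ j, (k j : ℂ) * (Q.B j a b : ℂ) by
    rw [← Finset.sum_neg_distrib]; exact Finset.sum_congr rfl fun j _ => by ring]
  ring

theorem conjV_G (k : Lat) (t : ℝ) (v : EuclideanSpace ℂ ι) :
    conjV (Q.G (-k) t v) = Q.G k t (conjV v) := by
  have h1 : ∀ t, HasDerivAt (fun t => conjV (Q.G (-k) t v))
      (Q.A k (conjV (Q.G (-k) t v))) t := fun t => by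
    have := (conjV (ι := ι)).toContinuousLinearEquiv.toContinuousLinearMap.hasFDerivAt.comp_hasDerivAt
      t (Q.hasDerivAt_G_apply (-k) (hasDerivAt_const t v))
    rw [map_zero, add_zero] at this
    rw [← conjV_A]
    exact this
  have h2 : ∀ t, HasDerivAt (fun t => Q.G k t (conjV v)) (Q.A k (Q.G k t (conjV v))) t :=
    fun t => by
      simpa using Q.hasDerivAt_G_apply k (hasDerivAt_const t (conjV v))
  have := ODE_solution_unique_univ (v := fun _ x => Q.A k x) (s := fun _ => Set.univ)
    (K := ‖Q.A k‖₊) (t₀ := 0) (fun _ => (Q.A k).lipschitz.lipschitzOnWith)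
    (fun t => ⟨h1 t, trivial⟩) (fun t => ⟨h2 t, trivial⟩) (by simp [G_zero])
  exact congrFun this t

theorem conjS_S (t : ℝ) (Z : Sq ι) : conjS (Q.S t Z) = Q.S t (conjS Z) := by
  apply lp.ext; funext k
  rw [conjS_apply, S_apply, S_apply, conjS_apply, conjV_G]

theorem conjV_MV (v : EuclideanSpace ℂ ι) : conjV (Q.MV v) = Q.MV (conjV v) := by
  ext a
  simp [MV_apply]

theorem conjV_qV (v w : EuclideanSpace ℂ ι) : conjV (Q.qV v w) = Q.qV (conjV v) (conjV w) := by
  ext a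
  simp [qV_apply]

theorem conjS_N (Z : Sq ι) : conjS (Q.N Z) = Q.N (conjS Z) := by
  apply lp.ext; funext k
  rw [conjS_apply, N_apply, N_apply, map_add, conjV_MV, conjS_apply]
  congr 1
  refine ((conjV (ι := ι)).toContinuousLinearEquiv.map_tsum).trans ?_
  rw [← (Equiv.neg Lat).tsum_eq]
  refine tsum_congr fun l => ?_
  simp only [Equiv.neg_apply]
  refine (Q.conjV_qV _ _).trans ?_
  rw [conjS_apply, conjS_apply]
  rw [show -k - -l = -(k - l) by abel]

theorem conjS_NI (t : ℝ) (Z : Sq ι) : conjS (Q.NI t Z) = Q.NI t (conjS Z) := by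
  rw [NI, NI, conjS_S, conjS_N, conjS_S]

theorem flow_real {R T : ℝ} (hR : 0 < R) (hT : 0 ≤ T) {Z : ℝ → Sq ι}
    (hZ : ∀ t ∈ Set.Ioo (-1) (T + 1), HasDerivAt Z (truncField R Q.NI t (Z t)) t)
    (h0 : conjS (Z 0) = Z 0) : ∀ t ∈ Set.Ioo (-1) (T + 1), conjS (Z t) = Z t := by
  refine Q.tameField_NI.flow_unique hR hT (fun t ht => ?_) hZ h0
  have := conjS.hasFDerivAt.comp_hasDerivAt t (hZ t ht)
  refine this.congr_deriv ?_
  rw [truncField, truncField, map_smul, conjS_NI, norm_conjS]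

end QuadSys

end Reality

section LatticeSums

/-- A summable weight on the frequency lattice. -/
def sw (k : Lat) : ℝ := ((1 + ‖k‖) ^ 3)⁻¹

theorem sw_pos (k : Lat) : 0 < sw k := by unfold sw; positivity

theorem summable_sw : Summable sw := by
  have h1 := EisensteinSeries.summable_one_div_norm_rpow (k := 3) (by norm_num)
  have h2 : Summable fun k : Lat => if k = 0 then (1 : ℝ) else 0 := (hasSum_ite_eq 0 1).summable
  refine Summable.of_nonneg_of_le (fun k => (sw_pos k).le) (fun k => ?_) (h1.add h2)
  by_cases hk : k = 0
  · subst hk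
    simp [sw]
  · have : 0 < ‖k‖ := norm_pos_iff.2 hk
    simp only [hk, if_false, add_zero]
    rw [rpow_neg this.le, sw]
    norm_cast
    gcongr
    linarith

/-- Rapid decay of time-dependent coefficients, uniformly on a time set. -/
structure Decay (I : Set ℝ) (c : ℝ → Lat → ℂ) : Prop where
  cont : ∀ k, ContinuousOn (fun t => c t k) I
  bd : ∀ s : ℕ, ∃ C, ∀ t ∈ I, ∀ k, (1 + ‖k‖) ^ s * ‖c t k‖ ≤ C

/-- Coefficients with `n` rapidly decaying time derivatives. -/
def Rapid (I : Set ℝ) : ℕ → (ℝ → Lat → ℂ) → Prop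
  | 0, c => Decay I c
  | n + 1, c => Decay I c ∧ ∃ c' : ℝ → Lat → ℂ,
      (∀ k, ∀ t ∈ I, HasDerivAt (fun t => c t k) (c' t k) t) ∧ Rapid I n c'

/-- Convolution of scalar sequences. -/
def cconv (c d : Lat → ℂ) (k : Lat) : ℂ := ∑' l, c l * d (k - l)

variable {I : Set ℝ} {c d : ℝ → Lat → ℂ} {n : ℕ}

theorem Rapid.decay (h : Rapid I n c) : Decay I c := by
  cases n with
  | zero => exact h
  | succ n => exact h.1

theorem Rapid.of_succ : ∀ {n : ℕ} {c : ℝ → Lat → ℂ}, Rapid I (n + 1) c → Rapid I n c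
  | 0, _, h => h.1
  | _ + 1, _, ⟨h, c', h1, h2⟩ => ⟨h, c', h1, h2.of_succ⟩

theorem Decay.add (hc : Decay I c) (hd : Decay I d) : Decay I fun t k => c t k + d t k where
  cont := fun k => (hc.cont k).add (hd.cont k)
  bd := fun s => by
    obtain ⟨C, hC⟩ := hc.bd s
    obtain ⟨D, hD⟩ := hd.bd s
    refine ⟨C + D, fun t ht k => ?_⟩
    calc _ ≤ (1 + ‖k‖) ^ s * (‖c t k‖ + ‖d t k‖) := by gcongr; exact norm_add_le _ _
      _ = (1 + ‖k‖) ^ s * ‖c t k‖ + (1 + ‖k‖) ^ s * ‖d t k‖ := by ring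
      _ ≤ _ := add_le_add (hC t ht k) (hD t ht k)

theorem Decay.mult (hc : Decay I c) {m : Lat → ℂ} {A : ℝ} {p : ℕ} (hA : 0 ≤ A)
    (hm : ∀ k, ‖m k‖ ≤ A * (1 + ‖k‖) ^ p) : Decay I fun t k => m k * c t k where
  cont := fun k => continuousOn_const.mul (hc.cont k)
  bd := fun s => by
    obtain ⟨C, hC⟩ := hc.bd (s + p)
    refine ⟨A * C, fun t ht k => ?_⟩
    calc _ ≤ (1 + ‖k‖) ^ s * ((A * (1 + ‖k‖) ^ p) * ‖c t k‖) := by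
          rw [norm_mul]; gcongr; exact hm k
      _ = A * ((1 + ‖k‖) ^ (s + p) * ‖c t k‖) := by rw [pow_add]; ring
      _ ≤ _ := by gcongr; exact hC t ht k

theorem Decay.exists_sw (hc : Decay I c) (s : ℕ) :
    ∃ C, 0 ≤ C ∧ ∀ t ∈ I, ∀ k, (1 + ‖k‖) ^ s * ‖c t k‖ ≤ C * sw k := by
  obtain ⟨C, hC⟩ := hc.bd (s + 3)
  refine ⟨|C|, abs_nonneg C, fun t ht k => ?_⟩
  have h1 := (hC t ht k).trans (le_abs_self C)
  rw [sw, ← div_eq_mul_inv, le_div_iff₀ (by positivity)]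
  refine le_trans (le_of_eq ?_) h1
  rw [pow_add]; ring

theorem Decay.exists_sw_zero (hc : Decay I c) :
    ∃ C, 0 ≤ C ∧ ∀ t ∈ I, ∀ k, ‖c t k‖ ≤ C * sw k := by
  simpa using hc.exists_sw 0

theorem Decay.exists_bd (hc : Decay I c) : ∃ C, 0 ≤ C ∧ ∀ t ∈ I, ∀ k, ‖c t k‖ ≤ C := by
  obtain ⟨C, hC⟩ := hc.bd 0
  exact ⟨|C|, abs_nonneg C, fun t ht k => by simpa using (hC t ht k).trans (le_abs_self C)⟩

theorem Decay.summable (hc : Decay I c) {t : ℝ} (ht : t ∈ I) : Summable fun k => ‖c t k‖ := by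
  obtain ⟨C, -, hC⟩ := hc.exists_sw_zero
  exact Summable.of_nonneg_of_le (fun _ => norm_nonneg _) (hC t ht) (summable_sw.mul_left C)

theorem Decay.summable_conv (hc : Decay I c) (hd : Decay I d) {t : ℝ} (ht : t ∈ I) (k : Lat) :
    Summable fun l => c t l * d t (k - l) := by
  obtain ⟨D, hD0, hD⟩ := hd.exists_bd
  refine Summable.of_norm_bounded ((hc.summable ht).mul_right D) fun l => ?_
  rw [norm_mul]
  gcongr
  exact hD t ht _

theorem Decay.cconv (hc : Decay I c) (hd : Decay I d) :
    Decay I fun t => cconv (c t) (d t) where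
  cont := fun k => by
    obtain ⟨C, hC0, hC⟩ := hc.exists_sw_zero
    obtain ⟨D, hD0, hD⟩ := hd.exists_bd
    refine continuousOn_tsum (u := fun l => C * sw l * D)
      (fun l => (hc.cont l).mul (hd.cont (k - l)))
      ((summable_sw.mul_left C).mul_right D) fun l t ht => ?_
    rw [norm_mul]
    exact mul_le_mul (hC t ht l) (hD t ht _) (norm_nonneg _) (mul_nonneg hC0 (sw_pos l).le)
  bd := fun s => by
    obtain ⟨C, hC0, hC⟩ := hc.exists_sw s
    obtain ⟨D, hD⟩ := hd.bd s
    refine ⟨∑' l, C * sw l * |D|, fun t ht k => ?_⟩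
    have hs : Summable fun l => C * sw l * |D| := (summable_sw.mul_left C).mul_right _
    have hn : Summable fun l => ‖c t l * d t (k - l)‖ := (hc.summable_conv hd ht k).norm
    calc _ ≤ (1 + ‖k‖) ^ s * ∑' l, ‖c t l * d t (k - l)‖ := by
          gcongr
          exact norm_tsum_le_tsum_norm hn
      _ = ∑' l, (1 + ‖k‖) ^ s * ‖c t l * d t (k - l)‖ := tsum_mul_left.symm
      _ ≤ _ := by
          refine (hn.mul_left _).tsum_le_tsum (fun l => ?_) hs
          have h1 : (1 + ‖k‖) ^ s ≤ (1 + ‖l‖) ^ s * (1 + ‖k - l‖) ^ s := by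
            rw [← mul_pow]
            have := norm_add_le l (k - l)
            rw [add_sub_cancel] at this
            have h2 := mul_nonneg (norm_nonneg l) (norm_nonneg (k - l))
            gcongr
            nlinarith
          calc _ ≤ ((1 + ‖l‖) ^ s * (1 + ‖k - l‖) ^ s) * ‖c t l * d t (k - l)‖ := by gcongr
            _ = ((1 + ‖l‖) ^ s * ‖c t l‖) * ((1 + ‖k - l‖) ^ s * ‖d t (k - l)‖) := by
              rw [norm_mul]; ring
            _ ≤ _ := mul_le_mul (hC t ht l) ((hD t ht _).trans (le_abs_self D)) (by positivity)
              (mul_nonneg hC0 (sw_pos l).le)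

theorem Rapid.add : ∀ {n : ℕ} {c d : ℝ → Lat → ℂ}, Rapid I n c → Rapid I n d →
    Rapid I n fun t k => c t k + d t k
  | 0, _, _, hc, hd => Decay.add hc hd
  | _ + 1, _, _, ⟨hc, c', h1, h2⟩, ⟨hd, d', h3, h4⟩ =>
    ⟨hc.add hd, _, fun k t ht => (h1 k t ht).add (h3 k t ht), h2.add h4⟩

theorem Rapid.mult {m : Lat → ℂ} {A : ℝ} {p : ℕ} (hA : 0 ≤ A)
    (hm : ∀ k, ‖m k‖ ≤ A * (1 + ‖k‖) ^ p) : ∀ {n : ℕ} {c : ℝ → Lat → ℂ}, Rapid I n c →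
    Rapid I n fun t k => m k * c t k
  | 0, _, hc => Decay.mult hc hA hm
  | _ + 1, _, ⟨hc, _, h1, h2⟩ =>
    ⟨hc.mult hA hm, _, fun k t ht => (h1 k t ht).const_mul (m k), h2.mult hA hm⟩

theorem Rapid.const_mul (a : ℂ) (hc : Rapid I n c) : Rapid I n fun t k => a * c t k :=
  hc.mult (m := fun _ => a) (A := ‖a‖) (p := 0) (norm_nonneg a) fun k => by simp

theorem Rapid.zero : ∀ n, Rapid I n fun _ _ => 0
  | 0 => ⟨fun _ => continuousOn_const, fun _ => ⟨0, fun _ _ _ => by simp⟩⟩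
  | n + 1 => ⟨⟨fun _ => continuousOn_const, fun _ => ⟨0, fun _ _ _ => by simp⟩⟩, _,
      fun _ _ _ => hasDerivAt_const _ _, Rapid.zero n⟩

theorem Rapid.sum {κ : Type*} (s : Finset κ) {c : κ → ℝ → Lat → ℂ}
    (h : ∀ a ∈ s, Rapid I n (c a)) : Rapid I n fun t k => ∑ a ∈ s, c a t k := by
  classical
  induction s using Finset.induction_on with
  | empty => simpa using Rapid.zero n
  | insert a s ha ih =>
    simp_rw [Finset.sum_insert ha]
    exact (h a (Finset.mem_insert_self a s)).add
      (ih fun b hb => h b (Finset.mem_insert_of_mem hb))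

theorem hasDerivAt_cconv {α β : ℝ} {c d c' d' : ℝ → Lat → ℂ} (hc : Decay (Set.Ioo α β) c)
    (hd : Decay (Set.Ioo α β) d) (hc' : Decay (Set.Ioo α β) c') (hd' : Decay (Set.Ioo α β) d')
    (h1 : ∀ k, ∀ t ∈ Set.Ioo α β, HasDerivAt (fun t => c t k) (c' t k) t)
    (h2 : ∀ k, ∀ t ∈ Set.Ioo α β, HasDerivAt (fun t => d t k) (d' t k) t) (k : Lat) {t : ℝ}
    (ht : t ∈ Set.Ioo α β) :
    HasDerivAt (fun t => cconv (c t) (d t) k)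
      (cconv (c' t) (d t) k + cconv (c t) (d' t) k) t := by
  obtain ⟨C, hC0, hC⟩ := hc.exists_sw_zero
  obtain ⟨C', hC0', hC'⟩ := hc'.exists_sw_zero
  obtain ⟨D, hD0, hD⟩ := hd.exists_bd
  obtain ⟨D', hD0', hD'⟩ := hd'.exists_bd
  have h := hasDerivAt_tsum_of_isPreconnected (u := fun l => C' * sw l * D + C * sw l * D')
    (g := fun l t => c t l * d t (k - l))
    (g' := fun l t => c' t l * d t (k - l) + c t l * d' t (k - l))
    (((summable_sw.mul_left C').mul_right D).add ((summable_sw.mul_left C).mul_right D'))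
    isOpen_Ioo isPreconnected_Ioo (fun l t ht => (h1 l t ht).mul (h2 (k - l) t ht))
    (fun l t ht => by
      refine (norm_add_le _ _).trans ?_
      rw [norm_mul, norm_mul]
      exact add_le_add
        (mul_le_mul (hC' t ht l) (hD t ht _) (norm_nonneg _) (mul_nonneg hC0' (sw_pos l).le))
        (mul_le_mul (hC t ht l) (hD' t ht _) (norm_nonneg _) (mul_nonneg hC0 (sw_pos l).le)))
    ht (hc.summable_conv hd ht k) ht
  rw [cconv, cconv, ← (hc'.summable_conv hd ht k).tsum_add (hc.summable_conv hd' ht k)]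
  exact h

theorem Rapid.cconv {α β : ℝ} : ∀ {n : ℕ} {c d : ℝ → Lat → ℂ}, Rapid (Set.Ioo α β) n c →
    Rapid (Set.Ioo α β) n d → Rapid (Set.Ioo α β) n fun t => cconv (c t) (d t)
  | 0, _, _, hc, hd => Decay.cconv hc hd
  | _ + 1, _, _, ⟨hc, c', h1, h2⟩, ⟨hd, d', h3, h4⟩ =>
    ⟨hc.cconv hd, _, fun k t ht => hasDerivAt_cconv hc hd h2.decay h4.decay h1 h3 k ht,
      (h2.cconv (Rapid.of_succ ⟨hd, d', h3, h4⟩)).add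
        ((Rapid.of_succ ⟨hc, c', h1, h2⟩).cconv h4)⟩

end LatticeSums

section FourierSeries

/-- The characters of the torus. -/
def chi (k : Lat) (x : Spc 2) : ℂ := Complex.exp (2 * π * Complex.I * ∑ i, (k i : ℂ) * (x i : ℂ))

theorem norm_chi (k : Lat) (x : Spc 2) : ‖chi k x‖ = 1 := by
  have : (2 * π * Complex.I * ∑ i, (k i : ℂ) * (x i : ℂ) : ℂ)
      = ((2 * π * ∑ i, (k i : ℝ) * x i : ℝ) : ℂ) * Complex.I := by
    push_cast; ring
  rw [chi, this, Complex.norm_exp_ofReal_mul_I]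

theorem chi_add (k l : Lat) (x : Spc 2) : chi (k + l) x = chi k x * chi l x := by
  rw [chi, chi, chi, ← Complex.exp_add]
  congr 1
  simp only [Pi.add_apply, Int.cast_add, add_mul, Finset.sum_add_distrib]
  ring

theorem chi_zero (x : Spc 2) : chi 0 x = 1 := by simp [chi]

theorem chi_neg (k : Lat) (x : Spc 2) : chi (-k) x = (starRingEnd ℂ) (chi k x) := by
  rw [chi, chi, ← Complex.exp_conj]
  congr 1
  simp only [Pi.neg_apply, Int.cast_neg, neg_mul, Finset.sum_neg_distrib, map_mul, map_sum,
    map_ofNat, Complex.conj_ofReal, Complex.conj_I, map_intCast]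
  ring

theorem chi_per (k : Lat) : Per (chi k) := by
  intro x m
  rw [chi, chi, Complex.exp_eq_exp_iff_exists_int]
  refine ⟨∑ i, k i * m i, ?_⟩
  push_cast
  simp only [mul_add, Finset.sum_add_distrib]
  ring

theorem hasFDerivAt_chi (k : Lat) (x : Spc 2) :
    HasFDerivAt (chi k) (∑ i, (ContinuousLinearMap.proj i : Spc 2 →L[ℝ] ℝ).smulRight
      (2 * π * Complex.I * (k i : ℂ) * chi k x)) x := by
  have h1 : HasFDerivAt (fun x : Spc 2 => 2 * π * Complex.I * ∑ i, (k i : ℂ) * (x i : ℂ))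
      (∑ i, (ContinuousLinearMap.proj i : Spc 2 →L[ℝ] ℝ).smulRight
        (2 * π * Complex.I * (k i : ℂ))) x := by
    have : (fun x : Spc 2 => 2 * π * Complex.I * ∑ i, (k i : ℂ) * (x i : ℂ))
        = ⇑(∑ i, (ContinuousLinearMap.proj i : Spc 2 →L[ℝ] ℝ).smulRight
        (2 * π * Complex.I * (k i : ℂ))) := by
      funext y
      simp only [_root_.sum_apply, ContinuousLinearMap.smulRight_apply,
        ContinuousLinearMap.proj_apply, Complex.real_smul, Finset.mul_sum]
      exact Finset.sum_congr rfl fun i _ => by ring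
    rw [this]
    exact ContinuousLinearMap.hasFDerivAt _
  have h2 := h1.cexp
  refine h2.congr_fderiv ?_
  ext v
  simp only [_root_.smul_apply, _root_.sum_apply,
    ContinuousLinearMap.smulRight_apply, Finset.smul_sum, smul_eq_mul, Complex.real_smul]
  exact Finset.sum_congr rfl fun i _ => by rw [chi]; ring

/-- Sum of a Fourier series. -/
def ser (c : Lat → ℂ) (x : Spc 2) : ℂ := ∑' k, c k * chi k x

/-- Derivative of Fourier coefficients. -/
def dcoef (i : Fin 2) (c : Lat → ℂ) (k : Lat) : ℂ := 2 * π * Complex.I * (k i : ℂ) * c k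

theorem norm_dcoef_fac (i : Fin 2) (k : Lat) :
    ‖(2 * π * Complex.I * (k i : ℂ) : ℂ)‖ ≤ 2 * π * (1 + ‖k‖) ^ 1 := by
  have h1 : ‖(k i : ℂ)‖ ≤ ‖k‖ := by
    have := norm_le_pi_norm k i
    rwa [Int.norm_eq_abs, ← Real.norm_eq_abs, ← Complex.norm_real, Complex.ofReal_intCast] at this
  simp only [norm_mul, Complex.norm_I, Complex.norm_real, Complex.norm_ofNat, mul_one, pow_one,
    Real.norm_of_nonneg pi_pos.le]
  gcongr
  linarith

theorem Rapid.dcoef {I : Set ℝ} {n : ℕ} {c : ℝ → Lat → ℂ} (i : Fin 2) (h : Rapid I n c) :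
    Rapid I n fun t => dcoef i (c t) :=
  h.mult (by positivity) (norm_dcoef_fac i)

theorem Decay.dcoef {I : Set ℝ} {c : ℝ → Lat → ℂ} (i : Fin 2) (h : Decay I c) :
    Decay I fun t => dcoef i (c t) :=
  h.mult (by positivity) (norm_dcoef_fac i)

theorem summable_ser {c : Lat → ℂ} (hc : Summable fun k => ‖c k‖) (x : Spc 2) :
    Summable fun k => c k * chi k x :=
  Summable.of_norm (by simpa [norm_chi] using hc)

theorem ser_per (c : Lat → ℂ) : Per (ser c) := fun x m =>
  tsum_congr fun k => by rw [chi_per]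

/-- The joint derivative of a Fourier series with time-dependent coefficients. -/
def serD (c c' : Lat → ℂ) (x : Spc 2) : ℝ × Spc 2 →L[ℝ] ℂ :=
  (ContinuousLinearMap.fst ℝ ℝ (Spc 2)).smulRight (ser c' x)
    + ∑ i, ((ContinuousLinearMap.proj i : Spc 2 →L[ℝ] ℝ).comp
        (ContinuousLinearMap.snd ℝ ℝ (Spc 2))).smulRight (ser (dcoef i c) x)

variable {α β : ℝ} {c c' : ℝ → Lat → ℂ}

theorem hasFDerivAt_ser (hc : Decay (Set.Ioo α β) c) (hc' : Decay (Set.Ioo α β) c')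
    (h : ∀ k, ∀ t ∈ Set.Ioo α β, HasDerivAt (fun t => c t k) (c' t k) t)
    {q : ℝ × Spc 2} (hq : q ∈ slab α β) :
    HasFDerivAt (fun q : ℝ × Spc 2 => ser (c q.1) q.2) (serD (c q.1) (c' q.1) q.2) q := by
  set L : Lat → ℝ × Spc 2 → ℝ × Spc 2 →L[ℝ] ℂ := fun k q =>
    (ContinuousLinearMap.fst ℝ ℝ (Spc 2)).smulRight (c' q.1 k * chi k q.2)
    + ∑ i, ((ContinuousLinearMap.proj i : Spc 2 →L[ℝ] ℝ).comp
        (ContinuousLinearMap.snd ℝ ℝ (Spc 2))).smulRight (dcoef i (c q.1) k * chi k q.2) with hL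
  have hterm : ∀ k, ∀ q ∈ slab α β,
      HasFDerivAt (fun q : ℝ × Spc 2 => c q.1 k * chi k q.2) (L k q) q := fun k q hq => by
    have h1 : HasFDerivAt (fun q : ℝ × Spc 2 => c q.1 k)
        ((ContinuousLinearMap.fst ℝ ℝ (Spc 2)).smulRight (c' q.1 k)) q := by
      refine ((h k q.1 (mem_slab.1 hq)).hasFDerivAt.comp q hasFDerivAt_fst).congr_fderiv ?_
      ext v <;> simp
    have h2 : HasFDerivAt (fun q : ℝ × Spc 2 => chi k q.2) _ q :=
      (hasFDerivAt_chi k q.2).comp q hasFDerivAt_snd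
    refine (h1.mul h2).congr_fderiv ?_
    ext v <;> simp [hL, dcoef] <;> ring
  obtain ⟨C', hC0', hC'⟩ := hc'.exists_sw_zero
  choose D hD0 hD using fun i => (hc.dcoef i).exists_sw_zero
  have hbd : ∀ k, ∀ q ∈ slab α β, ‖L k q‖ ≤ C' * sw k + ∑ i, D i * sw k := fun k q hq => by
    have hq' := mem_slab.1 hq
    refine (norm_add_le _ _).trans (add_le_add ?_ ((norm_sum_le _ _).trans
      (Finset.sum_le_sum fun i _ => ?_)))
    · rw [ContinuousLinearMap.norm_smulRight_apply, norm_mul, norm_chi, mul_one]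
      calc _ ≤ 1 * ‖c' q.1 k‖ := by gcongr; exact ContinuousLinearMap.norm_fst_le ..
        _ ≤ _ := by rw [one_mul]; exact hC' _ hq' k
    · rw [ContinuousLinearMap.norm_smulRight_apply, norm_mul, norm_chi, mul_one]
      have h1 : ‖(ContinuousLinearMap.proj i : Spc 2 →L[ℝ] ℝ).comp
          (ContinuousLinearMap.snd ℝ ℝ (Spc 2))‖ ≤ 1 :=
        ContinuousLinearMap.opNorm_le_bound _ zero_le_one fun v => by
          rw [one_mul]
          exact (norm_le_pi_norm v.2 i).trans (norm_snd_le v)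
      calc _ ≤ 1 * ‖dcoef i (c q.1) k‖ := by gcongr
        _ ≤ _ := by rw [one_mul]; exact hD i _ hq' k
  have hsu : Summable fun k => C' * sw k + ∑ i, D i * sw k :=
    (summable_sw.mul_left C').add (summable_sum fun i _ => summable_sw.mul_left (D i))
  have hconv : IsPreconnected (slab α β) := by
    have : slab α β = Set.Ioo α β ×ˢ Set.univ := by
      ext q; simp [mem_slab]
    rw [this]
    exact isPreconnected_Ioo.prod isPreconnected_univ
  have hq' := mem_slab.1 hq
  have key := hasFDerivAt_tsum_of_isPreconnected hsu (isOpen_slab _ _) hconv hterm hbd hq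
    (summable_ser (hc.summable hq') q.2) hq
  refine key.congr_fderiv ?_
  have hs1 : HasSum (fun k => L k q) (serD (c q.1) (c' q.1) q.2) := by
    refine HasSum.add ?_ (hasSum_sum fun i _ => ?_)
    · exact (summable_ser (hc'.summable hq') q.2).hasSum.mapL
        (ContinuousLinearMap.smulRightL ℝ (ℝ × Spc 2) ℂ (ContinuousLinearMap.fst ℝ ℝ (Spc 2)))
    · exact (summable_ser ((hc.dcoef i).summable hq') q.2).hasSum.mapL
        (ContinuousLinearMap.smulRightL ℝ (ℝ × Spc 2) ℂ
          ((ContinuousLinearMap.proj i : Spc 2 →L[ℝ] ℝ).comp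
            (ContinuousLinearMap.snd ℝ ℝ (Spc 2))))
  exact hs1.tsum_eq

theorem contDiffOn_ser : ∀ {n : ℕ} {c : ℝ → Lat → ℂ}, Rapid (Set.Ioo α β) n c →
    ContDiffOn ℝ n (fun q : ℝ × Spc 2 => ser (c q.1) q.2) (slab α β)
  | 0, c, hc => by
    obtain ⟨C, -, hC⟩ := Decay.exists_sw_zero hc
    refine contDiffOn_zero.2 (continuousOn_tsum (u := fun k => C * sw k) (fun k => ?_)
      (summable_sw.mul_left C) fun k q hq => ?_)
    · refine ((hc.cont k).comp continuousOn_fst fun q hq => mem_slab.1 hq).mul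
        (Continuous.continuousOn ?_)
      exact (continuous_iff_continuousAt.2 fun x => (hasFDerivAt_chi k x).continuousAt).comp
        continuous_snd
    · rw [norm_mul, norm_chi, mul_one]
      exact hC _ (mem_slab.1 hq) k
  | n + 1, c, ⟨hc, c', h1, h2⟩ => by
    have hd := fun q hq => hasFDerivAt_ser hc h2.decay h1 (q := q) hq
    rw [Nat.cast_add, Nat.cast_one, contDiffOn_succ_iff_fderiv_of_isOpen (isOpen_slab _ _)]
    refine ⟨fun q hq => (hd q hq).differentiableAt.differentiableWithinAt, by simp, ?_⟩
    refine ContDiffOn.congr ?_ fun q hq => (hd q hq).fderiv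
    refine ContDiffOn.add ?_ (ContDiffOn.sum fun i _ => ?_)
    · exact (ContinuousLinearMap.smulRightL ℝ (ℝ × Spc 2) ℂ
        (ContinuousLinearMap.fst ℝ ℝ (Spc 2))).contDiff.comp_contDiffOn (contDiffOn_ser h2)
    · exact (ContinuousLinearMap.smulRightL ℝ (ℝ × Spc 2) ℂ
          ((ContinuousLinearMap.proj i : Spc 2 →L[ℝ] ℝ).comp
            (ContinuousLinearMap.snd ℝ ℝ (Spc 2)))).contDiff.comp_contDiffOn
        (contDiffOn_ser ((Rapid.of_succ ⟨hc, c', h1, h2⟩).dcoef i))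

theorem hasSum_shear {f : Lat × Lat → ℂ} {a : ℂ} (h : HasSum f a) :
    HasSum (fun y : Lat × Lat => f (y.2, y.1 - y.2)) a := by
  let e : Lat × Lat ≃ Lat × Lat :=
    { toFun := fun y => (y.2, y.1 - y.2)
      invFun := fun y => (y.1 + y.2, y.1)
      left_inv := fun y => by simp
      right_inv := fun y => by simp }
  exact e.hasSum_iff.2 h

theorem ser_mul_ser {c d : Lat → ℂ} (hc : Summable fun k => ‖c k‖) (hd : Summable fun k => ‖d k‖)
    (x : Spc 2) : ser c x * ser d x = ser (cconv c d) x := by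
  have hc' : Summable fun k => ‖c k * chi k x‖ := by simpa [norm_chi] using hc
  have hd' : Summable fun k => ‖d k * chi k x‖ := by simpa [norm_chi] using hd
  have h0 : Summable fun y : Lat × Lat => c y.1 * chi y.1 x * (d y.2 * chi y.2 x) :=
    summable_mul_of_summable_norm (f := fun k => c k * chi k x) (g := fun k => d k * chi k x) hc' hd'
  have h1 : HasSum (fun y : Lat × Lat => c y.1 * chi y.1 x * (d y.2 * chi y.2 x))
      (ser c x * ser d x) := by
    have h := tsum_mul_tsum_of_summable_norm (f := fun k => c k * chi k x)
      (g := fun k => d k * chi k x) hc' hd'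
    rw [ser, ser, h]
    exact h0.hasSum
  have h2 : HasSum (fun y : Lat × Lat => c y.2 * chi y.2 x * (d (y.1 - y.2) * chi (y.1 - y.2) x))
      (ser c x * ser d x) := hasSum_shear h1
  have h3 : HasSum (fun k : Lat => ∑' l, c l * chi l x * (d (k - l) * chi (k - l) x))
      (ser c x * ser d x) :=
    h2.prod_fiberwise fun k => (h2.summable.prod_factor k).hasSum
  have h4 : ∀ k : Lat, ∑' l, c l * chi l x * (d (k - l) * chi (k - l) x)
      = cconv c d k * chi k x := fun k => by
    rw [cconv, ← tsum_mul_right]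
    refine tsum_congr fun l => ?_
    have : chi k x = chi l x * chi (k - l) x := by rw [← chi_add, add_sub_cancel]
    rw [this]; ring
  simp only [h4] at h3
  exact h3.tsum_eq.symm

theorem ser_add {c d : Lat → ℂ} (hc : Summable fun k => ‖c k‖) (hd : Summable fun k => ‖d k‖)
    (x : Spc 2) : ser (fun k => c k + d k) x = ser c x + ser d x := by
  rw [ser, ser, ser, ← (summable_ser hc x).tsum_add (summable_ser hd x)]
  exact tsum_congr fun k => add_mul _ _ _

theorem ser_mul (a : ℂ) (c : Lat → ℂ) (x : Spc 2) : ser (fun k => a * c k) x = a * ser c x := by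
  rw [ser, ser, ← tsum_mul_left]
  exact tsum_congr fun k => mul_assoc _ _ _

theorem ser_real {c : Lat → ℂ} (hc : ∀ k, c (-k) = (starRingEnd ℂ) (c k)) (x : Spc 2) :
    ((ser c x).re : ℂ) = ser c x := by
  refine Complex.conj_eq_iff_re.1 ?_
  rw [ser, Complex.conj_tsum, ← (Equiv.neg Lat).tsum_eq]
  refine tsum_congr fun k => ?_
  rw [Equiv.neg_apply, hc, chi_neg, map_mul, Complex.conj_conj, Complex.conj_conj]

end FourierSeries

section SeriesFields

open scoped ComplexConjugate

variable {α β : ℝ}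

/-- The real field with given Fourier coefficients. -/
def serField (c : ℝ → Lat → ℂ) (h : ∀ n, Rapid (Set.Ioo α β) n c) : Fd α β :=
  ⟨fun q => (ser (c q.1) q.2).re,
    Complex.reCLM.contDiff.comp_contDiffOn (contDiffOn_infty.2 fun n => contDiffOn_ser (h n)),
    fun t _ x k => congrArg Complex.re (ser_per (c t) x k)⟩

theorem serField_apply (c : ℝ → Lat → ℂ) (h : ∀ n, Rapid (Set.Ioo α β) n c) (q : ℝ × Spc 2) :
    (serField c h).1 q = (ser (c q.1) q.2).re := rfl

theorem Dd_serField {c c' : ℝ → Lat → ℂ} (h : ∀ n, Rapid (Set.Ioo α β) n c)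
    (hc' : Decay (Set.Ioo α β) c')
    (hd : ∀ k, ∀ t ∈ Set.Ioo α β, HasDerivAt (fun t => c t k) (c' t k) t) (e : ℝ × Spc 2)
    {q : ℝ × Spc 2} (hq : q ∈ slab α β) :
    (Dd e (serField c h)).1 q = (serD (c q.1) (c' q.1) q.2 e).re := by
  rw [Dd_apply _ _ hq]
  have h1 := Complex.reCLM.hasFDerivAt.comp q (hasFDerivAt_ser (h 0).decay hc' hd hq)
  rw [show (serField c h).1 = Complex.reCLM ∘ fun q : ℝ × Spc 2 => ser (c q.1) q.2 from rfl,
    h1.fderiv]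
  rfl

theorem Dt_serField {c c' : ℝ → Lat → ℂ} (h : ∀ n, Rapid (Set.Ioo α β) n c)
    (hc' : Decay (Set.Ioo α β) c')
    (hd : ∀ k, ∀ t ∈ Set.Ioo α β, HasDerivAt (fun t => c t k) (c' t k) t)
    {q : ℝ × Spc 2} (hq : q ∈ slab α β) :
    (Dt (serField c h)).1 q = (ser (c' q.1) q.2).re := by
  rw [Dd_serField h hc' hd _ hq]
  simp [serD]

theorem Dx_serField {c : ℝ → Lat → ℂ} (h : ∀ n, Rapid (Set.Ioo α β) n c)
    (i : Fin 2) {q : ℝ × Spc 2} (hq : q ∈ slab α β) :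
    (Dx i (serField c h)).1 q = (ser (dcoef i (c q.1)) q.2).re := by
  obtain ⟨-, c', hd, hc'⟩ := h 1
  rw [Dd_serField h hc'.decay hd _ hq]
  fin_cases i <;> simp [serD]

theorem Dx_serField_eq (c : ℝ → Lat → ℂ) (h : ∀ n, Rapid (Set.Ioo α β) n c)
    (i : Fin 2) {q : ℝ × Spc 2} (hq : q ∈ slab α β) :
    (Dx i (serField c h)).1 q = (serField (fun t => dcoef i (c t)) fun n => (h n).dcoef i).1 q :=
  Dx_serField h i hq

end SeriesFields

namespace QuadSys

open scoped ComplexConjugate lp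

variable {ι : Type} [Fintype ι] (Q : QuadSys ι) {α β : ℝ}

/-- The right-hand side of the system on Fourier coefficients. -/
def rhs (w : ι → Lat → ℂ) (a : ι) (k : Lat) : ℂ :=
  (∑ b, ∑ j, (Q.B j a b : ℂ) * dcoef j (w b) k) + (∑ b, (Q.M a b : ℂ) * w b k)
    + ∑ b, ∑ c, (Q.q a b c : ℂ) * cconv (w b) (w c) k

theorem rapid_rhs {n : ℕ} {w : ι → ℝ → Lat → ℂ} (h : ∀ a, Rapid (Set.Ioo α β) n (w a)) (a : ι) :
    Rapid (Set.Ioo α β) n fun t => Q.rhs (fun b => w b t) a := by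
  refine Rapid.add (Rapid.add ?_ ?_) ?_
  · exact Rapid.sum _ fun b _ => Rapid.sum _ fun j _ => ((h b).dcoef j).const_mul _
  · exact Rapid.sum _ fun b _ => (h b).const_mul _
  · exact Rapid.sum _ fun b _ => Rapid.sum _ fun c _ => ((h b).cconv (h c)).const_mul _

/-- Rapidly decaying Fourier coefficients of a real solution. -/
structure CoefSol (α β : ℝ) (w : ι → ℝ → Lat → ℂ) : Prop where
  decay : ∀ a, Decay (Set.Ioo α β) (w a)
  deriv : ∀ a k, ∀ t ∈ Set.Ioo α β,
    HasDerivAt (fun t => w a t k) (Q.rhs (fun b => w b t) a k) t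
  real : ∀ a, ∀ t ∈ Set.Ioo α β, ∀ k, w a t (-k) = conj (w a t k)

variable {Q} in
theorem CoefSol.rapid {w : ι → ℝ → Lat → ℂ} (h : Q.CoefSol α β w) :
    ∀ n a, Rapid (Set.Ioo α β) n (w a)
  | 0, a => h.decay a
  | n + 1, a => ⟨h.decay a, _, h.deriv a, Q.rapid_rhs (h.rapid n) a⟩

/-- The fields `W` solve the system on the slab. -/
def Solves (W : ι → Fd α β) : Prop :=
  ∀ a, ∀ q ∈ slab α β, (Dt (W a)).1 q = (∑ b, ∑ j, Q.B j a b * (Dx j (W b)).1 q)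
    + (∑ b, Q.M a b * (W b).1 q) + ∑ b, ∑ c, Q.q a b c * ((W b).1 q * (W c).1 q)

variable {Q} in
/-- The fields of a coefficient solution. -/
def CoefSol.field {w : ι → ℝ → Lat → ℂ} (h : Q.CoefSol α β w) (a : ι) : Fd α β :=
  serField (w a) fun n => h.rapid n a

variable {Q} in
theorem CoefSol.field_apply {w : ι → ℝ → Lat → ℂ} (h : Q.CoefSol α β w) (a : ι)
    {q : ℝ × Spc 2} (hq : q ∈ slab α β) : (((h.field a).1 q : ℝ) : ℂ) = ser (w a q.1) q.2 :=
  ser_real (h.real a q.1 (mem_slab.1 hq)) q.2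

theorem ser_sum {κ : Type*} (s : Finset κ) {c : κ → Lat → ℂ}
    (h : ∀ a ∈ s, Summable fun k => ‖c a k‖) (x : Spc 2) :
    ser (fun k => ∑ a ∈ s, c a k) x = ∑ a ∈ s, ser (c a) x := by
  simp only [ser, Finset.sum_mul]
  exact Summable.tsum_finsetSum fun a ha => summable_ser (h a ha) x

variable {Q} in
theorem CoefSol.solves {w : ι → ℝ → Lat → ℂ} (h : Q.CoefSol α β w) : Q.Solves h.field := by
  intro a q hq
  have ht := mem_slab.1 hq
  have hr := h.rapid 0
  have hS : ∀ {c : ℝ → Lat → ℂ}, Rapid (Set.Ioo α β) 0 c → Summable fun k => ‖c q.1 k‖ :=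
    fun hc => hc.decay.summable ht
  have hD : ∀ j b, (Dx j (h.field b)).1 q = (ser (dcoef j (w b q.1)) q.2).re :=
    fun j b => Dx_serField_eq _ _ j hq
  have e1 : (Dt (h.field a)).1 q = (ser (Q.rhs (fun b => w b q.1) a) q.2).re :=
    Dt_serField _ (Q.rapid_rhs hr a).decay (h.deriv a) hq
  have r1 : ∀ b j, Rapid (Set.Ioo α β) 0 fun t k => (Q.B j a b : ℂ) * dcoef j (w b t) k :=
    fun b j => ((hr b).dcoef j).const_mul _
  have r2 : ∀ b, Rapid (Set.Ioo α β) 0 fun t k => (Q.M a b : ℂ) * w b t k :=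
    fun b => (hr b).const_mul _
  have r3 : ∀ b c, Rapid (Set.Ioo α β) 0 fun t k => (Q.q a b c : ℂ) * cconv (w b t) (w c t) k :=
    fun b c => ((hr b).cconv (hr c)).const_mul _
  have s1 : ∀ b, Rapid (Set.Ioo α β) 0 fun t k => ∑ j, (Q.B j a b : ℂ) * dcoef j (w b t) k :=
    fun b => Rapid.sum _ fun j _ => r1 b j
  have s3 : ∀ b, Rapid (Set.Ioo α β) 0
      fun t k => ∑ c, (Q.q a b c : ℂ) * cconv (w b t) (w c t) k :=
    fun b => Rapid.sum _ fun c _ => r3 b c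
  have t1 := Rapid.sum Finset.univ fun b _ => s1 b
  have t2 := Rapid.sum Finset.univ fun b _ => r2 b
  have t3 := Rapid.sum Finset.univ fun b _ => s3 b
  have e2 : ser (Q.rhs (fun b => w b q.1) a) q.2
      = (∑ b, ∑ j, (Q.B j a b : ℂ) * ser (dcoef j (w b q.1)) q.2)
        + (∑ b, (Q.M a b : ℂ) * ser (w b q.1) q.2)
        + ∑ b, ∑ c, (Q.q a b c : ℂ) * (ser (w b q.1) q.2 * ser (w c q.1) q.2) := by
    change ser (fun k => ((∑ b, ∑ j, (Q.B j a b : ℂ) * dcoef j (w b q.1) k)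
      + (∑ b, (Q.M a b : ℂ) * w b q.1 k))
      + ∑ b, ∑ c, (Q.q a b c : ℂ) * cconv (w b q.1) (w c q.1) k) q.2 = _
    rw [ser_add (hS (t1.add t2)) (hS t3), ser_add (hS t1) (hS t2),
      ser_sum _ fun b _ => hS (s1 b), ser_sum _ fun b _ => hS (r2 b),
      ser_sum _ fun b _ => hS (s3 b)]
    congr 1
    · congr 1
      · refine Finset.sum_congr rfl fun b _ => ?_
        rw [ser_sum _ fun j _ => hS (r1 b j)]
        exact Finset.sum_congr rfl fun j _ => ser_mul _ _ _
      · exact Finset.sum_congr rfl fun b _ => ser_mul _ _ _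
    · refine Finset.sum_congr rfl fun b _ => ?_
      rw [ser_sum _ fun c _ => hS (r3 b c)]
      refine Finset.sum_congr rfl fun c _ => ?_
      rw [ser_mul, ser_mul_ser (hS (hr b)) (hS (hr c))]
  rw [e1, e2]
  simp only [hD, ← h.field_apply _ hq, Complex.add_re, Complex.re_sum, Complex.re_ofReal_mul,
    ← Complex.ofReal_mul, Complex.ofReal_re]

variable [DecidableEq ι]

theorem coefSol_of_flow {R T : ℝ} (hR : 0 < R) (hT : 0 ≤ T) {Z : ℝ → Sq ι}
    (hZ : ∀ t ∈ Set.Ioo (-1) (T + 1), HasDerivAt Z (truncField R Q.NI t (Z t)) t)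
    (h0 : ∀ s : ℕ, Summable fun k => (1 + ‖k‖) ^ s * ‖Z 0 k‖) (h0' : conjS (Z 0) = Z 0)
    (hαβ : Set.Ioo α β ⊆ Set.Ioo (-1) (T + 1)) (hlt : ∀ t ∈ Set.Ioo α β, ‖Z t‖ < R) :
    Q.CoefSol α β fun a t k => Q.S t (Z t) k a := by
  have hder : ∀ a k, ∀ t ∈ Set.Ioo α β, HasDerivAt (fun t => Q.S t (Z t) k a)
      (Q.rhs (fun b k => Q.S t (Z t) k b) a k) t := by
    intro a k t ht
    have h1 : HasDerivAt Z (Q.NI t (Z t)) t := by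
      have := hZ t (hαβ ht)
      rwa [truncField, cut_eq_one hR (hlt t ht).le, one_smul] at this
    have h2 : HasDerivAt (fun t => Z t k) (Q.NI t (Z t) k) t :=
      ((lp.evalCLM ℝ (fun _ : Lat => EuclideanSpace ℂ ι) 1 k).hasFDerivAt.comp_hasDerivAt t h1)
    have h3 := Q.hasDerivAt_G_apply k h2
    have h4 : Q.G k t (Q.NI t (Z t) k) = Q.N (Q.S t (Z t)) k := by
      exact congrArg (fun Y : Sq ι => Y k) (Q.S_S_neg t (Q.N (Q.S t (Z t))))
    rw [h4] at h3
    have h5 := ((EuclideanSpace.proj (𝕜 := ℂ) a).restrictScalars ℝ).hasFDerivAt.comp_hasDerivAt t h3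
    refine h5.congr_deriv ?_
    set w := Q.S t (Z t) with hw
    have h6 : Q.G k t (Z t k) = w k := rfl
    have h7 : ∀ x : EuclideanSpace ℂ ι,
      ((EuclideanSpace.proj (𝕜 := ℂ) a).restrictScalars ℝ) x = x a := fun x => rfl
    have h8 : (∑' l, Q.qV (w l) (w (k - l))) a
        = ∑ b, ∑ c, (Q.q a b c : ℂ) * cconv (fun l => w l b) (fun l => w l c) k := by
      have hs : Summable fun l => Q.qV (w l) (w (k - l)) :=
        (Sq.summable_conv_norm Q.qV w w k).of_norm
      have hsc : ∀ b c, Summable fun l => w l b * w (k - l) c := fun b c => by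
        refine Summable.of_norm_bounded ((Sq.hasSum_norm w).summable.mul_right ‖w‖) fun l => ?_
        rw [norm_mul]
        gcongr
        · exact PiLp.norm_apply_le (w l) b
        · exact (PiLp.norm_apply_le (w (k - l)) c).trans (Sq.norm_apply_le w _)
      have e1 := ((EuclideanSpace.proj (𝕜 := ℂ) a).hasSum hs.hasSum).tsum_eq
      refine e1.symm.trans ?_
      have e2 : ∀ l, EuclideanSpace.proj (𝕜 := ℂ) a (Q.qV (w l) (w (k - l)))
          = ∑ b, ∑ c, (Q.q a b c : ℂ) * (w l b * w (k - l) c) := fun l => by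
        refine (Q.qV_apply _ _ a).trans ?_
        simp only [mul_assoc]
      simp only [e2]
      rw [Summable.tsum_finsetSum fun b _ => summable_sum fun c _ => (hsc b c).mul_left _]
      refine Finset.sum_congr rfl fun b _ => ?_
      rw [Summable.tsum_finsetSum fun c _ => (hsc b c).mul_left _]
      exact Finset.sum_congr rfl fun c _ => tsum_mul_left
    rw [h6, h7, N_apply, PiLp.add_apply, PiLp.add_apply, A_apply, MV_apply, h8, rhs, ← add_assoc]
    congr 2
    refine Finset.sum_congr rfl fun b _ => ?_
    rw [Finset.mul_sum, Finset.sum_mul]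
    exact Finset.sum_congr rfl fun j _ => by rw [dcoef]; ring
  refine ⟨fun a => ⟨fun k t ht => (hder a k t ht).continuousAt.continuousWithinAt, fun s => ?_⟩,
    hder, fun a t ht k => ?_⟩
  · obtain ⟨C, hC⟩ := Q.flow_decay hR hT hZ h0 s
    refine ⟨C, fun t ht k => le_trans ?_ (hC t (hαβ ht) k)⟩
    gcongr
    rw [← Q.norm_G_apply k t (Z t k)]
    exact PiLp.norm_apply_le (Q.S t (Z t) k) a
  · have h1 : conjS (Q.S t (Z t)) = Q.S t (Z t) := by
      rw [conjS_S, Q.flow_real hR hT hZ h0' t (hαβ ht)]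
    have h2 := congrArg (fun Y : Sq ι => Y k a) h1
    have h3 : conj (Q.S t (Z t) (-k) a) = Q.S t (Z t) k a := h2
    rw [← h3, Complex.conj_conj]

end QuadSys

section Parseval

open scoped ComplexConjugate

theorem integral_fderiv_eq_zero (i : Fin 2) {f : Spc 2 → ℂ} (hf : ContDiff ℝ 1 f) (hp : Per f) :
    ∫ x in cube 2, fderiv ℝ f x (Pi.single i 1) = 0 := by
  have hc : Continuous fun x => fderiv ℝ f x (Pi.single i 1) :=
    (hf.continuous_fderiv (by simp)).clm_apply continuous_const
  have hInt0 : IntegrableOn (fun x => fderiv ℝ f x (Pi.single i 1)) (cube 2) :=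
    hc.continuousOn.integrableOn_compact isCompact_cube
  have hd : ∀ x, HasFDerivAt f (fderiv ℝ f x) x := fun x =>
    (hf.differentiable (by simp) x).hasFDerivAt
  have key : ∀ L : ℂ →L[ℝ] ℝ, L (∫ x in cube 2, fderiv ℝ f x (Pi.single i 1)) = 0 := fun L => by
    rw [← L.integral_comp_comm hInt0, ← integral_pd_eq_zero i (f := fun x => L (f x))
      (L.contDiff.comp hf) fun x k => congrArg L (hp x k)]
    refine integral_congr_ae (Filter.Eventually.of_forall fun x => ?_)
    have := L.hasFDerivAt.comp x (hd x)
    change _ = fderiv ℝ (L ∘ f) x _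
    rw [this.fderiv]
    rfl
  exact Complex.ext (key Complex.reCLM) (key Complex.imCLM)

theorem contDiff_chi (k : Lat) : ContDiff ℝ (⊤ : ℕ∞) (chi k) := by
  have h : ∀ i, ContDiff ℝ (⊤ : ℕ∞) fun x : Spc 2 => (x i : ℂ) := fun i =>
    Complex.ofRealCLM.contDiff.comp (contDiff_apply ℝ ℝ i)
  exact (contDiff_const.mul (ContDiff.sum fun i _ => contDiff_const.mul (h i))).cexp

theorem fderiv_chi_apply (k : Lat) (x : Spc 2) (i : Fin 2) :
    fderiv ℝ (chi k) x (Pi.single i 1) = 2 * π * Complex.I * (k i : ℂ) * chi k x := by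
  rw [(hasFDerivAt_chi k x).fderiv]
  fin_cases i <;> simp

theorem integral_chi (k : Lat) : ∫ x in cube 2, chi k x = if k = 0 then 1 else 0 := by
  split_ifs with h
  · subst h
    simp [chi_zero, Measure.real]
  · obtain ⟨i, hi⟩ := Function.ne_iff.1 h
    have := integral_fderiv_eq_zero i ((contDiff_chi k).of_le (by simp)) (chi_per k)
    simp only [fderiv_chi_apply, integral_const_mul] at this
    refine (mul_eq_zero.1 this).resolve_left ?_
    have : (k i : ℂ) ≠ 0 := by exact_mod_cast hi
    simp [this, pi_ne_zero]

theorem integral_ser {c : Lat → ℂ} (hc : Summable fun k => ‖c k‖) :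
    ∫ x in cube 2, ser c x = c 0 := by
  have h := hasSum_integral_of_summable_integral_norm (μ := volume.restrict (cube 2))
    (F := fun k x => c k * chi k x)
    (fun k => (continuous_const.mul (contDiff_chi k).continuous).continuousOn.integrableOn_compact
      isCompact_cube) (by simpa [norm_chi, volume_cube, Measure.real] using hc)
  simp only [integral_const_mul, integral_chi] at h
  refine h.unique ?_
  refine (hasSum_ite_eq (0 : Lat) (c 0)).congr_fun fun k => ?_
  by_cases hk : k = 0 <;> simp [hk]

variable {α β : ℝ}

theorem Int_serField_sq (c : ℝ → Lat → ℂ) (h : ∀ n, Rapid (Set.Ioo α β) n c) {t : ℝ}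
    (ht : t ∈ Set.Ioo α β) (hr : ∀ k, c t (-k) = conj (c t k)) :
    HasSum (fun k => ‖c t k‖ ^ 2) (Int t (serField c h ^ 2)) := by
  have hs := (h 0).decay.summable ht
  have hcc := ((h 0).decay.cconv (h 0).decay).summable ht
  have e1 : ∀ x, ((serField c h ^ 2).1 (t, x) : ℝ) = (ser (cconv (c t) (c t)) x).re := fun x => by
    rw [Fd.ev_pow, serField_apply, ← ser_mul_ser hs hs]
    have := ser_real hr x
    rw [← this]
    simp [sq]
  have e2 : Int t (serField c h ^ 2) = (cconv (c t) (c t) 0).re := by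
    rw [← integral_ser hcc, Int]
    simp only [e1]
    have hi : Integrable (ser (cconv (c t) (c t))) (volume.restrict (cube 2)) := by
      refine ContinuousOn.integrableOn_compact isCompact_cube (Continuous.continuousOn ?_)
      refine continuous_tsum (fun k => continuous_const.mul (contDiff_chi k).continuous) hcc
        fun k x => by rw [norm_mul, norm_chi, mul_one]
    exact Complex.reCLM.integral_comp_comm hi
  have h3 : HasSum (fun l => c t l * c t (0 - l)) (cconv (c t) (c t) 0) :=
    ((h 0).decay.summable_conv (h 0).decay ht 0).hasSum
  have h4 := h3.mapL Complex.reCLM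
  rw [e2]
  refine h4.congr_fun fun k => ?_
  rw [zero_sub, hr, Complex.mul_conj]
  rw [Complex.normSq_eq_norm_sq]
  rfl

theorem tsum_norm_le_sobolev (c : ℝ → Lat → ℂ) (h : ∀ n, Rapid (Set.Ioo α β) n c) {t : ℝ}
    (ht : t ∈ Set.Ioo α β) (hr : ∀ k, c t (-k) = conj (c t k)) :
    ∑' k, ‖c t k‖ ≤ ∑' k, sw k + Int t ((serField c h - (Dx 0 (Dx 0 (serField c h))
      + Dx 1 (Dx 1 (serField c h)))) ^ 2) := by
  set ρ : Lat → ℝ := fun k => 1 + 4 * π ^ 2 * ((k 0 : ℝ) ^ 2 + (k 1 : ℝ) ^ 2) with hρ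
  set d : ℝ → Lat → ℂ := fun t k => c t k + (-1 : ℂ) * (dcoef 0 (dcoef 0 (c t)) k
    + dcoef 1 (dcoef 1 (c t)) k) with hd
  have hd' : ∀ t k, d t k = (ρ k : ℂ) * c t k := fun t k => by
    simp only [hd, hρ, dcoef]
    push_cast
    linear_combination (-4 * π ^ 2 * ((k 0 : ℂ) ^ 2 + (k 1 : ℂ) ^ 2) * c t k) * Complex.I_sq
  have hdR : ∀ n, Rapid (Set.Ioo α β) n d := fun n =>
    (h n).add (((((h n).dcoef 0).dcoef 0).add (((h n).dcoef 1).dcoef 1)).const_mul (-1))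
  have hdr : ∀ k, d t (-k) = conj (d t k) := fun k => by
    rw [hd', hd', hr, map_mul, Complex.conj_ofReal]
    simp [hρ]
  have e1 : Int t ((serField c h - (Dx 0 (Dx 0 (serField c h))
      + Dx 1 (Dx 1 (serField c h)))) ^ 2) = Int t (serField d hdR ^ 2) := by
    refine Int_congr fun x => ?_
    have hq : ((t, x) : ℝ × Spc 2) ∈ slab α β := mem_slab.2 ht
    have hxx : ∀ i, (Dx i (Dx i (serField c h))).1 (t, x)
        = (ser (dcoef i (dcoef i (c t))) x).re := fun i => by
      rw [Dx_congr i ht (g := serField (fun t => dcoef i (c t)) fun n => (h n).dcoef i)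
        (fun y => Dx_serField_eq c h i (mem_slab.2 ht)) x, Dx_serField _ i hq]
    have hs := (h 0).decay.summable ht
    have hs2 := fun i => (((h 0).decay.dcoef i).dcoef i).summable ht
    rw [Fd.ev_pow, Fd.ev_pow, Fd.ev_sub, Fd.ev_add, hxx, hxx, serField_apply, serField_apply]
    have : ser (d t) x = ser (c t) x + (-1) * (ser (dcoef 0 (dcoef 0 (c t))) x
        + ser (dcoef 1 (dcoef 1 (c t))) x) := by
      rw [← ser_add (hs2 0) (hs2 1), ← ser_mul, ← ser_add hs]
      exact (((((h 0).dcoef 0).dcoef 0).add (((h 0).dcoef 1).dcoef 1)).const_mul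
        (-1)).decay.summable ht
    rw [this]
    simp
    ring
  rw [e1]
  have hS := Int_serField_sq d hdR ht hdr
  rw [← hS.tsum_eq, ← summable_sw.tsum_add hS.summable]
  refine ((h 0).decay.summable ht).tsum_le_tsum (fun k => ?_) (summable_sw.add hS.summable)
  rw [hd', norm_mul, Complex.norm_real, mul_pow, Real.norm_eq_abs, sq_abs]
  have hk0 : |(k 0 : ℝ)| ≤ ‖k‖ := by
    have := norm_le_pi_norm k 0
    rwa [Int.norm_eq_abs] at this
  have hρ1 : (1 + ‖k‖) ^ 2 ≤ 2 * ρ k := by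
    have hle : ‖k‖ ^ 2 ≤ (k 0 : ℝ) ^ 2 + (k 1 : ℝ) ^ 2 := by
      have h0 := sq_nonneg (k 0 : ℝ)
      have h1 := sq_nonneg (k 1 : ℝ)
      obtain hh | hh : ‖k‖ = |(k 0 : ℝ)| ∨ ‖k‖ = |(k 1 : ℝ)| := by
        obtain ⟨i, hi⟩ := Finite.exists_max fun i => ‖k i‖
        have : ‖k‖ = ‖k i‖ := le_antisymm
          ((pi_norm_le_iff_of_nonneg (norm_nonneg _)).2 hi) (norm_le_pi_norm k i)
        rw [this, Int.norm_eq_abs]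
        fin_cases i
        · exact Or.inl rfl
        · exact Or.inr rfl
      · rw [hh, sq_abs]; linarith
      · rw [hh, sq_abs]; linarith
    have hpi : (1 : ℝ) ≤ π ^ 2 := by nlinarith [pi_gt_three]
    have := norm_nonneg k
    simp only [hρ]
    nlinarith [sq_nonneg (1 - ‖k‖), sq_nonneg ‖k‖]
  have hsw : 1 ≤ 4 * (sw k * ρ k ^ 2) := by
    have h1 : (0 : ℝ) < 1 + ‖k‖ := by positivity
    have h2 : (1 : ℝ) ≤ 1 + ‖k‖ := by linarith [norm_nonneg k]
    have h4 : (1 + ‖k‖) ^ 3 ≤ 4 * ρ k ^ 2 := by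
      have : (1 + ‖k‖) ^ 3 ≤ ((1 + ‖k‖) ^ 2) ^ 2 := by
        rw [← pow_mul]; exact pow_le_pow_right₀ h2 (by norm_num)
      have h5 : ((1 + ‖k‖) ^ 2) ^ 2 ≤ (2 * ρ k) ^ 2 := by gcongr
      nlinarith
    have : sw k * (1 + ‖k‖) ^ 3 = 1 := inv_mul_cancel₀ (by positivity)
    nlinarith [sw_pos k]
  have hs := sw_pos k
  set n := ‖c t k‖
  have hn : 0 ≤ n := norm_nonneg _
  by_contra! hcon
  have h2 : (sw k + ρ k ^ 2 * n ^ 2) * (4 * sw k) < n * (4 * sw k) := by gcongr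
  nlinarith [sq_nonneg (2 * sw k - n), mul_le_mul_of_nonneg_right hsw (sq_nonneg n)]

end Parseval

section Coefficients

open scoped ComplexConjugate

variable {a b : ℝ}

/-- Fourier coefficients of a function on the unit square. -/
def fcoef (f : Spc 2 → ℝ) (k : Lat) : ℂ := ∫ x in cube 2, (f x : ℂ) * chi (-k) x

theorem fcoef_neg (f : Spc 2 → ℝ) (k : Lat) : fcoef f (-k) = conj (fcoef f k) := by
  rw [fcoef, fcoef, ← integral_conj]
  refine integral_congr_ae (Filter.Eventually.of_forall fun x => ?_)
  simp only [map_mul, Complex.conj_ofReal, chi_neg]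

theorem fcoef_pd (i : Fin 2) {f : Spc 2 → ℝ} (hf : ContDiff ℝ 1 f) (hp : Per f) (k : Lat) :
    fcoef (pd i f) k = 2 * π * Complex.I * (k i : ℂ) * fcoef f k := by
  have hfc : ContDiff ℝ 1 fun x => (f x : ℂ) := Complex.ofRealCLM.contDiff.comp hf
  have hχ : ContDiff ℝ 1 (chi (-k)) := (contDiff_chi (-k)).of_le (by simp)
  have h := integral_fderiv_eq_zero i (hfc.mul hχ) fun x m => by
    rw [hp x m, chi_per (-k) x m]
  have e : ∀ x, fderiv ℝ (fun x => (f x : ℂ) * chi (-k) x) x (Pi.single i 1)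
      = (pd i f x : ℂ) * chi (-k) x
        - 2 * π * Complex.I * (k i : ℂ) * ((f x : ℂ) * chi (-k) x) := fun x => by
    have h1 : HasFDerivAt (fun x => (f x : ℂ)) (Complex.ofRealCLM.comp (fderiv ℝ f x)) x :=
      Complex.ofRealCLM.hasFDerivAt.comp x (hf.differentiable (by simp) x).hasFDerivAt
    have h2 : HasFDerivAt (chi (-k)) (fderiv ℝ (chi (-k)) x) x :=
      (hχ.differentiable (by simp) x).hasFDerivAt
    have h3 : HasFDerivAt (fun x => (f x : ℂ) * chi (-k) x) _ x := h1.mul h2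
    rw [h3.fderiv]
    simp only [_root_.add_apply, _root_.smul_apply, fderiv_chi_apply,
      ContinuousLinearMap.comp_apply, smul_eq_mul, Pi.neg_apply, Int.cast_neg,
      Complex.ofRealCLM_apply, pd]
    ring
  simp only [e] at h
  have hi : ∀ g : Spc 2 → ℝ, Continuous g →
      Integrable (fun x => (g x : ℂ) * chi (-k) x) (volume.restrict (cube 2)) := fun g hg =>
    ((Complex.continuous_ofReal.comp hg).mul
      (contDiff_chi (-k)).continuous).continuousOn.integrableOn_compact isCompact_cube
  have hpd : Continuous (pd i f) := (hf.continuous_fderiv (by simp)).clm_apply continuous_const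
  rw [integral_sub (hi _ hpd) ((hi _ hf.continuous).const_mul _), integral_const_mul,
    sub_eq_zero] at h
  exact h

theorem exists_fcoef_le {t : ℝ} (ht : t ∈ Set.Ioo a b) (s : ℕ) :
    ∀ f : Fd a b, ∃ C, ∀ k, (1 + ‖k‖) ^ s * ‖fcoef (fun x => f.1 (t, x)) k‖ ≤ C := by
  induction s with
  | zero =>
    intro f
    obtain ⟨C, hC⟩ := isCompact_cube.exists_bound_of_continuousOn (f.slice_continuous ht).continuousOn
    refine ⟨C, fun k => ?_⟩
    rw [pow_zero, one_mul, fcoef]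
    refine (norm_setIntegral_le_of_norm_le_const (C := C) (by simp [volume_cube]) fun x hx => ?_).trans
      (by simp [volume_cube, Measure.real])
    rw [norm_mul, norm_chi, mul_one, Complex.norm_real]
    exact hC x hx
  | succ s ih =>
    intro f
    obtain ⟨C, hC⟩ := ih f
    obtain ⟨C0, hC0⟩ := ih (Dx 0 f)
    obtain ⟨C1, hC1⟩ := ih (Dx 1 f)
    refine ⟨C + (C0 + C1), fun k => ?_⟩
    have hd : ∀ i, ‖fcoef (fun x => (Dx i f).1 (t, x)) k‖
        = 2 * π * |(k i : ℝ)| * ‖fcoef (fun x => f.1 (t, x)) k‖ := fun i => by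
      have : (fun x => (Dx i f).1 (t, x)) = pd i fun x => f.1 (t, x) :=
        funext fun x => Dx_apply i f ht x
      rw [this, fcoef_pd i ((f.slice_contDiff ht).of_le (by simp)) (f.per ht)]
      simp [abs_of_pos pi_pos]
    have h0 := hC0 k
    have h1 := hC1 k
    rw [hd] at h0 h1
    have hk : ‖k‖ ≤ |(k 0 : ℝ)| + |(k 1 : ℝ)| := by
      refine (pi_norm_le_iff_of_nonneg (by positivity)).2 fun i => ?_
      rw [Int.norm_eq_abs]
      fin_cases i
      · exact le_add_of_nonneg_right (abs_nonneg _)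
      · exact le_add_of_nonneg_left (abs_nonneg _)
    set F := ‖fcoef (fun x => f.1 (t, x)) k‖
    have hF : 0 ≤ (1 + ‖k‖) ^ s * F := by positivity
    have hpi := pi_gt_three
    calc (1 + ‖k‖) ^ (s + 1) * F = (1 + ‖k‖) * ((1 + ‖k‖) ^ s * F) := by ring
      _ ≤ (1 + (2 * π * |(k 0 : ℝ)| + 2 * π * |(k 1 : ℝ)|)) * ((1 + ‖k‖) ^ s * F) := by
        gcongr
        nlinarith [abs_nonneg (k 0 : ℝ), abs_nonneg (k 1 : ℝ)]
      _ = (1 + ‖k‖) ^ s * F + ((1 + ‖k‖) ^ s * (2 * π * |(k 0 : ℝ)| * F)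
          + (1 + ‖k‖) ^ s * (2 * π * |(k 1 : ℝ)| * F)) := by ring
      _ ≤ _ := add_le_add (hC k) (add_le_add h0 h1)

/-- The projection to the torus. -/
def toTorus (x : Spc 2) : UnitAddTorus (Fin 2) := fun i => (x i : UnitAddCircle)

theorem isOpenQuotientMap_toTorus : IsOpenQuotientMap toTorus :=
  IsOpenQuotientMap.piMap fun _ => QuotientAddGroup.isOpenQuotientMap_mk

theorem mFourier_toTorus (k : Lat) (x : Spc 2) :
    UnitAddTorus.mFourier k (toTorus x) = chi k x := by
  simp only [UnitAddTorus.mFourier, ContinuousMap.coe_mk, toTorus, fourier_coe_apply, chi,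
    ← Complex.exp_sum]
  congr 1
  rw [Finset.mul_sum]
  refine Finset.sum_congr rfl fun i _ => ?_
  push_cast
  ring

theorem ser_fcoef {f : Spc 2 → ℝ} (hf : Continuous f) (hp : Per f)
    (hs : Summable fun k => ‖fcoef f k‖) (x : Spc 2) : ser (fcoef f) x = f x := by
  have hq := isOpenQuotientMap_toTorus
  set g : UnitAddTorus (Fin 2) → ℂ := fun y => (f (Function.surjInv hq.surjective y) : ℂ) with hg
  have hgt : ∀ x, g (toTorus x) = f x := fun x => by
    have h1 : toTorus (Function.surjInv hq.surjective (toTorus x)) = toTorus x :=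
      Function.surjInv_eq hq.surjective _
    set y := Function.surjInv hq.surjective (toTorus x) with hy
    have h2 : ∀ i, ∃ m : ℤ, y i = x i + (m : ℝ) := fun i => by
      have h3 : ((y i : ℝ) : UnitAddCircle) = (x i : UnitAddCircle) := congrFun h1 i
      rw [← sub_eq_zero, ← AddCircle.coe_sub, AddCircle.coe_eq_zero_iff] at h3
      obtain ⟨m, hm⟩ := h3
      exact ⟨m, by rw [zsmul_one] at hm; linarith⟩
    choose m hm using h2
    simp only [hg, ← hy]
    rw [← hp x m, funext hm]
  have hgc : Continuous g := by
    rw [hq.isQuotientMap.continuous_iff]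
    have : g ∘ toTorus = fun x => (f x : ℂ) := funext hgt
    rw [this]
    exact Complex.continuous_ofReal.comp hf
  set G : C(UnitAddTorus (Fin 2), ℂ) := ⟨g, hgc⟩
  have hco : UnitAddTorus.mFourierCoeff G = fcoef f := by
    funext k
    rw [UnitAddTorus.mFourierCoeff_eq_integral G k 0, fcoef]
    have hset : {x : Spc 2 | ∀ i, x i ∈ Set.Ioc ((0 : Spc 2) i) ((0 : Spc 2) i + 1)}
        =ᵐ[volume] cube 2 := by
      have e : {x : Spc 2 | ∀ i, x i ∈ Set.Ioc ((0 : Spc 2) i) ((0 : Spc 2) i + 1)}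
          = Set.univ.pi fun i => Set.Ioc ((0 : Spc 2) i) ((1 : Spc 2) i) := by
        ext x
        simp
      rw [e, cube_eq_Icc]
      exact Measure.univ_pi_Ioc_ae_eq_Icc
    rw [setIntegral_congr_set hset]
    refine integral_congr_ae (Filter.Eventually.of_forall fun x => ?_)
    have e1 : UnitAddTorus.mFourier (-k) (fun i => (x i : UnitAddCircle)) = chi (-k) x :=
      mFourier_toTorus (-k) x
    have e2 : G (fun i => (x i : UnitAddCircle)) = f x := hgt x
    simp only [e1, e2, smul_eq_mul, mul_comm]
  have hsum := UnitAddTorus.hasSum_mFourier_series_apply_of_summable (f := G)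
    (by rw [hco]; exact hs.of_norm) (toTorus x)
  rw [hco] at hsum
  simp only [mFourier_toTorus, smul_eq_mul] at hsum
  rw [ser, hsum.tsum_eq]
  exact hgt x

end Coefficients

section Existence

open scoped lp ComplexConjugate

namespace QuadSys

variable {ι : Type} [Fintype ι] [DecidableEq ι] (Q : QuadSys ι)

/-- Projection onto the components in `J`. -/
def maskV (J : Finset ι) : EuclideanSpace ℂ ι →L[ℂ] EuclideanSpace ℂ ι :=
  LinearMap.toContinuousLinearMap
    { toFun := fun v => (WithLp.toLp 2 fun a => if a ∈ J then v a else 0 : EuclideanSpace ℂ ι)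
      map_add' := fun v w => by
        ext a
        by_cases h : a ∈ J <;> simp [h]
      map_smul' := fun r v => by
        ext a
        by_cases h : a ∈ J <;> simp [h] }

theorem maskV_apply (J : Finset ι) (v : EuclideanSpace ℂ ι) (a : ι) :
    maskV J v a = if a ∈ J then v a else 0 := rfl

theorem norm_le_sum (v : EuclideanSpace ℂ ι) : ‖v‖ ≤ ∑ a, ‖v a‖ := by
  rw [EuclideanSpace.norm_eq]
  refine Real.sqrt_le_iff.2 ⟨Finset.sum_nonneg fun _ _ => norm_nonneg _, ?_⟩
  exact Finset.sum_sq_le_sq_sum_of_nonneg fun _ _ => norm_nonneg _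

theorem norm_maskV_apply_le (J : Finset ι) (v : EuclideanSpace ℂ ι) :
    ‖maskV J v‖ ≤ ∑ a ∈ J, ‖v a‖ := by
  refine (norm_le_sum _).trans (le_of_eq ?_)
  rw [← Finset.sum_subset (Finset.subset_univ J) (fun a _ ha => by simp [maskV_apply, ha])]
  exact Finset.sum_congr rfl fun a ha => by simp [maskV_apply, ha]

/-- Projection onto the components in `J` on sequences. -/
def maskS (J : Finset ι) : Sq ι →L[ℂ] Sq ι :=
  Sq.fib (fun _ => maskV J) (norm_nonneg (maskV J)) fun _ => le_rfl

theorem conv_maskS {J : Finset ι} (hJ : ∀ a b c, b ∉ J → Q.q a b c = 0) (W : Sq ι) :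
    Sq.conv Q.qV W W = Sq.conv Q.qV (maskS J W) W := by
  apply lp.ext
  funext k
  rw [Sq.conv_apply, Sq.conv_apply]
  refine tsum_congr fun l => ?_
  ext a
  rw [qV_apply, qV_apply]
  refine Finset.sum_congr rfl fun b _ => Finset.sum_congr rfl fun c _ => ?_
  have : (maskS J W) l b = if b ∈ J then W l b else 0 := rfl
  rw [this]
  by_cases hb : b ∈ J
  · simp [hb]
  · simp [hb, hJ a b c hb]

theorem norm_NI_le {J : Finset ι} (hJ : ∀ a b c, b ∉ J → Q.q a b c = 0) (t : ℝ) (x : Sq ι) :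
    ‖Q.NI t x‖ ≤ (‖Q.MV‖ + ‖Q.qV‖ * ‖maskS J (Q.S t x)‖) * ‖x‖ := by
  rw [NI, norm_S, N, conv_maskS Q hJ]
  refine (norm_add_le _ _).trans ((add_le_add (Q.norm_MS_le _) (Sq.norm_conv_le _ _ _)).trans
    (le_of_eq ?_))
  rw [norm_S]
  ring

theorem norm_maskS_le (J : Finset ι) (W : Sq ι) : ‖maskS J W‖ ≤ ∑ a ∈ J, ∑' k, ‖W k a‖ := by
  refine Sq.norm_le_of_hasSum _ (b := fun k => ∑ a ∈ J, ‖W k a‖) (hasSum_sum fun a _ => ?_)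
    fun k => norm_maskV_apply_le J (W k)
  exact (Summable.of_nonneg_of_le (fun _ => norm_nonneg _)
    (fun k => PiLp.norm_apply_le (W k) a) (Sq.hasSum_norm W).summable).hasSum

/-- The Fourier coefficients of an initial state. -/
def initCoef (F : ι → Fd (-1) 1) (k : Lat) : EuclideanSpace ℂ ι :=
  WithLp.toLp 2 fun a => fcoef (fun x => (F a).1 (0, x)) k

theorem exists_initCoef_le (F : ι → Fd (-1) 1) (s : ℕ) :
    ∃ C, ∀ k, (1 + ‖k‖) ^ s * ‖initCoef F k‖ ≤ C := by
  choose C hC using fun a => exists_fcoef_le (t := 0) (by norm_num) s (F a)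
  refine ⟨∑ a, C a, fun k => ?_⟩
  refine (mul_le_mul_of_nonneg_left (norm_le_sum _) (by positivity)).trans ?_
  rw [Finset.mul_sum]
  exact Finset.sum_le_sum fun a _ => hC a k

theorem summable_initCoef (F : ι → Fd (-1) 1) (s : ℕ) :
    Summable fun k => (1 + ‖k‖) ^ s * ‖initCoef F k‖ := by
  obtain ⟨C, hC⟩ := exists_initCoef_le F (s + 3)
  refine Summable.of_nonneg_of_le (fun k => by positivity) (fun k => ?_) (summable_sw.mul_left C)
  rw [sw, ← div_eq_mul_inv, le_div_iff₀ (by positivity)]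
  refine le_trans (le_of_eq ?_) (hC k)
  ring

theorem summable_norm_initCoef (F : ι → Fd (-1) 1) : Summable fun k => ‖initCoef F k‖ := by
  simpa using summable_initCoef F 0

/-- The initial state of the flow. -/
def initSq (F : ι → Fd (-1) 1) : Sq ι := Sq.of (initCoef F) (summable_norm_initCoef F)

theorem conjS_initSq (F : ι → Fd (-1) 1) : conjS (initSq F) = initSq F := by
  apply lp.ext
  funext k
  rw [conjS_apply]
  ext a
  rw [conjV_apply]
  change conj (fcoef _ (-k)) = fcoef _ k
  rw [fcoef_neg, Complex.conj_conj]

theorem exists_slab_of_lt {R T T' : ℝ} (hT' : T' ∈ Set.Icc 0 T) {Z : ℝ → Sq ι}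
    (hZ : ∀ t ∈ Set.Ioo (-1) (T + 1), HasDerivAt Z (truncField R Q.NI t (Z t)) t)
    (hlt : ∀ t ∈ Set.Icc 0 T', ‖Z t‖ < R) :
    ∃ τ > 0, τ ≤ 1 ∧ ∀ t ∈ Set.Ioo (-τ) (T' + τ), t ∈ Set.Ioo (-1) (T + 1) ∧ ‖Z t‖ < R := by
  have hc : ContinuousOn Z (Set.Ioo (-1) (T + 1)) := fun t ht =>
    (hZ t ht).continuousAt.continuousWithinAt
  have ho : IsOpen (Set.Ioo (-1) (T + 1) ∩ (fun t => ‖Z t‖) ⁻¹' Set.Iio R) :=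
    hc.norm.isOpen_inter_preimage isOpen_Ioo isOpen_Iio
  have hK : Set.Icc 0 T' ⊆ Set.Ioo (-1) (T + 1) ∩ (fun t => ‖Z t‖) ⁻¹' Set.Iio R :=
    fun t ht => ⟨⟨by linarith [ht.1], by linarith [ht.2, hT'.2]⟩, hlt t ht⟩
  obtain ⟨τ', hτ', hsub⟩ := isCompact_Icc.exists_thickening_subset_open ho hK
  obtain ⟨τ, hτ, hττ', hτ1⟩ : ∃ τ > 0, τ ≤ τ' ∧ τ ≤ 1 :=
    ⟨min τ' 1, lt_min hτ' one_pos, min_le_left _ _, min_le_right _ _⟩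
  refine ⟨τ, hτ, hτ1, fun t ht => hsub (Metric.thickening_mono hττ' _
    (Metric.mem_thickening_iff.2 ?_))⟩
  refine ⟨max 0 (min t T'), ⟨le_max_left _ _, max_le hT'.1 (min_le_right _ _)⟩, ?_⟩
  rw [Real.dist_eq, abs_lt]
  have h0 := hT'.1
  rcases le_total t T' with h | h
  · rw [min_eq_left h]
    rcases le_total 0 t with h' | h'
    · rw [max_eq_right h']; constructor <;> linarith
    · rw [max_eq_left h']; constructor <;> linarith [ht.1]
  · rw [min_eq_right h, max_eq_right h0]
    constructor <;> linarith [ht.2]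

theorem field_zero {α β : ℝ} {Z : ℝ → Sq ι} {F : ι → Fd (-1) 1} (hZ0 : Z 0 = initSq F)
    (h : Q.CoefSol α β fun a t k => Q.S t (Z t) k a) (h0 : (0 : ℝ) ∈ Set.Ioo α β) (a : ι)
    (x : Spc 2) : (h.field a).1 (0, x) = (F a).1 (0, x) := by
  have hm : (0 : ℝ) ∈ Set.Ioo (-1 : ℝ) 1 := by norm_num
  have h1 := h.field_apply a (q := (0, x)) (mem_slab.2 h0)
  have h2 : (fun k => Q.S 0 (Z 0) k a) = fcoef (fun x => (F a).1 (0, x)) := by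
    funext k
    rw [S_zero, hZ0]
    rfl
  simp only [h2] at h1
  rw [ser_fcoef ((F a).slice_continuous hm) ((F a).per hm)] at h1
  · exact_mod_cast h1
  · exact Summable.of_nonneg_of_le (fun _ => norm_nonneg _)
      (fun k => PiLp.norm_apply_le (initCoef F k) a) (summable_norm_initCoef F)

/-- Existence up to time `T` from an a priori bound in the Sobolev class controlling the
absolutely summable norm of the components entering the quadratic term. -/
theorem exists_solution (J : Finset ι) (hJ : ∀ a b c, b ∉ J → Q.q a b c = 0) {T Bd : ℝ}
    (hT : 0 ≤ T) (hBd : 0 ≤ Bd) (F : ι → Fd (-1) 1)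
    (hap : ∀ T' ∈ Set.Icc 0 T, ∀ τ > 0, τ ≤ 1 → ∀ W : ι → Fd (-τ) (T' + τ), Q.Solves W →
      (∀ a x, (W a).1 (0, x) = (F a).1 (0, x)) → ∀ t ∈ Set.Icc 0 T', ∀ b ∈ J,
        Int t ((W b - (Dx 0 (Dx 0 (W b)) + Dx 1 (Dx 1 (W b)))) ^ 2) ≤ Bd) :
    ∃ τ > 0, τ ≤ 1 ∧ ∃ W : ι → Fd (-τ) (T + τ), Q.Solves W ∧
      ∀ a x, (W a).1 (0, x) = (F a).1 (0, x) := by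
  set σ := ∑' k, sw k
  have hσ : 0 ≤ σ := tsum_nonneg fun k => (sw_pos k).le
  set b : ℝ := J.card * (σ + Bd)
  have hb : 0 ≤ b := by positivity
  set R : ℝ := ‖initSq F‖ * exp ((‖Q.MV‖ + ‖Q.qV‖ * b) * T) + 1
  have hR : 0 < R := by positivity
  obtain ⟨Z, hZ0, hZ⟩ := Q.tameField_NI.exists_flow hR (initSq F) hT
  have hdec : ∀ s : ℕ, Summable fun k => (1 + ‖k‖) ^ s * ‖Z 0 k‖ := fun s => by
    rw [hZ0]
    exact summable_initCoef F s
  have hreal : conjS (Z 0) = Z 0 := by rw [hZ0, conjS_initSq]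
  have hsol : ∀ T' ∈ Set.Icc 0 T, (∀ t ∈ Set.Icc 0 T', ‖Z t‖ < R) → ∃ τ > 0,
      τ ≤ 1 ∧ Q.CoefSol (-τ) (T' + τ) fun a t k => Q.S t (Z t) k a := fun T' hT' hlt => by
    obtain ⟨τ, hτ, hτ1, h⟩ := Q.exists_slab_of_lt hT' hZ hlt
    exact ⟨τ, hτ, hτ1, Q.coefSol_of_flow hR hT hZ hdec hreal (fun t ht => (h t ht).1)
      fun t ht => (h t ht).2⟩
  have hlt : ∀ t ∈ Set.Icc 0 T, ‖Z t‖ < R := by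
    refine TameField.flow_lt hZ (β := fun t x => ‖maskS J (Q.S t x)‖) (norm_nonneg Q.MV)
      Q.qV.opNorm_nonneg hb (Q.norm_NI_le hJ) (by rw [hZ0]; exact lt_add_one _) ?_
    intro T' hT' hlt t ht
    obtain ⟨τ, hτ, hτ1, hw⟩ := hsol T' hT' hlt
    have htm : t ∈ Set.Ioo (-τ) (T' + τ) := ⟨by linarith [ht.1], by linarith [ht.2]⟩
    refine (norm_maskS_le J _).trans ?_
    have : ∀ a ∈ J, ∑' k, ‖Q.S t (Z t) k a‖ ≤ σ + Bd := fun a ha => by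
      refine (tsum_norm_le_sobolev _ (fun n => hw.rapid n a) htm (hw.real a t htm)).trans ?_
      exact add_le_add le_rfl (hap T' hT' τ hτ hτ1 hw.field hw.solves
        (Q.field_zero hZ0 hw ⟨by linarith, by linarith [hT'.1]⟩) t ht a ha)
    refine (Finset.sum_le_sum this).trans (le_of_eq ?_)
    rw [Finset.sum_const, nsmul_eq_mul]
  obtain ⟨τ, hτ, hτ1, hw⟩ := hsol T ⟨hT, le_rfl⟩ hlt
  exact ⟨τ, hτ, hτ1, hw.field, hw.solves, Q.field_zero hZ0 hw ⟨by linarith, by linarith⟩⟩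

end QuadSys

end Existence

section RelaxationSystem

/-- Components of the relaxation system: pressure, velocity, stress. -/
abbrev Cmp : Type := Option (Fin 2 ⊕ Fin 2 × Fin 2)

/-- First-order coefficients of the symmetrised relaxation system. -/
def relB (κ l : ℝ) (j : Fin 2) : Cmp → Cmp → ℝ
  | none, some (Sum.inl i) => if i = j then -κ else 0
  | some (Sum.inl i), none => if i = j then -κ else 0
  | some (Sum.inl i), some (Sum.inr m) => if m = (i, j) then -l else 0
  | some (Sum.inr m), some (Sum.inl i) => if m = (i, j) then -l else 0
  | _, _ => 0

/-- Zeroth-order coefficients of the symmetrised relaxation system. -/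
def relM (l : ℝ) : Cmp → Cmp → ℝ
  | some (Sum.inr m), some (Sum.inr m') => if m' = m then -l ^ 2 else 0
  | _, _ => 0

/-- Quadratic coefficients of the symmetrised relaxation system. -/
def relq (l : ℝ) : Cmp → Cmp → Cmp → ℝ
  | some (Sum.inr m), some (Sum.inl i), some (Sum.inl j) => if m = (i, j) then l else 0
  | _, _, _ => 0

/-- The relaxation system in symmetric form, for the unknowns `√ε p`, `u`, `√δ U`, with
`κ = 1/√ε` and `l = 1/√δ`. -/
def relSystem (κ l : ℝ) : QuadSys Cmp where
  B j := relB κ l j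
  M := relM l
  q := relq l
  symm := fun j a b => by
    rcases a with _ | i | m <;> rcases b with _ | i' | m' <;> rfl

/-- The velocity components. -/
def velCmp : Finset Cmp := Finset.univ.image fun i : Fin 2 => some (Sum.inl i)

theorem relq_eq_zero (κ l : ℝ) (a b c : Cmp) (hb : b ∉ velCmp) : (relSystem κ l).q a b c = 0 := by
  rcases b with _ | i | m
  · rcases a with _ | _ | _ <;> rfl
  · exact absurd (Finset.mem_image_of_mem _ (Finset.mem_univ i)) hb
  · rcases a with _ | _ | _ <;> rfl

variable {a b : ℝ}

theorem relSys_of_solves {ε δ κ l : ℝ} (hκ : ε * κ ^ 2 = 1) (hl : δ * l ^ 2 = 1) {W : Cmp → Fd a b}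
    (h : (relSystem κ l).Solves W) :
    RelSys ε δ (κ • W none) (fun i => W (some (Sum.inl i)))
      (fun i j => l • W (some (Sum.inr (i, j)))) := by
  constructor
  · intro z hz
    have h0 := h none z hz
    simp only [relSystem, relB, relM, relq, Fintype.sum_option, Fintype.sum_sum_type,
      Fintype.sum_prod_type, Fin.sum_univ_two, zero_mul, add_zero, zero_add] at h0
    simp only [Derivation.map_smul, Fd.ev_add, Fd.ev_smul, Fin.sum_univ_two, h0]
    simp
    linear_combination (-(Dx 0 (W (some (Sum.inl 0)))).1 z - (Dx 1 (W (some (Sum.inl 1)))).1 z) * hκ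
  · intro i z hz
    have h0 := h (some (Sum.inl i)) z hz
    simp only [relSystem, relB, relM, relq, Fintype.sum_option, Fintype.sum_sum_type,
      Fintype.sum_prod_type, Fin.sum_univ_two, zero_mul, add_zero, zero_add] at h0
    simp only [Fd.ev_add, Fin.sum_univ_two, h0]
    fin_cases i <;> simp <;> ring
  · intro i j z hz
    have h0 := h (some (Sum.inr (i, j))) z hz
    simp only [relSystem, relB, relM, relq, Fintype.sum_option, Fintype.sum_sum_type,
      Fintype.sum_prod_type, Fin.sum_univ_two, zero_mul, add_zero, zero_add] at h0
    simp only [Derivation.map_smul, Fd.ev_add, Fd.ev_smul, Fd.ev_mul, h0]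
    fin_cases i <;> fin_cases j <;> simp
    · linear_combination ((W (some (Sum.inl 0))).1 z * (W (some (Sum.inl 0))).1 z
        - (Dx 0 (W (some (Sum.inl 0)))).1 z - l * (W (some (Sum.inr (0, 0)))).1 z) * hl
    · linear_combination ((W (some (Sum.inl 0))).1 z * (W (some (Sum.inl 1))).1 z
        - (Dx 1 (W (some (Sum.inl 0)))).1 z - l * (W (some (Sum.inr (0, 1)))).1 z) * hl
    · linear_combination ((W (some (Sum.inl 1))).1 z * (W (some (Sum.inl 0))).1 z
        - (Dx 0 (W (some (Sum.inl 1)))).1 z - l * (W (some (Sum.inr (1, 0)))).1 z) * hl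
    · linear_combination ((W (some (Sum.inl 1))).1 z * (W (some (Sum.inl 1))).1 z
        - (Dx 1 (W (some (Sum.inl 1)))).1 z - l * (W (some (Sum.inr (1, 1)))).1 z) * hl

end RelaxationSystem

section Translation

variable {a b t : ℝ}

/-- The field of a function that is smooth and periodic on the whole space-time. -/
def Fd.ofSmooth (f : ℝ × Spc 2 → ℝ) (hf : ContDiff ℝ (⊤ : ℕ∞) f)
    (hp : ∀ t, Per fun x : Spc 2 => f (t, x)) : Fd a b :=
  ⟨f, hf.contDiffOn, fun t _ => hp t⟩

/-- The field `f` restricts to the function `g` at time `t`. -/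
def Slice (t : ℝ) (f : Fd a b) (g : Spc 2 → ℝ) : Prop := ∀ x, f.1 (t, x) = g x

theorem Slice.pd (ht : t ∈ Set.Ioo a b) {f : Fd a b} {g : Spc 2 → ℝ} (h : Slice t f g)
    (i : Fin 2) : Slice t (Dx i f) (pd i g) := fun x => by
  rw [Dx_apply i f ht, funext h]

theorem Slice.vort (ht : t ∈ Set.Ioo a b) {u : Fin 2 → Fd a b} {v : Spc 2 → Vec 2}
    (h : ∀ i, Slice t (u i) fun x => v x i) : Slice t (vort u) fun x => curl2 v x := fun x =>
  congrArg₂ (· - ·) ((h 1).pd ht 0 x) ((h 0).pd ht 1 x)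

theorem Slice.dive (ht : t ∈ Set.Ioo a b) {u : Fin 2 → Fd a b} {v : Spc 2 → Vec 2}
    (h : ∀ i, Slice t (u i) fun x => v x i) : Slice t (dive u) fun x => divv v x := fun x => by
  simp only [NSRelax.dive, Fd.ev_sum, divv]
  exact Finset.sum_congr rfl fun i _ => (h i).pd ht i x

theorem Slice.rowDiv (ht : t ∈ Set.Ioo a b) {U : Fin 2 → Fin 2 → Fd a b}
    {V : Spc 2 → Fin 2 → Fin 2 → ℝ} (h : ∀ i j, Slice t (U i j) fun x => V x i j) (i : Fin 2) :
    Slice t (rowDiv U i) fun x => divM V x i := fun x => by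
  simp only [NSRelax.rowDiv, Fd.ev_sum, divM]
  exact Finset.sum_congr rfl fun j _ => (h i j).pd ht j x

theorem Slice.L2sq_sc {f : Fd a b} {g : Spc 2 → ℝ} (h : Slice t f g) :
    L2sq (sc g) = Int t (f ^ 2) := by
  simp only [L2sq, ptsq, sc, Int, Fd.ev_pow, h _, Finset.univ_unique, Finset.sum_singleton]

theorem Slice.D1L2sq_sc (ht : t ∈ Set.Ioo a b) {f : Fd a b} {g : Spc 2 → ℝ} (h : Slice t f g) :
    D1L2sq (sc g) = Int t (gradSq f) := by
  simp only [D1L2sq, ptsqD1, sc, Int, gradSq, Fd.ev_sum, Fd.ev_pow, h.pd ht _ _,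
    Finset.univ_unique, Finset.sum_singleton]

theorem Slice.D2L2sq_sc (ht : t ∈ Set.Ioo a b) {f : Fd a b} {g : Spc 2 → ℝ} (h : Slice t f g) :
    D2L2sq (sc g) = Int t (hessSq f) := by
  simp only [D2L2sq, ptsqD2, sc, Int, hessSq, Fd.ev_sum, Fd.ev_pow,
    ((h.pd ht _).pd ht _ _), Finset.univ_unique, Finset.sum_singleton]

theorem L2sq_vec {u : Fin 2 → Fd a b} {v : Spc 2 → Vec 2}
    (h : ∀ i, Slice t (u i) fun x => v x i) : L2sq v = Int t (sumSq u) := by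
  simp only [L2sq, ptsq, Int, sumSq, Fd.ev_sum, Fd.ev_pow, h _ _]

theorem D1L2sq_vec (ht : t ∈ Set.Ioo a b) {u : Fin 2 → Fd a b} {v : Spc 2 → Vec 2}
    (h : ∀ i, Slice t (u i) fun x => v x i) : D1L2sq v = Int t (sumSqD u) := by
  simp only [D1L2sq, ptsqD1, Int, sumSqD, Fd.ev_sum, Fd.ev_pow, (h _).pd ht _ _]

theorem L2sq_mtx {U : Fin 2 → Fin 2 → Fd a b} {V : Spc 2 → Fin 2 → Fin 2 → ℝ}
    (h : ∀ i j, Slice t (U i j) fun x => V x i j) : L2sq (mtx V) = Int t (matSq U) := by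
  simp only [L2sq, ptsq, mtx, Int, matSq, Fd.ev_sum, Fd.ev_pow, h _ _ _, Fintype.sum_prod_type]

theorem D1L2sq_mtx (ht : t ∈ Set.Ioo a b) {U : Fin 2 → Fin 2 → Fd a b}
    {V : Spc 2 → Fin 2 → Fin 2 → ℝ} (h : ∀ i j, Slice t (U i j) fun x => V x i j) :
    D1L2sq (mtx V) = Int t (∑ k, matSq fun i j => Dx k (U i j)) := by
  simp only [D1L2sq, ptsqD1, mtx, Int, matSq,
    Fintype.sum_prod_type, Fin.sum_univ_two]
  congr 1
  funext x
  simp only [Fd.ev_add, Fd.ev_pow, (h _ _).pd ht _ _]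
  ring

/-- The bounds assumed of the initial data. -/
structure InitBd (ε δ C0 : ℝ) (v0 : Spc 2 → Vec 2) (p0 : Spc 2 → ℝ) (u0 : Spc 2 → Vec 2)
    (U0 : Spc 2 → Fin 2 → Fin 2 → ℝ) : Prop where
  u : L2sq (fun x (b : Fin 2) => u0 x b - v0 x b) ≤ C0 * δ
  curl : L2sq (sc fun x => curl2 u0 x) + δ * H1sq (sc fun x => curl2 u0 x) ≤ C0
  div : L2sq (sc fun x => divv u0 x) + δ * H1sq (sc fun x => divv u0 x) ≤ C0 * δ⁻¹ * ε
  p : ε * L2sq (sc p0) + δ ^ 2 * H1sq (sc p0) + δ ^ 3 * H2sq (sc p0) ≤ C0 * δ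
  U : L2sq (mtx U0) + δ * H1sq (mtx U0) + δ ^ 2 * H1sq (fun x => divM U0 x) ≤ C0

/-- The bounds claimed of the velocity. -/
structure VelBd (ε δ C : ℝ) (v w : Spc 2 → Vec 2) : Prop where
  u : L2sq (fun x (b : Fin 2) => w x b - v x b) ≤ C * δ
  curl : L2sq (sc fun x => curl2 w x) + δ * H1sq (sc fun x => curl2 w x) ≤ C
  div : L2sq (sc fun x => divv w x) + δ * H1sq (sc fun x => divv w x) ≤ C * δ⁻¹ * ε

theorem InitBd.int_totF_le {ε δ K C0 : ℝ} {v0 : Spc 2 → Vec 2} {p0 : Spc 2 → ℝ}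
    {u0 : Spc 2 → Vec 2} {U0 : Spc 2 → Fin 2 → Fin 2 → ℝ} (hI : InitBd ε δ C0 v0 p0 u0 U0)
    (hε : 0 < ε) (hεδ : ε ≤ δ) (hδ1 : δ ≤ 1)
    (ht : t ∈ Set.Ioo a b) {p pE : Fd a b} {u uE : Fin 2 → Fd a b}
    {UE : Fin 2 → Fin 2 → Fd a b} (h : RelSys ε δ pE uE UE) (hN : NSAt t p u) (hB : NSBd K t p u)
    (hv : ∀ i, Slice t (u i) fun x => v0 x i) (hp : Slice t pE p0)
    (hu : ∀ i, Slice t (uE i) fun x => u0 x i)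
    (hU : ∀ i j, Slice t (UE i j) fun x => U0 x i j) :
    Int t (totF ε δ (pE - p) (uE - u) (UE - nsStress u)) ≤ 100 * C0 + 1000 * K := by
  have i1 := hI.u
  have i2 := hI.curl
  have i3 := hI.div
  have i4 := hI.p
  have i5 := hI.U
  have hs : ∀ i, Slice t ((uE - u) i) fun x => u0 x i - v0 x i := fun i x =>
    congrArg₂ (· - ·) (hu i x) (hv i x)
  have hc := Slice.vort ht hu
  have hd := Slice.dive ht hu
  have hr := Slice.rowDiv ht hU
  rw [L2sq_vec hs] at i1
  rw [H1sq, hc.L2sq_sc, hc.D1L2sq_sc ht] at i2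
  rw [H1sq, hd.L2sq_sc, hd.D1L2sq_sc ht] at i3
  rw [H1sq, H2sq, hp.L2sq_sc, hp.D1L2sq_sc ht, hp.D2L2sq_sc ht] at i4
  rw [H1sq, H1sq, L2sq_mtx hU, D1L2sq_mtx ht hU, L2sq_vec hr, D1L2sq_vec ht hr] at i5
  exact init_totF_le hε hεδ hδ1 ht h hN hB i1 i2 i3 i4 i5

theorem velBd_of_totE_le {ε δ K M : ℝ} (hε : 0 < ε) (hεδ : ε ≤ δ) (hδ1 : δ ≤ 1)
    (ht : t ∈ Set.Ioo a b) {p pE : Fd a b} {u uE : Fin 2 → Fd a b}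
    {UE : Fin 2 → Fin 2 → Fd a b} (hN : NSAt t p u) (hB : NSBd K t p u)
    (hM : Int t (totE ε δ (pE - p) (uE - u) (UE - nsStress u)) ≤ M)
    {v w : Spc 2 → Vec 2} (hv : ∀ i, Slice t (u i) fun x => v x i)
    (hw : ∀ i, Slice t (uE i) fun x => w x i) : VelBd ε δ (72 * M + 32 * K) v w := by
  obtain ⟨h1, h2, h3, -⟩ := final_bounds hε hεδ hδ1 ht hN hB hM
  have hs : ∀ i, Slice t ((uE - u) i) fun x => w x i - v x i := fun i x =>
    congrArg₂ (· - ·) (hw i x) (hv i x)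
  have hc := Slice.vort ht hw
  have hd := Slice.dive ht hw
  refine ⟨?_, ?_, ?_⟩
  · rwa [L2sq_vec hs]
  · rwa [H1sq, hc.L2sq_sc, hc.D1L2sq_sc ht]
  · rwa [H1sq, hd.L2sq_sc, hd.D1L2sq_sc ht]

end Translation

section Existence

variable {A B a b t : ℝ}

theorem Int_sobolev_le (ht : t ∈ Set.Ioo a b) {K C δ : ℝ} (hδ : 0 < δ) {u uE : Fin 2 → Fd a b}
    (hu : ∀ i x, (u i).1 (t, x) ^ 2 ≤ K) (h0 : Int t (sumSq (uE - u)) ≤ C)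
    (h2 : δ * Int t (sumSqDD uE) ≤ C) (i : Fin 2) :
    Int t ((uE i - (Dx 0 (Dx 0 (uE i)) + Dx 1 (Dx 1 (uE i)))) ^ 2)
      ≤ 6 * C + 6 * K + 3 * (C / δ) := by
  have h1 : Int t ((uE i - (Dx 0 (Dx 0 (uE i)) + Dx 1 (Dx 1 (uE i)))) ^ 2)
      ≤ Int t ((6 : ℝ) • sumSq (uE - u) + (3 : ℝ) • sumSqDD uE + (6 * K) • (1 : Fd a b)) := by
    refine Int_mono ht fun x => ?_
    have hk := hu i x
    have one : (1 : Fd a b).1 (t, x) = 1 := rfl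
    simp only [sumSq, sumSqDD, Fd.ev_add, Fd.ev_sub, Fd.ev_smul, Fd.ev_pow, one,
      Fin.sum_univ_two, Pi.sub_apply]
    have key : ∀ v d e : ℝ, v ^ 2 ≤ K → ∀ w : ℝ,
        (w - (d + e)) ^ 2 ≤ 6 * (w - v) ^ 2 + 3 * (d ^ 2 + e ^ 2) + 6 * K := fun v d e hv w => by
      nlinarith [sq_nonneg (w - 2 * v), sq_nonneg (w + d), sq_nonneg (w + e), sq_nonneg (d - e)]
    have hp : ∀ r : Fd a b, 0 ≤ r.1 (t, x) ^ 2 := fun r => sq_nonneg _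
    have hk' := key _ ((Dx 0 (Dx 0 (uE i))).1 (t, x)) ((Dx 1 (Dx 1 (uE i))).1 (t, x)) hk
    refine (hk' ((uE i).1 (t, x))).trans ?_
    fin_cases i <;> simp only [Fin.zero_eta, Fin.mk_one, Fin.isValue]
    · linarith [sq_nonneg ((uE 1).1 (t, x) - (u 1).1 (t, x)), hp (Dx 0 (Dx 1 (uE 0))),
        hp (Dx 1 (Dx 0 (uE 0))), hp (Dx 0 (Dx 0 (uE 1))), hp (Dx 0 (Dx 1 (uE 1))),
        hp (Dx 1 (Dx 0 (uE 1))), hp (Dx 1 (Dx 1 (uE 1)))]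
    · linarith [sq_nonneg ((uE 0).1 (t, x) - (u 0).1 (t, x)), hp (Dx 0 (Dx 1 (uE 1))),
        hp (Dx 1 (Dx 0 (uE 1))), hp (Dx 0 (Dx 0 (uE 0))), hp (Dx 0 (Dx 1 (uE 0))),
        hp (Dx 1 (Dx 0 (uE 0))), hp (Dx 1 (Dx 1 (uE 0)))]
  have one : Int t (1 : Fd a b) = 1 := by
    simp [Int, show ∀ x, (1 : Fd a b).1 (t, x) = 1 from fun _ => rfl]
  rw [Int_add ht, Int_add ht, Int_smul, Int_smul, Int_smul, one] at h1
  have h3 : Int t (sumSqDD uE) ≤ C / δ := by rwa [le_div_iff₀' hδ]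
  linarith

/-- The energy bound along the evolution. -/
theorem totE_le_of_initBd {ε δ T T0 K C0 s M : ℝ} (hε : 0 < ε) (hεδ : ε ≤ δ) (hδ1 : δ ≤ 1)
    (hA : A ≤ a) (hB : b ≤ B) (ha : a < 0) (hb : T < b) (hT : 0 ≤ T) (hTT : T ≤ T0)
    {p : Fd A B} {u : Fin 2 → Fd A B} (hN : ∀ t ∈ Set.Icc 0 T0, NSAt t p u)
    (hK : 1 ≤ K) (hBd : ∀ t ∈ Set.Icc 0 T0, NSBd K t p u) (hC0 : 0 ≤ C0)
    (hs0 : 0 < s) (hsδ : s ^ 2 = δ)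
    (hM : M = (3 * (100 * C0 + 1000 * K) + 24 * K + 1) * exp ((1000000 * K + 4 + 1) * T0))
    (hsM : 12000000 * (s * M) ≤ 1)
    {v0 : Spc 2 → Vec 2} {p0 : Spc 2 → ℝ}
    {u0 : Spc 2 → Vec 2} {U0 : Spc 2 → Fin 2 → Fin 2 → ℝ} (hI : InitBd ε δ C0 v0 p0 u0 U0)
    (hv : ∀ i, Slice 0 (u i) fun x => v0 x i)
    {pE : Fd a b} {uE : Fin 2 → Fd a b} {UE : Fin 2 → Fin 2 → Fd a b}
    (h : RelSys ε δ pE uE UE) (hp : Slice 0 pE p0)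
    (hu : ∀ i, Slice 0 (uE i) fun x => u0 x i)
    (hU : ∀ i j, Slice 0 (UE i j) fun x => U0 x i j) :
    ∀ t ∈ Set.Icc 0 T, Int t (totE ε δ (pE - res hA hB p) (uE - fun i => res hA hB (u i))
      (UE - nsStress fun i => res hA hB (u i))) ≤ M := by
  have hI' : ∀ t ∈ Set.Icc 0 T, t ∈ Set.Ioo a b := fun t ht =>
    ⟨ha.trans_le ht.1, ht.2.trans_lt hb⟩
  have h0 : (0 : ℝ) ∈ Set.Icc 0 T := ⟨le_rfl, hT⟩
  have hs : ∀ t ∈ Set.Icc 0 T, t ∈ Set.Icc 0 T0 := fun t ht => ⟨ht.1, ht.2.trans hTT⟩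
  have hN' := fun t (ht : t ∈ Set.Icc 0 T) => (hN t (hs t ht)).res (hI' t ht) hA hB
  have hB' := fun t (ht : t ∈ Set.Icc 0 T) => (hBd t (hs t ht)).res (hI' t ht) hA hB
  refine totE_le_of_init hε hεδ hδ1 ha hb hTT h hN' hK hB' hs0 hsδ (by positivity) hM hsM ?_
  have h1 := hI.int_totF_le hε hεδ hδ1 (hI' 0 h0) h (hN' 0 h0) (hB' 0 h0) hv hp hu hU
  have h2 := Int_mono (hI' 0 h0) (f := totE ε δ (pE - res hA hB p)
    (uE - fun i => res hA hB (u i)) (UE - nsStress fun i => res hA hB (u i)))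
    (g := (3 : ℝ) • totF ε δ (pE - res hA hB p)
    (uE - fun i => res hA hB (u i)) (UE - nsStress fun i => res hA hB (u i))) fun x => by
      rw [Fd.ev_smul]
      exact totE_le_totF hε hεδ _ _ _ _
  rw [Int_smul] at h2
  linarith

/-- Existence of a smooth solution of the relaxation system on the whole time interval. -/
theorem exists_relSys {ε δ T0 K C0 s M : ℝ} (hT0 : 0 < T0) (hε : 0 < ε) (hεδ : ε ≤ δ)
    (hδ1 : δ ≤ 1) {p : Fd (-1) (T0 + 1)} {u : Fin 2 → Fd (-1) (T0 + 1)}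
    (hN : ∀ t ∈ Set.Icc 0 T0, NSAt t p u)
    (hK : 1 ≤ K) (hBd : ∀ t ∈ Set.Icc 0 T0, NSBd K t p u) (hC0 : 0 ≤ C0)
    (hs0 : 0 < s) (hsδ : s ^ 2 = δ)
    (hM : M = (3 * (100 * C0 + 1000 * K) + 24 * K + 1) * exp ((1000000 * K + 4 + 1) * T0))
    (hsM : 12000000 * (s * M) ≤ 1)
    {v0 : Spc 2 → Vec 2} {p0 : Spc 2 → ℝ}
    {u0 : Spc 2 → Vec 2} {U0 : Spc 2 → Fin 2 → Fin 2 → ℝ} (hI : InitBd ε δ C0 v0 p0 u0 U0)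
    (hv : ∀ i, Slice 0 (u i) fun x => v0 x i)
    (hsm : ContDiff ℝ (⊤ : ℕ∞) fun x : Spc 2 => (p0 x, u0 x, U0 x))
    (hp0 : Per p0) (hu0 : Per u0) (hU0 : Per U0) :
    ∃ τ > 0, τ ≤ 1 ∧ ∃ (pE : Fd (-τ) (T0 + τ)) (uE : Fin 2 → Fd (-τ) (T0 + τ))
      (UE : Fin 2 → Fin 2 → Fd (-τ) (T0 + τ)), RelSys ε δ pE uE UE ∧ Slice 0 pE p0 ∧
      (∀ i, Slice 0 (uE i) fun x => u0 x i) ∧ ∀ i j, Slice 0 (UE i j) fun x => U0 x i j := by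
  have hδ : 0 < δ := hε.trans_le hεδ
  obtain ⟨κ, hκ0, hκ⟩ : ∃ κ : ℝ, κ ≠ 0 ∧ ε * κ ^ 2 = 1 :=
    ⟨(√ε)⁻¹, by positivity, by rw [inv_pow, Real.sq_sqrt hε.le]; field_simp⟩
  obtain ⟨l, hl0, hl⟩ : ∃ l : ℝ, l ≠ 0 ∧ δ * l ^ 2 = 1 :=
    ⟨(√δ)⁻¹, by positivity, by rw [inv_pow, Real.sq_sqrt hδ.le]; field_simp⟩
  have sp : ContDiff ℝ (⊤ : ℕ∞) p0 := contDiff_fst.comp hsm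
  have su : ∀ i, ContDiff ℝ (⊤ : ℕ∞) fun x => u0 x i := fun i =>
    (contDiff_apply ℝ ℝ i).comp (contDiff_fst.comp (contDiff_snd.comp hsm))
  have sU : ∀ i j, ContDiff ℝ (⊤ : ℕ∞) fun x => U0 x i j := fun i j =>
    (contDiff_apply_apply ℝ ℝ i j).comp (contDiff_snd.comp (contDiff_snd.comp hsm))
  let F : Cmp → Fd (-1) 1
    | none => κ⁻¹ • Fd.ofSmooth (fun q => p0 q.2) (sp.comp contDiff_snd) fun _ => hp0
    | some (Sum.inl i) => Fd.ofSmooth (fun q => u0 q.2 i) ((su i).comp contDiff_snd)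
        fun _ x k => congrFun (hu0 x k) i
    | some (Sum.inr (i, j)) => l⁻¹ • Fd.ofSmooth (fun q => U0 q.2 i j)
        ((sU i j).comp contDiff_snd) fun _ x k => congrFun (congrFun (hU0 x k) i) j
  have slp : ∀ {a b : ℝ} {W : Cmp → Fd a b}, (∀ c x, (W c).1 (0, x) = (F c).1 (0, x)) →
      Slice 0 (κ • W none) p0 ∧ (∀ i, Slice 0 (W (some (Sum.inl i))) fun x => u0 x i) ∧
      ∀ i j, Slice 0 (l • W (some (Sum.inr (i, j)))) fun x => U0 x i j := by
    intro a b W hW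
    refine ⟨fun x => ?_, fun i x => hW _ x, fun i j x => ?_⟩
    · rw [Fd.ev_smul, hW none x]
      exact mul_inv_cancel_left₀ hκ0 _
    · rw [Fd.ev_smul, hW _ x]
      exact mul_inv_cancel_left₀ hl0 _
  have hM0 : 0 ≤ M := by rw [hM]; positivity
  have hex := (relSystem κ l).exists_solution velCmp
    (relq_eq_zero κ l) hT0.le
    (Bd := 6 * (72 * M + 32 * K) + 6 * K + 3 * ((72 * M + 32 * K) / δ)) (by positivity) F
    fun T' hT' τ hτ hτ1 W hW hW0 t ht c hc => by
    obtain ⟨i, -, rfl⟩ := Finset.mem_image.1 hc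
    obtain ⟨h1, h2, h3⟩ := slp hW0
    have hA : (-1 : ℝ) ≤ -τ := by linarith
    have hB : T' + τ ≤ T0 + 1 := by linarith [hT'.2]
    have htI : t ∈ Set.Ioo (-τ) (T' + τ) := ⟨by linarith [ht.1], by linarith [ht.2]⟩
    have ht0 : t ∈ Set.Icc 0 T0 := ⟨ht.1, ht.2.trans hT'.2⟩
    have key := totE_le_of_initBd hε hεδ hδ1 hA hB (by linarith) (by linarith) hT'.1 hT'.2 hN hK
      hBd hC0 hs0 hsδ hM hsM hI hv (relSys_of_solves hκ hl hW) h1 h2 h3 t ht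
    have hBt := (hBd t ht0).res htI hA hB
    obtain ⟨f1, -, -, f4⟩ := final_bounds hε hεδ hδ1 htI ((hN t ht0).res htI hA hB) hBt key
    refine Int_sobolev_le htI hδ hBt.u0 (f1.trans ?_) f4 i
    exact mul_le_of_le_one_right (by positivity) hδ1
  obtain ⟨τ, hτ, hτ1, W, hW, hW0⟩ := hex
  obtain ⟨h1, h2, h3⟩ := slp hW0
  exact ⟨τ, hτ, hτ1, _, _, _, relSys_of_solves hκ hl hW, h1, h2, h3⟩

end Existence

section NavierStokesFields

variable {a b : ℝ} {I : Set ℝ} {p : ℝ → Spc 2 → ℝ} {u : ℝ → Spc 2 → Vec 2}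

/-- The pressure of a Navier–Stokes solution as a field. -/
def IsNS.pField (h : IsNS 2 I p u) : Fd a b := Fd.ofSmooth (fun q => p q.1 q.2) h.smooth_p h.per_p

/-- The velocity of a Navier–Stokes solution as a field. -/
def IsNS.uField (h : IsNS 2 I p u) (i : Fin 2) : Fd a b :=
  Fd.ofSmooth (fun q => u q.1 q.2 i) ((contDiff_apply ℝ ℝ i).comp h.smooth_u)
    fun t x k => congrFun (h.per_u t x k) i

theorem IsNS.nsAt (h : IsNS 2 I p u) {t : ℝ} (ht : t ∈ I) (hab : t ∈ Set.Ioo a b) :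
    NSAt t (h.pField : Fd a b) h.uField where
  div_free x := by
    rw [Fd.ev_sum]
    simp only [Dx_apply _ _ hab]
    exact h.div_free t ht x
  momentum i x := by
    have h1 := h.momentum t ht x i
    simp only [Fd.ev_add, Fd.ev_sub, Fd.ev_sum, Dt_apply _ hab, Dx_apply _ _ hab]
    simp only [dtV, divM, tens, lapV, lapS] at h1
    change deriv (fun s => u s x i) t + ∑ j, pd j (fun y => u t y i * u t y j) x
      - ∑ j, pd j (fun y => pd j (fun y => u t y i) y) x + pd i (fun y => p t y) x = 0
    linarith

end NavierStokesFields

section SolutionOfFields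

variable {a b ε δ : ℝ}

theorem RelSys.isRelax (ha : a < 0) (hb : 0 < b) {pE : Fd a b} {uE : Fin 2 → Fd a b}
    {UE : Fin 2 → Fin 2 → Fd a b} (h : RelSys ε δ pE uE UE) :
    IsRelax 2 ε δ (ENNReal.ofReal b) (fun t x => pE.1 (t, x)) (fun t x i => (uE i).1 (t, x))
      (fun t x i j => (UE i j).1 (t, x)) := by
  have hI : ∀ t ∈ Itv (ENNReal.ofReal b), t ∈ Set.Ioo a b := fun t ht =>
    ⟨ha.trans_le ht.1, (ENNReal.ofReal_lt_ofReal_iff hb).1 ht.2⟩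
  have h0 : (0 : ℝ) ∈ Set.Ioo a b := ⟨ha, hb⟩
  have key : ContDiffOn ℝ (⊤ : ℕ∞) (fun q : ℝ × Spc 2 => (pE.1 (q.1, q.2),
      (fun i => (uE i).1 (q.1, q.2)), fun i j => (UE i j).1 (q.1, q.2))) (slab a b) :=
    pE.contDiffOn.prodMk ((contDiffOn_pi.2 fun i => (uE i).contDiffOn).prodMk
      (contDiffOn_pi.2 fun i => contDiffOn_pi.2 fun j => (UE i j).contDiffOn))
  constructor
  · exact ENNReal.ofReal_pos.2 hb
  · exact (pE.slice_contDiff h0).prodMk ((contDiff_pi.2 fun i => (uE i).slice_contDiff h0).prodMk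
      (contDiff_pi.2 fun i => contDiff_pi.2 fun j => (UE i j).slice_contDiff h0))
  · exact fun t ht => pE.per (hI t ht)
  · exact fun t ht x k => funext fun i => (uE i).per (hI t ht) x k
  · exact fun t ht x k => funext fun i => funext fun j => (UE i j).per (hI t ht) x k
  · exact key.continuousOn.mono fun q hq => mem_slab.2 (hI _ hq.1)
  · exact fun t ht _ x => key.contDiffAt ((isOpen_slab a b).mem_nhds (mem_slab.2 (hI t ht)))
  · intro t ht _ x
    have h1 := h.mass (t, x) (mem_slab.2 (hI t ht))
    simp only [Fd.ev_add, Fd.ev_smul, Fd.ev_sum, Dt_apply _ (hI t ht),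
      Dx_apply _ _ (hI t ht)] at h1
    exact h1
  · intro t ht _ x i
    have h1 := h.momentum i (t, x) (mem_slab.2 (hI t ht))
    simp only [Fd.ev_add, Fd.ev_sum, Dt_apply _ (hI t ht),
      Dx_apply _ _ (hI t ht)] at h1
    exact h1
  · intro t ht _ x i j
    have h1 := h.stress i j (t, x) (mem_slab.2 (hI t ht))
    simp only [Fd.ev_add, Fd.ev_smul, Fd.ev_mul, Dt_apply _ (hI t ht),
      Dx_apply _ _ (hI t ht)] at h1
    simp only [dtM]
    linarith

end SolutionOfFields

section FieldsOfSolution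

variable {T ε δ : ℝ} {Tl : ℝ≥0∞} {p : ℝ → Spc 2 → ℝ} {u : ℝ → Spc 2 → Vec 2}
  {U : ℝ → Spc 2 → Fin 2 → Fin 2 → ℝ}

theorem IsRelax.contDiffOn (h : IsRelax 2 ε δ Tl p u U) (hT : Set.Icc 0 T ⊆ Itv Tl) :
    ContDiffOn ℝ (⊤ : ℕ∞) (fun q : ℝ × Spc 2 => (p q.1 q.2, u q.1 q.2, U q.1 q.2)) (slab 0 T) :=
  fun q hq => (h.smooth q.1 (hT ⟨hq.1.1.le, hq.1.2.le⟩) hq.1.1 q.2).contDiffWithinAt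

/-- The pressure of a solution as a field. -/
def IsRelax.pField (h : IsRelax 2 ε δ Tl p u U) (hT : Set.Icc 0 T ⊆ Itv Tl) : Fd 0 T :=
  ⟨fun q => p q.1 q.2, contDiff_fst.comp_contDiffOn (h.contDiffOn hT),
    fun _ ht => h.per_p _ (hT ⟨ht.1.le, ht.2.le⟩)⟩

/-- The velocity of a solution as a field. -/
def IsRelax.uField (h : IsRelax 2 ε δ Tl p u U) (hT : Set.Icc 0 T ⊆ Itv Tl) (i : Fin 2) : Fd 0 T :=
  ⟨fun q => u q.1 q.2 i, ((contDiff_apply ℝ ℝ i).comp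
    (contDiff_fst.comp contDiff_snd)).comp_contDiffOn (h.contDiffOn hT),
    fun _ ht x k => congrFun (h.per_u _ (hT ⟨ht.1.le, ht.2.le⟩) x k) i⟩

/-- The stress of a solution as a field. -/
def IsRelax.UField (h : IsRelax 2 ε δ Tl p u U) (hT : Set.Icc 0 T ⊆ Itv Tl) (i j : Fin 2) :
    Fd 0 T :=
  ⟨fun q => U q.1 q.2 i j, ((contDiff_apply_apply ℝ ℝ i j).comp
    (contDiff_snd.comp contDiff_snd)).comp_contDiffOn (h.contDiffOn hT),
    fun _ ht x k => congrFun (congrFun (h.per_U _ (hT ⟨ht.1.le, ht.2.le⟩) x k) i) j⟩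

theorem IsRelax.relSys (h : IsRelax 2 ε δ Tl p u U) (hT : Set.Icc 0 T ⊆ Itv Tl) :
    RelSys ε δ (h.pField hT) (h.uField hT) (h.UField hT) where
  mass z hz := by
    have hz1 := mem_slab.1 hz
    have h1 := h.mass z.1 (hT ⟨hz1.1.le, hz1.2.le⟩) hz1.1 z.2
    obtain ⟨t, x⟩ := z
    simp only [Fd.ev_add, Fd.ev_smul, Fd.ev_sum, Dt_apply _ hz1, Dx_apply _ _ hz1]
    exact h1
  momentum i z hz := by
    have hz1 := mem_slab.1 hz
    have h1 := h.momentum z.1 (hT ⟨hz1.1.le, hz1.2.le⟩) hz1.1 z.2 i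
    obtain ⟨t, x⟩ := z
    simp only [Fd.ev_add, Fd.ev_sum, Dt_apply _ hz1, Dx_apply _ _ hz1]
    exact h1
  stress i j z hz := by
    have hz1 := mem_slab.1 hz
    have h1 := h.stress_eq z.1 (hT ⟨hz1.1.le, hz1.2.le⟩) hz1.1 z.2 i j
    obtain ⟨t, x⟩ := z
    simp only [Fd.ev_add, Fd.ev_smul, Fd.ev_mul, Dt_apply _ hz1, Dx_apply _ _ hz1]
    have h2 : δ * deriv (fun s => U s x i j) t + pd j (fun y => u t y i) x
      = u t x i * u t x j - U t x i j := h1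
    change δ * deriv (fun s => U s x i j) t + pd j (fun y => u t y i) x + U t x i j
      = u t x i * u t x j
    linarith

theorem IsRelax.exists_sq_le (h : IsRelax 2 ε δ Tl p u U) (hT : Set.Icc 0 T ⊆ Itv Tl) :
    ∃ R, 0 ≤ R ∧ ∀ t ∈ Set.Icc 0 T, ∀ i x, u t x i ^ 2 ≤ R := by
  have hc : ContinuousOn (fun q : ℝ × Spc 2 => ∑ i, u q.1 q.2 i ^ 2) (Set.Icc 0 T ×ˢ cube 2) := by
    have h1 := (continuous_fst.comp continuous_snd).comp_continuousOn
      (h.cont.mono (Set.prod_mono hT (Set.subset_univ (cube 2))))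
    exact continuousOn_finsetSum _ fun i _ =>
      ((continuous_apply i).comp_continuousOn h1).pow 2
  obtain ⟨R, hR⟩ := ((isCompact_Icc.prod isCompact_cube).image_of_continuousOn hc).bddAbove
  refine ⟨max R 0, le_max_right _ _, fun t ht i x => ?_⟩
  have hp : Per fun x => u t x i := fun x k => congrFun (h.per_u t (hT ht) x k) i
  obtain ⟨y, hy, hxy⟩ := hp.exists_cube x
  rw [← hxy]
  have h2 := hR ⟨(t, y), ⟨ht, hy⟩, rfl⟩
  exact ((Finset.single_le_sum (f := fun i => u t y i ^ 2) (fun i _ => sq_nonneg _)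
    (Finset.mem_univ i)).trans h2).trans (le_max_left _ _)

end FieldsOfSolution

section Uniqueness

variable {a b ε δ : ℝ}

/-- The quadratic energy density of the relaxation system. -/
def quadE (ε δ : ℝ) (q : Fd a b) (v : Fin 2 → Fd a b) (V : Fin 2 → Fin 2 → Fd a b) : Fd a b :=
  ε • q ^ 2 + sumSq v + δ • matSq V

theorem deriv_quadE_le {t R : ℝ} (ht : t ∈ Set.Ioo a b) (hε : 0 ≤ ε) (hδ : 0 ≤ δ) (hR : 0 ≤ R)
    {p p' : Fd a b} {u u' : Fin 2 → Fd a b} {U U' : Fin 2 → Fin 2 → Fd a b}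
    (h : RelSys ε δ p u U) (h' : RelSys ε δ p' u' U') (hu : ∀ i x, (u i).1 (t, x) ^ 2 ≤ R)
    (hu' : ∀ i x, (u' i).1 (t, x) ^ 2 ≤ R) :
    Int t (Dt (quadE ε δ (p - p') (u - u') (U - U')))
      ≤ 4 * R * Int t (quadE ε δ (p - p') (u - u') (U - U')) := by
  set q := p - p' with hq
  set v := u - u' with hv
  set V := U - U' with hV
  have flux : Int t (∑ i, Dx i (q * v i) + ∑ i, ∑ j, Dx j (v i * V i j)) = 0 := by
    simp only [Fin.sum_univ_two, Int_add ht, Int_Dx _ ht, add_zero]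
  have main : Int t (Dt (quadE ε δ q v V)) ≤ Int t ((4 * R) • quadE ε δ q v V
      - (2 : ℝ) • (∑ i, Dx i (q * v i) + ∑ i, ∑ j, Dx j (v i * V i j))) := by
    refine Int_mono ht fun x => ?_
    have hz : ((t, x) : ℝ × Spc 2) ∈ slab a b := mem_slab.2 ht
    have m := h.mass _ hz
    have m' := h'.mass _ hz
    have mo := fun i => h.momentum i _ hz
    have mo' := fun i => h'.momentum i _ hz
    have st := fun i j => h.stress i j _ hz
    have st' := fun i j => h'.stress i j _ hz
    have em : ε * (Dt q).1 (t, x) + (Dx 0 (v 0)).1 (t, x) + (Dx 1 (v 1)).1 (t, x) = 0 := by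
      simp only [hq, hv, Pi.sub_apply, map_sub, Fd.ev_add, Fd.ev_sub, Fd.ev_smul,
        Fin.sum_univ_two] at m m' ⊢
      linarith
    have emo : ∀ i, (Dt (v i)).1 (t, x) + (Dx 0 (V i 0)).1 (t, x) + (Dx 1 (V i 1)).1 (t, x)
        + (Dx i q).1 (t, x) = 0 := fun i => by
      have h1 := mo i
      have h2 := mo' i
      simp only [hq, hv, hV, Pi.sub_apply, map_sub, Fd.ev_add, Fd.ev_sub,
        Fin.sum_univ_two] at h1 h2 ⊢
      linarith
    have est : ∀ i j, δ * (Dt (V i j)).1 (t, x) + (Dx j (v i)).1 (t, x) + (V i j).1 (t, x)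
        = (u i).1 (t, x) * (v j).1 (t, x) + (v i).1 (t, x) * (u' j).1 (t, x) := fun i j => by
      have h1 := st i j
      have h2 := st' i j
      simp only [hv, hV, Pi.sub_apply, map_sub, Fd.ev_add, Fd.ev_sub, Fd.ev_smul,
        Fd.ev_mul] at h1 h2 ⊢
      linear_combination h1 - h2
    have young : ∀ i j, 2 * (V i j).1 (t, x) * ((u i).1 (t, x) * (v j).1 (t, x)
        + (v i).1 (t, x) * (u' j).1 (t, x)) ≤ 2 * (V i j).1 (t, x) ^ 2
          + R * ((v j).1 (t, x) ^ 2 + (v i).1 (t, x) ^ 2) := fun i j => by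
      have h1 := mul_le_mul_of_nonneg_right (hu i x) (sq_nonneg ((v j).1 (t, x)))
      have h2 := mul_le_mul_of_nonneg_right (hu' j x) (sq_nonneg ((v i).1 (t, x)))
      nlinarith [sq_nonneg (2 * (V i j).1 (t, x) - ((u i).1 (t, x) * (v j).1 (t, x)
        + (v i).1 (t, x) * (u' j).1 (t, x))), sq_nonneg ((u i).1 (t, x) * (v j).1 (t, x)
        - (v i).1 (t, x) * (u' j).1 (t, x))]
    have nn : 0 ≤ 4 * R * (ε * q.1 (t, x) ^ 2 + δ * (((V 0 0).1 (t, x) ^ 2 + (V 0 1).1 (t, x) ^ 2)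
        + ((V 1 0).1 (t, x) ^ 2 + (V 1 1).1 (t, x) ^ 2))) := by positivity
    have y00 := young 0 0
    have y01 := young 0 1
    have y10 := young 1 0
    have y11 := young 1 1
    rw [← est] at y00 y01 y10 y11
    simp only [quadE, sumSq, matSq, map_add, Derivation.map_smul, Derivation.leibniz,
      pow_two, smul_eq_mul, Fd.ev_add, Fd.ev_sub, Fd.ev_smul, Fd.ev_mul, Fin.sum_univ_two]
    have e0 := emo 0
    have e1 := emo 1
    have a1 : (Dt (v 0)).1 (t, x) = _ := eq_neg_of_add_eq_zero_left (by linear_combination e0 :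
      (Dt (v 0)).1 (t, x) + ((Dx 0 (V 0 0)).1 (t, x) + (Dx 1 (V 0 1)).1 (t, x)
        + (Dx 0 q).1 (t, x)) = 0)
    have a2 : (Dt (v 1)).1 (t, x) = _ := eq_neg_of_add_eq_zero_left (by linear_combination e1 :
      (Dt (v 1)).1 (t, x) + ((Dx 0 (V 1 0)).1 (t, x) + (Dx 1 (V 1 1)).1 (t, x)
        + (Dx 1 q).1 (t, x)) = 0)
    have a0 : 2 * q.1 (t, x) * (ε * (Dt q).1 (t, x)) = 2 * q.1 (t, x) *
      (-((Dx 0 (v 0)).1 (t, x) + (Dx 1 (v 1)).1 (t, x))) := by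
        rw [eq_neg_of_add_eq_zero_left (by linear_combination em : ε * (Dt q).1 (t, x)
          + ((Dx 0 (v 0)).1 (t, x) + (Dx 1 (v 1)).1 (t, x)) = 0)]
    rw [a1, a2]
    linarith
  rw [Int_sub ht, Int_smul, Int_smul, flux] at main
  linarith

theorem Continuous.integral_cube {X : Type*} [TopologicalSpace X] [FirstCountableTopology X]
    [LocallyCompactSpace X] {f : X → Spc 2 → ℝ} (hf : Continuous fun q : X × Spc 2 => f q.1 q.2) :
    Continuous fun s => ∫ x in cube 2, f s x :=
  continuous_parametric_integral_of_continuous hf isCompact_cube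

variable {T : ℝ} {Tl Tl' : ℝ≥0∞} {p p' : ℝ → Spc 2 → ℝ} {u u' : ℝ → Spc 2 → Vec 2}
  {U U' : ℝ → Spc 2 → Fin 2 → Fin 2 → ℝ}

/-- Solutions of the relaxation system with the same initial data have the same velocity. -/
theorem IsRelax.unique (hε : 0 < ε) (hδ : 0 < δ) (h : IsRelax 2 ε δ Tl p u U)
    (h' : IsRelax 2 ε δ Tl' p' u' U') (hT : Set.Icc 0 T ⊆ Itv Tl) (hT' : Set.Icc 0 T ⊆ Itv Tl')
    (hp : p' 0 = p 0) (hu : u' 0 = u 0) (hU : U' 0 = U 0) :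
    ∀ t ∈ Set.Icc 0 T, u t = u' t := by
  obtain ⟨R, hR0, hR⟩ := h.exists_sq_le hT
  obtain ⟨R', -, hR'⟩ := h'.exists_sq_le hT'
  let G : ℝ → Spc 2 → ℝ := fun t x => ε * (p t x - p' t x) ^ 2 + ∑ i, (u t x i - u' t x i) ^ 2
    + δ * ∑ i, ∑ j, (U t x i j - U' t x i j) ^ 2
  have hG0 : ∀ t x, 0 ≤ G t x := fun t x => by positivity
  have hGc : ContinuousOn (fun q : ℝ × Spc 2 => G q.1 q.2) (Set.Icc 0 T ×ˢ Set.univ) := by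
    have c := h.cont.mono (Set.prod_mono_left hT)
    have c' := h'.cont.mono (Set.prod_mono_left hT')
    have d := c.sub c'
    have d1 := continuous_fst.comp_continuousOn d
    have d2 := (continuous_fst.comp continuous_snd).comp_continuousOn d
    have d3 := (continuous_snd.comp continuous_snd).comp_continuousOn d
    refine (((d1.pow 2).const_mul ε).add (continuousOn_finsetSum _ fun i _ =>
      ((continuous_apply i).comp_continuousOn d2).pow 2)).add
      ((continuousOn_finsetSum _ fun i _ => continuousOn_finsetSum _ fun j _ =>
      ((continuous_apply_apply i j).comp_continuousOn d3).pow 2).const_mul δ)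
  let E : ℝ → ℝ := fun t => ∫ x in cube 2, G t x
  have hEc : ContinuousOn E (Set.Icc 0 T) := by
    rw [continuousOn_iff_continuous_domRestrict]
    refine Continuous.integral_cube (X := Set.Icc 0 T) (f := fun s x => G s x) ?_
    exact hGc.comp_continuous ((continuous_subtype_val.comp continuous_fst).prodMk continuous_snd)
      fun q => ⟨q.1.2, trivial⟩
  have hE : ∀ t ∈ Set.Ioo 0 T, ∃ e', HasDerivAt E e' t ∧ e' ≤ 4 * max R R' * E t := by
    intro t ht
    have ht' : t ∈ Set.Icc 0 T := ⟨ht.1.le, ht.2.le⟩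
    have eq : E = fun s => Int s (quadE ε δ (h.pField hT - h'.pField hT')
        (h.uField hT - h'.uField hT') (h.UField hT - h'.UField hT')) := by
      funext s
      refine integral_congr_ae (Filter.Eventually.of_forall fun x => ?_)
      simp only [quadE, sumSq, matSq, Fd.ev_add, Fd.ev_sub, Fd.ev_smul, Fd.ev_sum, Fd.ev_pow,
        Pi.sub_apply]
      rfl
    refine ⟨_, ?_, deriv_quadE_le ht hε.le hδ.le (hR0.trans (le_max_left R R')) (h.relSys hT)
      (h'.relSys hT') (fun i x => (hR t ht' i x).trans (le_max_left _ _))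
      fun i x => (hR' t ht' i x).trans (le_max_right _ _)⟩
    rw [eq]
    exact hasDerivAt_Int ht _
  intro t ht
  set L := 4 * max R R'
  have hanti : AntitoneOn (fun s => exp (-(L * s)) * E s) (Set.Icc 0 T) := by
    have hd : ∀ s ∈ Set.Ioo 0 T, ∃ e', HasDerivAt (fun s => exp (-(L * s)) * E s) e' s ∧ e' ≤ 0 := by
      intro s hs
      obtain ⟨e', h1, h2⟩ := hE s hs
      have h3 : HasDerivAt (fun s => exp (-(L * s))) (exp (-(L * s)) * -(L * 1)) s :=
        (((hasDerivAt_id s).const_mul L).neg).exp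
      refine ⟨_, h3.mul h1, ?_⟩
      have h4 := mul_le_mul_of_nonneg_left h2 (exp_pos (-(L * s))).le
      linarith
    refine antitoneOn_of_deriv_nonpos (convex_Icc 0 T) ?_ ?_ ?_
    · exact (by fun_prop : Continuous fun s : ℝ => exp (-(L * s))).continuousOn.mul hEc
    · rw [interior_Icc]
      intro s hs
      obtain ⟨e', h1, -⟩ := hd s hs
      exact h1.differentiableAt.differentiableWithinAt
    · rw [interior_Icc]
      intro s hs
      obtain ⟨e', h1, h2⟩ := hd s hs
      rwa [h1.deriv]
  have hE0 : E 0 = 0 := by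
    simp [E, G, hp, hu, hU]
  have hEt : E t ≤ 0 := by
    have h1 := hanti ⟨le_rfl, ht.1.trans ht.2⟩ ht ht.1
    simp only [hE0, mul_zero] at h1
    exact nonpos_of_mul_nonpos_right h1 (exp_pos _)
  have hGt : Continuous fun x => G t x :=
    hGc.comp_continuous (f := fun x : Spc 2 => ((t, x) : ℝ × Spc 2)) (by fun_prop)
      fun x => ⟨ht, trivial⟩
  have hz : ∀ x ∈ cube 2, G t x = 0 := by
    have h1 : ∫ x in cube 2, G t x = 0 := le_antisymm hEt (integral_nonneg fun x => hG0 t x)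
    rw [integral_eq_zero_iff_of_nonneg (fun x => hG0 t x) (integrableOn_cube hGt)] at h1
    refine Measure.eqOn_of_ae_eq h1 hGt.continuousOn continuousOn_const ?_
    rw [cube, interior_pi_set Set.finite_univ, closure_pi_set]
    simp
  funext x i
  have hper : Per fun x => u t x i - u' t x i := fun x k =>
    congrArg₂ (· - ·) (congrFun (h.per_u t (hT ht) x k) i) (congrFun (h'.per_u t (hT' ht) x k) i)
  obtain ⟨y, hy, hxy⟩ := hper.exists_cube x
  have h1 := hz y hy
  have h2 : (u t y i - u' t y i) ^ 2 ≤ ∑ i, (u t y i - u' t y i) ^ 2 :=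
    Finset.single_le_sum (f := fun i => (u t y i - u' t y i) ^ 2) (fun i _ => sq_nonneg _)
      (Finset.mem_univ i)
  have h3 : 0 ≤ ε * (p t y - p' t y) ^ 2 := by positivity
  have h4 : 0 ≤ δ * ∑ i, ∑ j, (U t y i j - U' t y i j) ^ 2 := by positivity
  have h5 : (u t y i - u' t y i) ^ 2 = 0 := le_antisymm (by simp only [G] at h1; linarith)
    (sq_nonneg _)
  rw [← sub_eq_zero, ← hxy]
  exact pow_eq_zero_iff two_ne_zero |>.1 h5

end Uniqueness

/-- Theorem `thm:critical_2d` of the paper: global-in-time velocity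
convergence on `𝕋²` for order-one initial perturbations, in the regime `ε ≤ μ⋆ δ`. -/
theorem relaxation_critical_2d
    (T0 : ℝ) (hT0 : 0 < T0)
    (p : ℝ → Spc 2 → ℝ) (u : ℝ → Spc 2 → Vec 2)
    (hNS : IsNS 2 (Set.Icc 0 T0) p u)
    (pe : ℝ → ℝ → ℝ → Spc 2 → ℝ) (ue : ℝ → ℝ → ℝ → Spc 2 → Vec 2)
    (Ue : ℝ → ℝ → ℝ → Spc 2 → Fin 2 → Fin 2 → ℝ) (Tl : ℝ → ℝ → ℝ≥0∞)
    (hRel : ∀ ε δ : ℝ, 0 < ε → 0 < δ →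
      IsMaxRelax 2 ε δ (Tl ε δ) (pe ε δ) (ue ε δ) (Ue ε δ))
    (C0 : ℝ) (hC0 : 1 ≤ C0)
    (hinit_u : ∀ ε δ : ℝ, 0 < ε → 0 < δ →
      L2sq (fun x (b : Fin 2) => ue ε δ 0 x b - u 0 x b) ≤ C0 * δ)
    (hinit_curl : ∀ ε δ : ℝ, 0 < ε → 0 < δ →
      L2sq (sc fun x => curl2 (ue ε δ 0) x) + δ * H1sq (sc fun x => curl2 (ue ε δ 0) x)
        ≤ C0)
    (hinit_div : ∀ ε δ : ℝ, 0 < ε → 0 < δ →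
      L2sq (sc fun x => divv (ue ε δ 0) x) + δ * H1sq (sc fun x => divv (ue ε δ 0) x)
        ≤ C0 * δ⁻¹ * ε)
    (hinit_p : ∀ ε δ : ℝ, 0 < ε → 0 < δ →
      ε * L2sq (sc (pe ε δ 0)) + δ ^ 2 * H1sq (sc (pe ε δ 0))
        + δ ^ 3 * H2sq (sc (pe ε δ 0)) ≤ C0 * δ)
    (hinit_U : ∀ ε δ : ℝ, 0 < ε → 0 < δ →
      L2sq (mtx (Ue ε δ 0)) + δ * H1sq (mtx (Ue ε δ 0))
        + δ ^ 2 * H1sq (fun x => divM (Ue ε δ 0) x) ≤ C0) :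
    ∃ μs > (0:ℝ), ∃ C > (0:ℝ), ∃ η > (0:ℝ),
      ∀ ε δ : ℝ, 0 < ε → 0 < δ → ε + δ < η → ε ≤ μs * δ →
        -- the solution exists on `[0,T0]` …
        ENNReal.ofReal T0 < Tl ε δ ∧
        -- … and the bounds hold on `[0,T0]`
        ∀ t ∈ Set.Icc (0:ℝ) T0,
          L2sq (fun x (b : Fin 2) => ue ε δ t x b - u t x b) ≤ C * δ ∧
          L2sq (sc fun x => curl2 (ue ε δ t) x)
            + δ * H1sq (sc fun x => curl2 (ue ε δ t) x) ≤ C ∧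
          L2sq (sc fun x => divv (ue ε δ t) x)
            + δ * H1sq (sc fun x => divv (ue ε δ t) x) ≤ C * δ⁻¹ * ε := by
  have hN : ∀ t ∈ Set.Icc 0 T0, NSAt t (hNS.pField : Fd (-1) (T0 + 1)) hNS.uField := fun t ht =>
    hNS.nsAt ht ⟨by linarith [ht.1], by linarith [ht.2]⟩
  obtain ⟨K, hK, hB⟩ := exists_NSBd (T := T0) (by norm_num : (-1 : ℝ) < 0)
    (by linarith : T0 < T0 + 1) (hNS.pField : Fd (-1) (T0 + 1)) hNS.uField
  obtain ⟨M, hM⟩ : ∃ M, M = (3 * (100 * C0 + 1000 * K) + 24 * K + 1)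
    * exp ((1000000 * K + 4 + 1) * T0) := ⟨_, rfl⟩
  have hM0 : 0 < M := by rw [hM]; positivity
  refine ⟨1, one_pos, 72 * M + 32 * K, by positivity, min 1 ((1 / (12000000 * M)) ^ 2),
    by positivity, fun ε δ hε hδ hη hεδ => ?_⟩
  rw [one_mul] at hεδ
  have hδ1 : δ ≤ 1 := by linarith [min_le_left 1 ((1 / (12000000 * M)) ^ 2)]
  have hδM : δ ≤ (1 / (12000000 * M)) ^ 2 := by
    linarith [min_le_right 1 ((1 / (12000000 * M)) ^ 2)]
  have hsM : 12000000 * (√δ * M) ≤ 1 := by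
    have h1 : √δ ≤ 1 / (12000000 * M) := Real.sqrt_le_iff.2 ⟨by positivity, hδM⟩
    rw [le_div_iff₀ (by positivity)] at h1
    linarith
  obtain ⟨hR, hmax⟩ := hRel ε δ hε hδ
  have hI : InitBd ε δ C0 (u 0) (pe ε δ 0) (ue ε δ 0) (Ue ε δ 0) :=
    ⟨hinit_u ε δ hε hδ, hinit_curl ε δ hε hδ, hinit_div ε δ hε hδ, hinit_p ε δ hε hδ,
      hinit_U ε δ hε hδ⟩
  have h00 : (0 : ℝ) ∈ Itv (Tl ε δ) := ⟨le_rfl, by simpa using hR.pos⟩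
  have hv : ∀ t i, Slice t (hNS.uField i : Fd (-1) (T0 + 1)) fun x => u t x i := fun t i x => rfl
  obtain ⟨τ, hτ, hτ1, pE, uE, UE, hS, sp, su, sU⟩ := exists_relSys hT0 hε hεδ hδ1 hN hK hB
    (by linarith) (Real.sqrt_pos.2 hδ) (Real.sq_sqrt hδ.le) hM hsM hI (hv 0) hR.init_smooth
    (hR.per_p 0 h00) (hR.per_u 0 h00) (hR.per_U 0 h00)
  have hS' := hS.isRelax (by linarith) (by linarith)
  have ep : (fun x => pE.1 (0, x)) = pe ε δ 0 := funext sp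
  have eu : (fun x i => (uE i).1 (0, x)) = ue ε δ 0 := funext fun x => funext fun i => su i x
  have eU : (fun x i j => (UE i j).1 (0, x)) = Ue ε δ 0 :=
    funext fun x => funext fun i => funext fun j => sU i j x
  have hlt : ENNReal.ofReal T0 < ENNReal.ofReal (T0 + τ) :=
    (ENNReal.ofReal_lt_ofReal_iff (by linarith)).2 (by linarith)
  have hTl : ENNReal.ofReal T0 < Tl ε δ := hlt.trans_le (hmax _ _ _ _ hS' ep eu eU)
  refine ⟨hTl, fun t ht => ?_⟩
  have hsub : ∀ {S : ℝ≥0∞}, ENNReal.ofReal T0 < S → Set.Icc 0 T0 ⊆ Itv S := fun hS s hs =>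
    ⟨hs.1, (ENNReal.ofReal_le_ofReal hs.2).trans_lt hS⟩
  have huniq := hR.unique hε hδ hS' (hsub hTl) (hsub hlt) ep eu eU t ht
  have hA : (-1 : ℝ) ≤ -τ := by linarith
  have hb : T0 + τ ≤ T0 + 1 := by linarith
  have htI : t ∈ Set.Ioo (-τ) (T0 + τ) := ⟨by linarith [ht.1], by linarith [ht.2]⟩
  have hE := totE_le_of_initBd hε hεδ hδ1 hA hb (by linarith) (by linarith) hT0.le le_rfl hN hK hB
    (by linarith) (Real.sqrt_pos.2 hδ) (Real.sq_sqrt hδ.le) hM hsM hI (hv 0) hS sp su sU t ht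
  have hV : VelBd ε δ (72 * M + 32 * K) (u t) (ue ε δ t) :=
    velBd_of_totE_le hε hεδ hδ1 htI ((hN t ht).res htI hA hb) ((hB t ht).res htI hA hb) hE
      (fun i x => rfl) fun i x => (congrFun (congrFun huniq x) i).symm
  exact ⟨hV.u, hV.curl, hV.div⟩

end NSRelax
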